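/- (Convergence to a weak solution of the local equation, Lemma 4.2.) Let T > 0, let V : ℝ → ℝ be locally Lipschitz and nondecreasing, let q₀ ∈ L^∞(ℝ) have bounded total variation, and for each η > 0 let q_η be the unique weak solution of the nonlocal conservation law with exponential kernel γ_η and initial datum q₀. Then for every sequence (η_k)_{k∈ℕ} ⊂ (0,∞) with η_k → 0 there exist a subsequence (again denoted η_k) and a function q* ∈ C([0,T];L¹_loc(ℝ)) ∩ L^∞(Ω_T) such that: (i) lim_{k→∞} sup_{t∈[0,T]} ‖W[q_{η_k},γ_{η_k}](t,·) − |q*(t,·)|‖_{L¹(K)} = 0 for every compact K ⊂ ℝ; (ii) q_{η_k} ⇀* q* in L^∞(Ω_T), i.e. ∬_{Ω_T} q_{η_k} g dx dt → ∬_{Ω_T} q* g dx dt for every g ∈ L¹(Ω_T); and (iii) q* is a weak solution of the local conservation law ∂_t q + ∂_x(V(|q|)q) = 0 with initial datum q₀. -/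

import Mathlib

open MeasureTheory Set Filter Function

noncomputable section

/-- The nonlocal term `W[q,γ](t,x) = ∫_{-∞}^x γ(y-x) |q(t,y)| dy`. -/
def nonlocalTerm (γ : ℝ → ℝ) (q : ℝ → ℝ → ℝ) (t x : ℝ) : ℝ :=
  ∫ y in Iic x, γ (y - x) * |q t y|

/-- The exponential kernel `γ_η(x) = exp(x/η)/η`. -/
def expKernel (η : ℝ) (x : ℝ) : ℝ := Real.exp (x / η) / η

/-- An admissible kernel: nonnegative, nondecreasing, convex, of bounded variation,
and of unit mass on `(-∞, 0]`. -/
structure AdmissibleKernel (γ : ℝ → ℝ) : Prop where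
  nonneg : ∀ x ≤ (0:ℝ), 0 ≤ γ x
  mono : MonotoneOn γ (Iic (0:ℝ))
  convex : ConvexOn ℝ (Iic (0:ℝ)) γ
  bv : BoundedVariationOn γ (Iic (0:ℝ))
  mass : (∫ x in Iic (0:ℝ), γ x) = 1

/-- A test function in `C¹_c([0,T) × ℝ)`. -/
structure IsTestFun (T : ℝ) (φ : ℝ → ℝ → ℝ) : Prop where
  smooth : ContDiff ℝ 1 (uncurry φ)
  compSupp : HasCompactSupport (uncurry φ)
  vanish : ∀ t x : ℝ, T ≤ t → φ t x = 0

/-- Membership in `C([0,T]; L¹_loc(ℝ)) ∩ L^∞(Ω_T)`. -/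
structure InSolutionClass (T : ℝ) (q : ℝ → ℝ → ℝ) : Prop where
  meas : Measurable (uncurry q)
  bdd : ∃ M : ℝ, ∀ t x : ℝ, |q t x| ≤ M
  timeCont : ∀ s ∈ Icc (0:ℝ) T, ∀ K : Set ℝ, IsCompact K →
    Tendsto (fun t => ∫ x in K, |q t x - q s x|) (nhdsWithin s (Icc (0:ℝ) T)) (nhds 0)

/-- Weak solution of the nonlocal conservation law
`∂ₜ q + ∂ₓ (V(W[q,γ]) q) = 0`, `q(0,·) = q₀`. -/
def IsWeakSolutionNonlocal (T : ℝ) (V γ q₀ : ℝ → ℝ) (q : ℝ → ℝ → ℝ) : Prop :=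
  ∀ φ : ℝ → ℝ → ℝ, IsTestFun T φ →
    (∫ t in Ioo (0:ℝ) T, ∫ x : ℝ, q t x *
        (deriv (fun s => φ s x) t + deriv (fun y => φ t y) x * V (nonlocalTerm γ q t x)))
      + (∫ x : ℝ, φ 0 x * q₀ x) = 0

/-- Strong solution: Lipschitz on `[0,T] × ℝ` and the PDE holds pointwise a.e. in `Ω_T`. -/
def IsStrongSolutionNonlocal (T : ℝ) (V γ q₀ : ℝ → ℝ) (q : ℝ → ℝ → ℝ) : Prop :=
  (∃ L : NNReal, LipschitzOnWith L (uncurry q) (Icc (0:ℝ) T ×ˢ (univ : Set ℝ))) ∧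
  (∀ x : ℝ, q 0 x = q₀ x) ∧
  (∀ᵐ p : ℝ × ℝ ∂(volume.restrict (Ioo (0:ℝ) T ×ˢ (univ : Set ℝ))),
    deriv (fun s => q s p.2) p.1
      + deriv (fun y => V (nonlocalTerm γ q p.1 y) * q p.1 y) p.2 = 0)

/-- The entropy functional `ℰ[φ,α,q]` (with entropy flux `β`). -/
def entropyE (T : ℝ) (q₀ : ℝ → ℝ) (α β : ℝ → ℝ) (φ : ℝ → ℝ → ℝ) (q : ℝ → ℝ → ℝ) : ℝ :=
  (∫ t in Ioo (0:ℝ) T, ∫ x : ℝ,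
      α (q t x) * deriv (fun s => φ s x) t + β (q t x) * deriv (fun y => φ t y) x)
    + ∫ x : ℝ, α (q₀ x) * φ 0 x

/-- Weak solution of the local conservation law `∂ₜ q + ∂ₓ (V(|q|) q) = 0`. -/
def IsWeakSolutionLocal (T : ℝ) (V q₀ : ℝ → ℝ) (q : ℝ → ℝ → ℝ) : Prop :=
  ∀ φ : ℝ → ℝ → ℝ, IsTestFun T φ →
    (∫ t in Ioo (0:ℝ) T, ∫ x : ℝ, q t x *
        (deriv (fun s => φ s x) t + deriv (fun y => φ t y) x * V |q t x|))
      + (∫ x : ℝ, φ 0 x * q₀ x) = 0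

/-- Entropy solution of the local conservation law. -/
def IsEntropySolutionLocal (T : ℝ) (V q₀ : ℝ → ℝ) (q : ℝ → ℝ → ℝ) : Prop :=
  ∀ α β : ℝ → ℝ, ContDiff ℝ 2 α → ConvexOn ℝ univ α → ContDiff ℝ 1 β →
    (∀ x : ℝ, deriv β x = deriv α x * deriv (fun y => y * V |y|) x) →
    ∀ φ : ℝ → ℝ → ℝ, IsTestFun T φ → (∀ t x : ℝ, 0 ≤ φ t x) →
      0 ≤ entropyE T q₀ α β φ q

open scoped Topology NNReal

/-- A bounded time-dependent vector field that is Lipschitz in space and continuous in time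
has a global integral curve through every point. -/
theorem exists_global_integral_curve {v : ℝ → ℝ → ℝ} {K C : ℝ≥0}
    (hL : ∀ t, LipschitzWith K (v t)) (hc : ∀ x, Continuous fun t => v t x)
    (hb : ∀ t x, |v t x| ≤ C) (t₀ x₀ : ℝ) :
    ∃ α : ℝ → ℝ, α t₀ = x₀ ∧ ∀ t, HasDerivAt α (v t (α t)) t := by
  have hloc : ∀ n : ℕ, ∃ α : ℝ → ℝ, α t₀ = x₀ ∧
      ∀ t ∈ Ioo (t₀ - (n + 1)) (t₀ + (n + 1)), HasDerivAt α (v t (α t)) t := by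
    intro n
    have hn : (0 : ℝ) ≤ n := n.cast_nonneg
    have hmem : t₀ ∈ Icc (t₀ - (n + 1)) (t₀ + (n + 1)) := ⟨by linarith, by linarith⟩
    have hpl : IsPicardLindelof v (⟨t₀, hmem⟩ : Icc (t₀ - (n + 1)) (t₀ + (n + 1)))
        x₀ (C * (n + 1)) 0 C K :=
      { lipschitzOnWith := fun t _ => (hL t).lipschitzOnWith
        continuousOn := fun x _ => (hc x).continuousOn
        norm_le := fun t _ x _ => hb t x
        mul_max_le := by
          have : max (t₀ + (n + 1) - t₀) (t₀ - (t₀ - (n + 1))) = (n : ℝ) + 1 := by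
            rw [max_eq_left] <;> ring_nf
            exact le_rfl
          simp only [this]
          push_cast
          linarith }
    obtain ⟨α, h0, hα⟩ := hpl.exists_eq_forall_mem_Icc_hasDerivWithinAt₀
    exact ⟨α, h0, fun t ht => (hα t (Ioo_subset_Icc_self ht)).hasDerivAt (Icc_mem_nhds ht.1 ht.2)⟩
  choose α h0 hα using hloc
  have hsub : ∀ {m n : ℕ}, m ≤ n → Ioo (t₀ - ((m : ℝ) + 1)) (t₀ + (m + 1)) ⊆
      Ioo (t₀ - ((n : ℝ) + 1)) (t₀ + (n + 1)) := by
    intro m n hmn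
    have : (m : ℝ) ≤ n := by exact_mod_cast hmn
    exact Ioo_subset_Ioo (by linarith) (by linarith)
  have hagree : ∀ {m n : ℕ}, m ≤ n → EqOn (α m) (α n) (Ioo (t₀ - ((m : ℝ) + 1)) (t₀ + (m + 1))) := by
    intro m n hmn
    have hm : (0 : ℝ) ≤ m := m.cast_nonneg
    exact ODE_solution_unique_of_mem_Ioo (s := fun _ => univ)
      (fun t _ => (hL t).lipschitzOnWith) (t₀ := t₀) ⟨by linarith, by linarith⟩
      (fun t ht => ⟨hα m t ht, mem_univ _⟩) (fun t ht => ⟨hα n t (hsub hmn ht), mem_univ _⟩)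
      ((h0 m).trans (h0 n).symm)
  have hdom : ∀ t : ℝ, t ∈ Ioo (t₀ - ((⌈|t - t₀|⌉₊ : ℝ) + 1)) (t₀ + (⌈|t - t₀|⌉₊ + 1)) := by
    intro t
    have h1 := Nat.le_ceil |t - t₀|
    have h2 := abs_le.1 (le_refl |t - t₀|)
    exact ⟨by linarith [h2.1], by linarith [h2.2]⟩
  have heq : ∀ (n : ℕ) (t : ℝ), t ∈ Ioo (t₀ - ((n : ℝ) + 1)) (t₀ + (n + 1)) →
      α ⌈|t - t₀|⌉₊ t = α n t := by
    intro n t ht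
    rcases le_total n ⌈|t - t₀|⌉₊ with h | h
    · exact (hagree h ht).symm
    · exact hagree h (hdom t)
  refine ⟨fun t => α ⌈|t - t₀|⌉₊ t, h0 _, fun t => ?_⟩
  have hev : (fun s => α ⌈|s - t₀|⌉₊ s) =ᶠ[𝓝 t] α ⌈|t - t₀|⌉₊ := by
    filter_upwards [isOpen_Ioo.mem_nhds (hdom t)] with s hs using heq _ s hs
  exact (hα _ t (hdom t)).congr_of_eventuallyEq hev

/-- The flow of a bounded vector field that is Lipschitz in space and continuous in time. -/
theorem exists_flow {v : ℝ → ℝ → ℝ} {K C : ℝ≥0}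
    (hL : ∀ t, LipschitzWith K (v t)) (hc : ∀ x, Continuous fun t => v t x)
    (hb : ∀ t x, |v t x| ≤ C) :
    ∃ X : ℝ → ℝ → ℝ, (∀ a, X 0 a = a) ∧ (∀ t a, HasDerivAt (fun s => X s a) (v t (X t a)) t) ∧
      (∀ t, StrictMono (X t)) ∧ (∀ t, Surjective (X t)) ∧
      ∀ t, 0 ≤ t → ∀ a b, |X t a - X t b| ≤ |a - b| * Real.exp (K * t) := by
  choose X hX0 hX using fun a => exists_global_integral_curve hL hc hb 0 a
  have huniq : ∀ (f g : ℝ → ℝ), (∀ t, HasDerivAt f (v t (f t)) t) →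
      (∀ t, HasDerivAt g (v t (g t)) t) → ∀ t₀, f t₀ = g t₀ → f = g := fun f g hf hg t₀ h =>
    ODE_solution_unique_univ (s := fun _ => univ) (fun t => (hL t).lipschitzOnWith)
      (fun t => ⟨hf t, mem_univ _⟩) (fun t => ⟨hg t, mem_univ _⟩) h
  refine ⟨fun t a => X a t, hX0, fun t a => hX a t, fun t a b hab => ?_, fun t x => ?_, ?_⟩
  · by_contra hcon
    have hcont : Continuous fun s => X b s - X a s :=
      continuous_iff_continuousAt.2 fun s => ((hX b s).sub (hX a s)).continuousAt
    have hmem : (0 : ℝ) ∈ Icc (X b t - X a t) (X b 0 - X a 0) := by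
      rw [hX0, hX0]
      exact ⟨by linarith [not_lt.1 hcon], by linarith⟩
    obtain ⟨s, hs⟩ := mem_range_of_exists_le_of_exists_ge hcont ⟨t, hmem.1⟩ ⟨0, hmem.2⟩
    have := congrFun (huniq (X a) (X b) (hX a) (hX b) s (by linarith [hs])) 0
    rw [hX0, hX0] at this
    exact hab.ne this
  · obtain ⟨α, hα0, hα⟩ := exists_global_integral_curve hL hc hb t x
    change ∃ a, X a t = x
    exact ⟨α 0, by rw [huniq (X (α 0)) α (hX _) hα 0 (hX0 _), hα0]⟩
  · intro t ht a b
    have := dist_le_of_trajectories_ODE (δ := |a - b|) (a := 0) (b := t) hL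
      (fun s _ => (hX a s).continuousAt.continuousWithinAt)
      (fun s _ => (hX a s).hasDerivWithinAt)
      (fun s _ => (hX b s).continuousAt.continuousWithinAt)
      (fun s _ => (hX b s).hasDerivWithinAt) (by rw [hX0, hX0, Real.dist_eq]) t ⟨ht, le_rfl⟩
    simpa [Real.dist_eq] using this

theorem locallyIntegrable_of_bounded {u : ℝ → ℝ} {M : ℝ} (hu : Measurable u)
    (hM : ∀ x, |u x| ≤ M) : LocallyIntegrable u volume :=
  LocallyIntegrable.mono (f := fun _ : ℝ => M) (locallyIntegrable_const M)
    hu.aestronglyMeasurable (ae_of_all _ fun x => by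
      rw [Real.norm_eq_abs, Real.norm_eq_abs]; exact (hM x).trans (le_abs_self M))

theorem intervalIntegrable_of_bounded {u : ℝ → ℝ} {M : ℝ} (hu : Measurable u)
    (hM : ∀ x, |u x| ≤ M) (a b : ℝ) : IntervalIntegrable u volume a b :=
  intervalIntegrable_iff.2 (((locallyIntegrable_of_bounded hu hM).integrableOn_isCompact
    isCompact_uIcc).mono_set uIoc_subset_uIcc)

/-- The exponentially weighted average `∫_{-∞}^x exp((y-x)/η)/η u(y) dy`. -/
def expAvg (η : ℝ) (u : ℝ → ℝ) (x : ℝ) : ℝ :=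
  ∫ y in Iic x, Real.exp ((y - x) / η) / η * u y

theorem integrableOn_expWeight {η : ℝ} (hη : 0 < η) (x b : ℝ) :
    IntegrableOn (fun y => Real.exp ((y - x) / η) / η) (Iic b) := by
  have h := (integrableOn_exp_mul_Iic (inv_pos.2 hη) b).const_mul (Real.exp (-x / η) / η)
  refine h.congr (ae_of_all _ fun y => ?_)
  change Real.exp (-x / η) / η * Real.exp (η⁻¹ * y) = Real.exp ((y - x) / η) / η
  rw [div_mul_eq_mul_div, ← Real.exp_add]
  congr 2
  field_simp
  ring

theorem integral_expWeight {η : ℝ} (hη : 0 < η) (x : ℝ) :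
    ∫ y in Iic x, Real.exp ((y - x) / η) / η = 1 := by
  have h : (fun y => Real.exp ((y - x) / η) / η) =
      fun y => Real.exp (-x / η) / η * Real.exp (η⁻¹ * y) := by
    funext y
    rw [div_mul_eq_mul_div, ← Real.exp_add]
    congr 2
    field_simp
    ring
  rw [h, integral_const_mul, integral_exp_mul_Iic (inv_pos.2 hη), div_inv_eq_mul, mul_comm (Real.exp (η⁻¹ * x)),
    ← mul_assoc, div_mul_cancel₀ _ hη.ne', ← Real.exp_add]
  rw [show -x / η + η⁻¹ * x = 0 by field_simp; ring, Real.exp_zero]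

theorem integrableOn_expWeight_mul {η M : ℝ} (hη : 0 < η) {u : ℝ → ℝ} (hu : Measurable u)
    (hM : ∀ x, |u x| ≤ M) (x b : ℝ) :
    IntegrableOn (fun y => Real.exp ((y - x) / η) / η * u y) (Iic b) :=
  (integrableOn_expWeight hη x b).mul_bdd hu.aestronglyMeasurable (ae_of_all _ hM)

theorem abs_expAvg_le {η M : ℝ} (hη : 0 < η) {u : ℝ → ℝ}
    (hM : ∀ x, |u x| ≤ M) (x : ℝ) : |expAvg η u x| ≤ M := by
  have h : ‖expAvg η u x‖ ≤ ∫ y in Iic x, Real.exp ((y - x) / η) / η * M := by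
    refine norm_integral_le_of_norm_le ((integrableOn_expWeight hη x x).mul_const M)
      (ae_of_all _ fun y => ?_)
    rw [norm_mul, Real.norm_of_nonneg (by positivity)]
    exact mul_le_mul_of_nonneg_left (hM y) (by positivity)
  rwa [integral_mul_const, integral_expWeight hη, one_mul] at h

theorem expAvg_nonneg {η : ℝ} (hη : 0 < η) {u : ℝ → ℝ}
    (hu : ∀ x, 0 ≤ u x) (x : ℝ) : 0 ≤ expAvg η u x :=
  integral_nonneg fun y => mul_nonneg (by positivity) (hu y)

theorem expAvg_eq_add {η M : ℝ} (hη : 0 < η) {u : ℝ → ℝ} (hu : Measurable u)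
    (hM : ∀ x, |u x| ≤ M) {x z : ℝ} (hxz : x ≤ z) :
    expAvg η u z = Real.exp (-z / η) *
      (Real.exp (x / η) * expAvg η u x + ∫ s in x..z, Real.exp (s / η) / η * u s) := by
  have hintg := integrableOn_expWeight_mul hη hu hM z z
  rw [expAvg, ← Iic_union_Ioc_eq_Iic hxz, setIntegral_union (Iic_disjoint_Ioc le_rfl) measurableSet_Ioc
    (hintg.mono_set (Iic_subset_Iic.2 hxz)) (hintg.mono_set Ioc_subset_Iic_self), mul_add, expAvg,
    intervalIntegral.integral_of_le hxz, ← integral_const_mul, ← integral_const_mul,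
    ← integral_const_mul]
  congr 1
  · refine integral_congr_ae (ae_of_all _ fun y => ?_)
    have : Real.exp ((y - z) / η) = Real.exp (-z / η) * (Real.exp (x / η) * Real.exp ((y - x) / η)) := by
      rw [← Real.exp_add, ← Real.exp_add]; congr 1; field_simp; ring
    simp only [this]
    ring
  · refine integral_congr_ae (ae_of_all _ fun y => ?_)
    have : Real.exp ((y - z) / η) = Real.exp (-z / η) * Real.exp (y / η) := by
      rw [← Real.exp_add]; congr 1; field_simp; ring
    simp only [this]
    ring

theorem integral_sub_expAvg {η M : ℝ} (hη : 0 < η) {u : ℝ → ℝ} (hu : Measurable u)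
    (hM : ∀ x, |u x| ≤ M) {x y : ℝ} (hxy : x ≤ y) :
    ∫ z in x..y, (u z - expAvg η u z) = η * (expAvg η u y - expAvg η u x) := by
  set c := Real.exp (x / η) * expAvg η u x
  have hk : IntervalIntegrable (fun s => Real.exp (s / η) / η * u s) volume x y :=
    (intervalIntegrable_of_bounded hu hM x y).continuousOn_mul (by fun_prop)
  have hg : AbsolutelyContinuousOnInterval
      (fun z => c + ∫ s in x..z, Real.exp (s / η) / η * u s) x y :=
    AbsolutelyContinuousOnInterval.fun_add
      (contDiffOn_const.absolutelyContinuousOnInterval)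
      (hk.absolutelyContinuousOnInterval_intervalIntegral left_mem_uIcc)
  have hf : AbsolutelyContinuousOnInterval (fun z : ℝ => Real.exp (-z / η)) x y :=
    ContDiffOn.absolutelyContinuousOnInterval
      (ContDiff.contDiffOn (by fun_prop))
  have hd : ∀ z, deriv (fun z : ℝ => Real.exp (-z / η)) z = - Real.exp (-z / η) / η := by
    intro z
    have : HasDerivAt (fun z : ℝ => Real.exp (-z / η)) (Real.exp (-z / η) * (-1 / η)) z :=
      (((hasDerivAt_id z).neg).div_const η).exp
    rw [this.deriv]; ring
  have key := hf.integral_deriv_mul_eq_sub hg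
  have hval : ∀ z, x ≤ z → Real.exp (-z / η) * (c + ∫ s in x..z, Real.exp (s / η) / η * u s)
      = expAvg η u z := fun z hz => (expAvg_eq_add hη hu hM hz).symm
  rw [hval y hxy, hval x le_rfl] at key
  rw [← key, ← intervalIntegral.integral_const_mul]
  refine intervalIntegral.integral_congr_ae ?_
  filter_upwards [hk.ae_hasDerivAt_integral] with z hz hzm
  have hzm' : z ∈ uIcc x y := uIoc_subset_uIcc hzm
  have h1 := ((hz hzm' x left_mem_uIcc).const_add c).deriv
  rw [h1, hd, uIcc_of_le hxy] at *
  have h2 : Real.exp (-z / η) * Real.exp (z / η) = 1 := by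
    rw [← Real.exp_add]; simp [neg_div]
  have h3 := hval z hzm'.1
  have h4 : -Real.exp (-z / η) / η * (c + ∫ s in x..z, Real.exp (s / η) / η * u s)
      = - expAvg η u z / η := by rw [← h3]; ring
  rw [h4]
  have h5 : Real.exp (-z / η) * (Real.exp (z / η) / η * u z) = u z / η := by
    rw [← mul_assoc, mul_div_assoc', h2]; ring
  rw [h5]
  field_simp
  ring

theorem abs_expAvg_sub_le {η M : ℝ} (hη : 0 < η) {u : ℝ → ℝ} (hu : Measurable u)
    (hM : ∀ x, |u x| ≤ M) (x y : ℝ) :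
    |expAvg η u y - expAvg η u x| ≤ 2 * M / η * |y - x| := by
  wlog hxy : x ≤ y generalizing x y
  · rw [abs_sub_comm, abs_sub_comm y]
    exact this y x (not_le.1 hxy).le
  have h1 : ‖∫ z in x..y, (u z - expAvg η u z)‖ ≤ (2 * M) * |y - x| :=
    intervalIntegral.norm_integral_le_of_norm_le_const fun z _ => by
      have h1 := hM z
      have h2 := abs_expAvg_le hη hM z
      exact (abs_sub _ _).trans (by linarith)
  rw [integral_sub_expAvg hη hu hM hxy, norm_mul, Real.norm_of_nonneg hη.le, Real.norm_eq_abs] at h1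
  rw [div_mul_eq_mul_div, le_div_iff₀ hη]
  linarith

theorem continuous_expAvg {η M : ℝ} (hη : 0 < η) {u : ℝ → ℝ} (hu : Measurable u)
    (hM : ∀ x, |u x| ≤ M) : Continuous (expAvg η u) := by
  refine (LipschitzWith.of_dist_le_mul (K := (2 * M / η).toNNReal) fun x y => ?_).continuous
  rw [Real.dist_eq, Real.dist_eq]
  exact (abs_expAvg_sub_le hη hu hM y x).trans
    (mul_le_mul_of_nonneg_right (Real.le_coe_toNNReal _) (abs_nonneg _))

theorem deriv_smoothTransition_eq_zero {y : ℝ} (hy : y ∉ Icc (0 : ℝ) 1) :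
    deriv Real.smoothTransition y = 0 := by
  rw [mem_Icc, not_and_or, not_le, not_le] at hy
  rcases hy with h | h
  · have : Real.smoothTransition =ᶠ[𝓝 y] fun _ => 0 := by
      filter_upwards [Iio_mem_nhds h] with z hz using Real.smoothTransition.zero_of_nonpos hz.le
    rw [this.deriv_eq, deriv_const]
  · have : Real.smoothTransition =ᶠ[𝓝 y] fun _ => 1 := by
      filter_upwards [Ioi_mem_nhds h] with z hz using Real.smoothTransition.one_of_one_le hz.le
    rw [this.deriv_eq, deriv_const]

theorem exists_bound_deriv_smoothTransition :
    ∃ C : ℝ, 0 ≤ C ∧ ∀ y, |deriv Real.smoothTransition y| ≤ C := by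
  have hc : Continuous (deriv Real.smoothTransition) :=
    (Real.smoothTransition.contDiff (n := 1)).continuous_deriv le_rfl
  obtain ⟨C, hC⟩ := isCompact_Icc.exists_bound_of_continuousOn (hc.continuousOn (s := Icc (0 : ℝ) 1))
  refine ⟨C, (norm_nonneg _).trans (hC 0 ⟨le_rfl, zero_le_one⟩), fun y => ?_⟩
  by_cases hy : y ∈ Icc (0 : ℝ) 1
  · exact hC y hy
  · rw [deriv_smoothTransition_eq_zero hy, abs_zero]
    exact (norm_nonneg _).trans (hC 0 ⟨le_rfl, zero_le_one⟩)

/-- The smoothed indicator of `(p, r]`, with transition layers of width `δ`. -/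
def smoothStrip (δ p r x : ℝ) : ℝ :=
  Real.smoothTransition ((x - p) / δ) - Real.smoothTransition ((x - r) / δ)

theorem abs_smoothStrip_sub_indicator_le {δ p r : ℝ} (hδ : 0 < δ) (hpr : p ≤ r) (x : ℝ) :
    |smoothStrip δ p r x - (Ioc p r).indicator (fun _ => 1) x| ≤
      (Icc p (p + δ)).indicator (fun _ => 1) x + (Icc r (r + δ)).indicator (fun _ => 1) x := by
  have key : ∀ c : ℝ, |Real.smoothTransition ((x - c) / δ) - (Ioi c).indicator (fun _ => 1) x| ≤
      (Icc c (c + δ)).indicator (fun _ => (1 : ℝ)) x := by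
    intro c
    by_cases h1 : x ∈ Icc c (c + δ)
    · rw [indicator_of_mem h1]
      have h2 := Real.smoothTransition.nonneg ((x - c) / δ)
      have h3 := Real.smoothTransition.le_one ((x - c) / δ)
      by_cases h4 : x ∈ Ioi c
      · rw [indicator_of_mem h4, abs_le]; constructor <;> linarith
      · rw [indicator_of_notMem h4, abs_le]; constructor <;> linarith
    · rw [indicator_of_notMem h1]
      rw [mem_Icc, not_and_or, not_le, not_le] at h1
      rcases h1 with h | h
      · rw [Real.smoothTransition.zero_of_nonpos (div_nonpos_of_nonpos_of_nonneg (by linarith) hδ.le),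
          indicator_of_notMem (by simp; linarith)]
        simp
      · rw [Real.smoothTransition.one_of_one_le ((one_le_div hδ).2 (by linarith)),
          indicator_of_mem (by simp; linarith)]
        simp
  have hi : (Ioc p r).indicator (fun _ => (1 : ℝ)) x =
      (Ioi p).indicator (fun _ => 1) x - (Ioi r).indicator (fun _ => 1) x := by
    simp only [indicator_apply, mem_Ioc, mem_Ioi]
    split_ifs <;> first | linarith | (exfalso; grind)
  rw [smoothStrip, hi]
  calc _ = |(Real.smoothTransition ((x - p) / δ) - (Ioi p).indicator (fun _ => 1) x) -
        (Real.smoothTransition ((x - r) / δ) - (Ioi r).indicator (fun _ => 1) x)| := by ring_nf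
    _ ≤ _ := (abs_sub _ _).trans (add_le_add (key p) (key r))

theorem abs_integral_mul_sub_strip_le {f G : ℝ → ℝ} {M B κ δ p r : ℝ} (hf : Measurable f)
    (hM : ∀ x, |f x| ≤ M) (hGm : Measurable G) (hδ : 0 < δ) (hpr : p ≤ r)
    (hG : ∀ x, |G x - κ * (Ioc p r).indicator (fun _ => 1) x| ≤
      B * ((Icc p (p + δ)).indicator (fun _ => 1) x + (Icc r (r + δ)).indicator (fun _ => 1) x)) :
    |(∫ x, f x * G x) - κ * ∫ x in p..r, f x| ≤ M * (B * (2 * δ)) := by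
  have hM0 : 0 ≤ M := (abs_nonneg _).trans (hM 0)
  have hI : ∀ a b : ℝ, Integrable ((Icc a b).indicator fun _ => (1 : ℝ)) := fun a b =>
    (integrable_indicator_iff measurableSet_Icc).2 (by simp [integrableOn_const_iff])
  have hval : ∀ a : ℝ, ∫ x, (Icc a (a + δ)).indicator (fun _ => (1 : ℝ)) x = δ := by
    intro a
    rw [integral_indicator measurableSet_Icc]
    simp [hδ.le]
  have hfI : IntegrableOn f (Ioc p r) :=
    (intervalIntegrable_iff_integrableOn_Ioc_of_le hpr).1 (intervalIntegrable_of_bounded hf hM p r)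
  have hfi : Integrable (fun x => κ * (Ioc p r).indicator f x) :=
    ((integrable_indicator_iff measurableSet_Ioc).2 hfI).const_mul κ
  have hbd : Integrable fun x => M * (B * ((Icc p (p + δ)).indicator (fun _ => 1) x +
      (Icc r (r + δ)).indicator (fun _ => 1) x)) := (((hI _ _).add (hI _ _)).const_mul B).const_mul M
  have hle : ∀ x, ‖f x * G x - κ * (Ioc p r).indicator f x‖ ≤
      M * (B * ((Icc p (p + δ)).indicator (fun _ => 1) x +
      (Icc r (r + δ)).indicator (fun _ => 1) x)) := by
    intro x
    have : f x * G x - κ * (Ioc p r).indicator f x =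
        f x * (G x - κ * (Ioc p r).indicator (fun _ => 1) x) := by
      by_cases h : x ∈ Ioc p r
      · simp only [indicator_of_mem h]; ring
      · simp only [indicator_of_notMem h]; ring
    rw [this, norm_mul]
    exact mul_le_mul (hM x) (hG x) (norm_nonneg _) hM0
  have hdiff : Integrable (fun x => f x * G x - κ * (Ioc p r).indicator f x) :=
    hbd.mono' ((hf.mul hGm).sub ((hf.indicator measurableSet_Ioc).const_mul κ)).aestronglyMeasurable
      (ae_of_all _ hle)
  have hfG : Integrable (fun x => f x * G x) :=
    (hdiff.add hfi).congr (ae_of_all _ fun x => sub_add_cancel _ _)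
  have h1 : (∫ x, f x * G x) - κ * ∫ x in p..r, f x =
      ∫ x, (f x * G x - κ * (Ioc p r).indicator f x) := by
    rw [integral_sub hfG hfi, integral_const_mul, integral_indicator measurableSet_Ioc,
      intervalIntegral.integral_of_le hpr]
  rw [h1, ← Real.norm_eq_abs]
  refine (norm_integral_le_of_norm_le hbd (ae_of_all _ hle)).trans (le_of_eq ?_)
  rw [integral_const_mul, integral_const_mul, integral_add (hI _ _) (hI _ _), hval, hval]
  ring

/-- Continuity in time of the mass between two continuous curves. -/
theorem continuousOn_integral_curves {T M : ℝ} {q : ℝ → ℝ → ℝ} (hqm : Measurable (uncurry q))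
    (hqM : ∀ t x, |q t x| ≤ M)
    (hqc : ∀ s ∈ Icc (0:ℝ) T, ∀ K : Set ℝ, IsCompact K →
      Tendsto (fun t => ∫ x in K, |q t x - q s x|) (nhdsWithin s (Icc (0:ℝ) T)) (nhds 0))
    {xa xb : ℝ → ℝ} (ha : Continuous xa) (hb : Continuous xb) :
    ContinuousOn (fun t => ∫ x in xa t..xb t, q t x) (Icc 0 T) := by
  have hm : ∀ t, Measurable (q t) := fun t => hqm.comp measurable_prodMk_left
  have hi : ∀ t a b, IntervalIntegrable (q t) volume a b := fun t =>
    intervalIntegrable_of_bounded (hm t) (hqM t)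
  intro s hs
  have hbound : ∀ t, dist (∫ x in xa t..xb t, q t x) (∫ x in xa s..xb s, q s x) ≤
      M * |xa s - xa t| + M * |xb t - xb s| + ∫ x in uIcc (xa s) (xb s), |q t x - q s x| := by
    intro t
    have h1 : (∫ x in xa t..xb t, q t x) - ∫ x in xa s..xb s, q s x =
        (∫ x in xa t..xa s, q t x) + (∫ x in xb s..xb t, q t x) +
          ∫ x in xa s..xb s, (q t x - q s x) := by
      rw [intervalIntegral.integral_sub (hi _ _ _) (hi _ _ _),
        ← intervalIntegral.integral_add_adjacent_intervals (hi t (xa t) (xa s)) (hi t (xa s) (xb t)),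
        ← intervalIntegral.integral_add_adjacent_intervals (hi t (xa s) (xb s)) (hi t (xb s) (xb t))]
      ring
    rw [Real.dist_eq, h1]
    have e1 : |∫ x in xa t..xa s, q t x| ≤ M * |xa s - xa t| :=
      (Real.norm_eq_abs _).symm.trans_le
        (intervalIntegral.norm_integral_le_of_norm_le_const fun x _ => hqM t x)
    have e2 : |∫ x in xb s..xb t, q t x| ≤ M * |xb t - xb s| :=
      (Real.norm_eq_abs _).symm.trans_le
        (intervalIntegral.norm_integral_le_of_norm_le_const fun x _ => hqM t x)
    have e3 : |∫ x in xa s..xb s, (q t x - q s x)| ≤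
        ∫ x in uIcc (xa s) (xb s), |q t x - q s x| := by
      rw [← Real.norm_eq_abs]
      refine (intervalIntegral.norm_integral_le_integral_norm_uIoc).trans ?_
      refine setIntegral_mono_set ?_ (ae_of_all _ fun x => abs_nonneg _)
        (LE.le.eventuallyLE uIoc_subset_uIcc)
      refine ((LocallyIntegrable.integrableOn_isCompact ?_ isCompact_uIcc).abs)
      exact (locallyIntegrable_of_bounded (hm t) (hqM t)).sub
        (locallyIntegrable_of_bounded (hm s) (hqM s))
    exact (abs_add_three _ _ _).trans (by linarith)
  rw [ContinuousWithinAt, tendsto_iff_dist_tendsto_zero]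
  refine squeeze_zero (fun _ => dist_nonneg) hbound ?_
  have l1 : Tendsto (fun t => M * |xa s - xa t|) (nhdsWithin s (Icc (0:ℝ) T)) (𝓝 0) := by
    have : Continuous fun t => M * |xa s - xa t| := by fun_prop
    simpa using (this.tendsto s).mono_left nhdsWithin_le_nhds
  have l2 : Tendsto (fun t => M * |xb t - xb s|) (nhdsWithin s (Icc (0:ℝ) T)) (𝓝 0) := by
    have : Continuous fun t => M * |xb t - xb s| := by fun_prop
    simpa using (this.tendsto s).mono_left nhdsWithin_le_nhds
  simpa using (l1.add l2).add (hqc s hs _ isCompact_uIcc)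

theorem hasDerivAt_smoothTransition (y : ℝ) :
    HasDerivAt Real.smoothTransition (deriv Real.smoothTransition y) y :=
  ((Real.smoothTransition.contDiff (n := 1)).differentiable (by simp) y).hasDerivAt

theorem weak_mass_identity {T M M₀ : ℝ} {K : ℝ≥0} (hT : 0 < T) {q v : ℝ → ℝ → ℝ}
    {q₀ : ℝ → ℝ} (hqm : Measurable (uncurry q)) (hqM : ∀ t x, |q t x| ≤ M)
    (hqc : ∀ s ∈ Icc (0:ℝ) T, ∀ K : Set ℝ, IsCompact K →
      Tendsto (fun t => ∫ x in K, |q t x - q s x|) (nhdsWithin s (Icc (0:ℝ) T)) (nhds 0))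
    (hq₀ : Measurable q₀) (hq₀M : ∀ x, |q₀ x| ≤ M₀) (hv : Continuous (uncurry v))
    (hvL : ∀ t, LipschitzWith K (v t))
    (hweak : ∀ φ : ℝ → ℝ → ℝ, IsTestFun T φ →
      (∫ t in Ioo (0:ℝ) T, ∫ x : ℝ, q t x *
        (deriv (fun s => φ s x) t + deriv (fun y => φ t y) x * v t x))
      + (∫ x : ℝ, φ 0 x * q₀ x) = 0)
    {xa xb : ℝ → ℝ} (ha : ∀ t, HasDerivAt xa (v t (xa t)) t)
    (hb : ∀ t, HasDerivAt xb (v t (xb t)) t) (hab : ∀ t, xa t ≤ xb t)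
    {θ : ℝ → ℝ} (hθ : ContDiff ℝ 1 θ) (hθT : ∀ t, T ≤ t → θ t = 0) (hθ0 : ∀ t, t ≤ -2 → θ t = 0) :
    (∫ t in Ioo (0:ℝ) T, deriv θ t * ∫ x in xa t..xb t, q t x) +
      θ 0 * (∫ x in xa 0..xb 0, q₀ x) = 0 := by
  have hxac : Continuous xa := continuous_iff_continuousAt.2 fun t => (ha t).continuousAt
  have hxbc : Continuous xb := continuous_iff_continuousAt.2 fun t => (hb t).continuousAt
  have hxa1 : ContDiff ℝ 1 xa := by
    refine contDiff_one_iff_deriv.2 ⟨fun t => (ha t).differentiableAt, ?_⟩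
    rw [funext fun t => (ha t).deriv]
    exact hv.comp (continuous_id.prodMk hxac)
  have hxb1 : ContDiff ℝ 1 xb := by
    refine contDiff_one_iff_deriv.2 ⟨fun t => (hb t).differentiableAt, ?_⟩
    rw [funext fun t => (hb t).deriv]
    exact hv.comp (continuous_id.prodMk hxbc)
  have hθd : ∀ t, HasDerivAt θ (deriv θ t) t := fun t =>
    (hθ.differentiable (by simp) t).hasDerivAt
  have hθ'c : Continuous (deriv θ) := hθ.continuous_deriv le_rfl
  have hSc : Continuous (deriv Real.smoothTransition) :=
    (Real.smoothTransition.contDiff (n := 1)).continuous_deriv le_rfl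
  obtain ⟨CS, hCS0, hCS⟩ := exists_bound_deriv_smoothTransition
  obtain ⟨C1, hC1⟩ := isCompact_Icc.exists_bound_of_continuousOn
    (hθ.continuous.continuousOn (s := Icc (-2 : ℝ) T))
  obtain ⟨C2, hC2⟩ := isCompact_Icc.exists_bound_of_continuousOn
    (hθ'c.continuousOn (s := Icc (-2 : ℝ) T))
  have hM0 : 0 ≤ M := (abs_nonneg _).trans (hqM 0 0)
  have hM₀0 : 0 ≤ M₀ := (abs_nonneg _).trans (hq₀M 0)
  have hm : ∀ t, Measurable (q t) := fun t => hqm.comp measurable_prodMk_left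
  have hmc := continuousOn_integral_curves hqm hqM hqc hxac hxbc
  set m : ℝ → ℝ := fun t => ∫ x in xa t..xb t, q t x with hmdef
  have hmint : IntegrableOn (fun t => deriv θ t * m t) (Ioo 0 T) :=
    ((hθ'c.continuousOn.mul hmc).integrableOn_Icc).mono_set Ioo_subset_Icc_self
  set B := C2 + C1 * (CS * K) with hB
  have hC10 : 0 ≤ C1 := (norm_nonneg _).trans (hC1 0 ⟨by norm_num, hT.le⟩)
  have hC20 : 0 ≤ C2 := (norm_nonneg _).trans (hC2 0 ⟨by norm_num, hT.le⟩)
  have hKnn : (0:ℝ) ≤ K := K.2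
  have main : ∀ δ : ℝ, 0 < δ → |(∫ t in Ioo (0:ℝ) T, deriv θ t * m t) +
      θ 0 * (∫ x in xa 0..xb 0, q₀ x)| ≤ (M * (B * 2) * T + M₀ * (C1 * 2)) * δ := by
    intro δ hδ
    set φ : ℝ → ℝ → ℝ := fun t x => θ t * smoothStrip δ (xa t) (xb t) x with hφ
    set G : ℝ → ℝ → ℝ := fun t x => deriv θ t * smoothStrip δ (xa t) (xb t) x +
      θ t / δ * (deriv Real.smoothTransition ((x - xa t) / δ) * (v t x - v t (xa t)) -
        deriv Real.smoothTransition ((x - xb t) / δ) * (v t x - v t (xb t))) with hG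
    have hφtest : IsTestFun T φ := by
      refine ⟨?_, ?_, fun t x ht => by simp [hφ, hθT t ht]⟩
      · have hS := Real.smoothTransition.contDiff (n := 1)
        change ContDiff ℝ 1 fun p : ℝ × ℝ => θ p.1 *
          (Real.smoothTransition ((p.2 - xa p.1) / δ) - Real.smoothTransition ((p.2 - xb p.1) / δ))
        exact (hθ.comp contDiff_fst).mul
          ((hS.comp ((contDiff_snd.sub (hxa1.comp contDiff_fst)).div_const δ)).sub
            (hS.comp ((contDiff_snd.sub (hxb1.comp contDiff_fst)).div_const δ)))
      · obtain ⟨ca, hca⟩ := isCompact_Icc.exists_bound_of_continuousOn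
          (hxac.continuousOn (s := Icc (-2 : ℝ) T))
        obtain ⟨cb, hcb⟩ := isCompact_Icc.exists_bound_of_continuousOn
          (hxbc.continuousOn (s := Icc (-2 : ℝ) T))
        refine HasCompactSupport.intro ((isCompact_Icc (a := (-2:ℝ)) (b := T)).prod
          (isCompact_Icc (a := -ca) (b := cb + δ))) ?_
        rintro ⟨t, x⟩ hp
        change θ t * _ = 0
        by_cases ht : t ∈ Icc (-2) T
        · have hx : x ∉ Icc (-ca) (cb + δ) := fun h => hp ⟨ht, h⟩
          have h1 := abs_le.1 (hca t ht)
          have h2 := abs_le.1 (hcb t ht)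
          have h3 := hab t
          rw [mem_Icc, not_and_or, not_le, not_le] at hx
          rcases hx with h | h
          · rw [smoothStrip, Real.smoothTransition.zero_of_nonpos
              (div_nonpos_of_nonpos_of_nonneg (by linarith) hδ.le),
              Real.smoothTransition.zero_of_nonpos
              (div_nonpos_of_nonpos_of_nonneg (by linarith) hδ.le)]
            simp
          · rw [smoothStrip, Real.smoothTransition.one_of_one_le
              ((one_le_div hδ).2 (by linarith)),
              Real.smoothTransition.one_of_one_le ((one_le_div hδ).2 (by linarith))]
            simp
        · rw [mem_Icc, not_and_or, not_le, not_le] at ht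
          rcases ht with h | h
          · rw [hθ0 t h.le, zero_mul]
          · rw [hθT t h.le, zero_mul]
    have hder : ∀ t x, deriv (fun s => φ s x) t + deriv (fun y => φ t y) x * v t x = G t x := by
      intro t x
      have d1 : HasDerivAt (fun s => φ s x) (deriv θ t * smoothStrip δ (xa t) (xb t) x +
          θ t * (deriv Real.smoothTransition ((x - xa t) / δ) * ((0 - v t (xa t)) / δ) -
            deriv Real.smoothTransition ((x - xb t) / δ) * ((0 - v t (xb t)) / δ))) t := by
        refine (hθd t).mul (HasDerivAt.sub ?_ ?_)
        · exact (hasDerivAt_smoothTransition _).comp t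
            (((hasDerivAt_const t x).sub (ha t)).div_const δ)
        · exact (hasDerivAt_smoothTransition _).comp t
            (((hasDerivAt_const t x).sub (hb t)).div_const δ)
      have d2 : HasDerivAt (fun y => φ t y) (θ t *
          (deriv Real.smoothTransition ((x - xa t) / δ) * (1 / δ) -
            deriv Real.smoothTransition ((x - xb t) / δ) * (1 / δ))) x := by
        refine HasDerivAt.const_mul _ (HasDerivAt.sub ?_ ?_)
        · exact (hasDerivAt_smoothTransition _).comp x
            (((hasDerivAt_id x).sub_const (xa t)).div_const δ)
        · exact (hasDerivAt_smoothTransition _).comp x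
            (((hasDerivAt_id x).sub_const (xb t)).div_const δ)
      rw [d1.deriv, d2.deriv]
      simp only [hG]
      ring
    have hGc : Continuous (uncurry G) := by
      have hv1 : Continuous fun p : ℝ × ℝ => v p.1 p.2 := hv
      have hv2 : Continuous fun p : ℝ × ℝ => v p.1 (xa p.1) :=
        hv.comp (continuous_fst.prodMk (hxac.comp continuous_fst))
      have hv3 : Continuous fun p : ℝ × ℝ => v p.1 (xb p.1) :=
        hv.comp (continuous_fst.prodMk (hxbc.comp continuous_fst))
      have hθ1 := hθ.continuous
      have hS1 := Real.smoothTransition.continuous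
      change Continuous fun p : ℝ × ℝ => deriv θ p.1 *
        (Real.smoothTransition ((p.2 - xa p.1) / δ) - Real.smoothTransition ((p.2 - xb p.1) / δ)) +
        θ p.1 / δ * (deriv Real.smoothTransition ((p.2 - xa p.1) / δ) * (v p.1 p.2 - v p.1 (xa p.1)) -
        deriv Real.smoothTransition ((p.2 - xb p.1) / δ) * (v p.1 p.2 - v p.1 (xb p.1)))
      fun_prop
    have hS1 : ∀ t x p, |deriv Real.smoothTransition ((x - p) / δ) * (v t x - v t p)| ≤
        CS * K * δ * (Icc p (p + δ)).indicator (fun _ => 1) x := by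
      intro t x p
      by_cases hx : x ∈ Icc p (p + δ)
      · rw [indicator_of_mem hx, abs_mul]
        have h1 : |v t x - v t p| ≤ K * δ := by
          have := (hvL t).dist_le_mul x p
          rw [Real.dist_eq, Real.dist_eq, abs_of_nonneg (sub_nonneg.2 hx.1)] at this
          exact this.trans (mul_le_mul_of_nonneg_left (by linarith [hx.2]) hKnn)
        calc _ ≤ CS * (K * δ) := mul_le_mul (hCS _) h1 (abs_nonneg _) hCS0
          _ = _ := by ring
      · rw [deriv_smoothTransition_eq_zero, indicator_of_notMem hx]
        · simp
        · intro h
          rw [mem_Icc, le_div_iff₀ hδ, div_le_iff₀ hδ] at h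
          exact hx ⟨by linarith [h.1], by linarith [h.2]⟩
    have hGb : ∀ t ∈ Ioo 0 T, ∀ x, |G t x - deriv θ t * (Ioc (xa t) (xb t)).indicator (fun _ => 1) x| ≤
        B * ((Icc (xa t) (xa t + δ)).indicator (fun _ => 1) x +
          (Icc (xb t) (xb t + δ)).indicator (fun _ => 1) x) := by
      intro t ht x
      have ht' : t ∈ Icc (-2) T := ⟨by linarith [ht.1], ht.2.le⟩
      have h1 := abs_smoothStrip_sub_indicator_le hδ (hab t) x
      have h2 := hS1 t x (xa t)
      have h3 := hS1 t x (xb t)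
      have h4 := hC1 t ht'
      have h5 := hC2 t ht'
      rw [Real.norm_eq_abs] at h4 h5
      set Ia := (Icc (xa t) (xa t + δ)).indicator (fun _ => (1:ℝ)) x
      set Ib := (Icc (xb t) (xb t + δ)).indicator (fun _ => (1:ℝ)) x
      have hIa : 0 ≤ Ia := indicator_nonneg (fun _ _ => zero_le_one) _
      have hIb : 0 ≤ Ib := indicator_nonneg (fun _ _ => zero_le_one) _
      have e1 : |deriv θ t * (smoothStrip δ (xa t) (xb t) x -
          (Ioc (xa t) (xb t)).indicator (fun _ => 1) x)| ≤ C2 * (Ia + Ib) := by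
        rw [abs_mul]
        exact mul_le_mul h5 h1 (abs_nonneg _) hC20
      have e2 : |θ t / δ * (deriv Real.smoothTransition ((x - xa t) / δ) * (v t x - v t (xa t)) -
          deriv Real.smoothTransition ((x - xb t) / δ) * (v t x - v t (xb t)))| ≤
          C1 * (CS * K) * (Ia + Ib) := by
        rw [abs_mul, abs_div, abs_of_pos hδ]
        calc _ ≤ C1 / δ * (CS * K * δ * Ia + CS * K * δ * Ib) := by
              refine mul_le_mul (by gcongr) ((abs_sub _ _).trans (add_le_add h2 h3))
                (abs_nonneg _) (by positivity)
          _ = _ := by field_simp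
      have e3 : G t x - deriv θ t * (Ioc (xa t) (xb t)).indicator (fun _ => 1) x =
        deriv θ t * (smoothStrip δ (xa t) (xb t) x - (Ioc (xa t) (xb t)).indicator (fun _ => 1) x) +
        θ t / δ * (deriv Real.smoothTransition ((x - xa t) / δ) * (v t x - v t (xa t)) -
          deriv Real.smoothTransition ((x - xb t) / δ) * (v t x - v t (xb t))) := by
        simp only [hG]; ring
      rw [e3]
      refine (abs_add_le _ _).trans ((add_le_add e1 e2).trans (le_of_eq ?_))
      rw [hB]; ring
    have hinner : ∀ t ∈ Ioo 0 T, |(∫ x, q t x * G t x) - deriv θ t * m t| ≤ M * (B * (2 * δ)) :=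
      fun t ht => abs_integral_mul_sub_strip_le (hm t) (hqM t)
        (hGc.measurable.comp measurable_prodMk_left) hδ (hab t) (hGb t ht)
    have hinitial : |(∫ x, q₀ x * φ 0 x) - θ 0 * ∫ x in xa 0..xb 0, q₀ x| ≤ M₀ * (C1 * (2 * δ)) := by
      refine abs_integral_mul_sub_strip_le hq₀ hq₀M ?_ hδ (hab 0) fun x => ?_
      · exact (hφtest.smooth.continuous.measurable).comp measurable_prodMk_left
      · simp only [hφ]
        rw [← mul_sub, abs_mul]
        exact mul_le_mul (hC1 0 ⟨by norm_num, hT.le⟩)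
          (abs_smoothStrip_sub_indicator_le hδ (hab 0) x) (abs_nonneg _) hC10
    have hw := hweak φ hφtest
    simp only [hder] at hw
    have hIm : StronglyMeasurable fun t => ∫ x, q t x * G t x := by
      refine StronglyMeasurable.integral_prod_right ?_
      exact (hqm.mul hGc.measurable).stronglyMeasurable
    have hfin : volume (Ioo (0:ℝ) T) < ⊤ := by simp
    have hdI : IntegrableOn (fun t => (∫ x, q t x * G t x) - deriv θ t * m t) (Ioo 0 T) :=
      IntegrableOn.of_bound hfin
        (hIm.aestronglyMeasurable.sub hmint.aestronglyMeasurable) (M * (B * (2 * δ)))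
        ((ae_restrict_iff' measurableSet_Ioo).2 (ae_of_all _ hinner))
    have hI : IntegrableOn (fun t => ∫ x, q t x * G t x) (Ioo 0 T) :=
      (hdI.add hmint).congr (ae_of_all _ fun x => sub_add_cancel _ _)
    have hJ : |(∫ t in Ioo (0:ℝ) T, ∫ x, q t x * G t x) - ∫ t in Ioo (0:ℝ) T, deriv θ t * m t| ≤
        M * (B * (2 * δ)) * T := by
      rw [← integral_sub hI hmint]
      have := norm_setIntegral_le_of_norm_le_const
        (f := fun t => (∫ x, q t x * G t x) - deriv θ t * m t) hfin hinner
      simpa [hT.le] using this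
    have hcomm : (∫ x, φ 0 x * q₀ x) = ∫ x, q₀ x * φ 0 x := by simp only [mul_comm]
    rw [hcomm] at hw
    have a1 := abs_le.1 hJ
    have a2 := abs_le.1 hinitial
    rw [abs_le]
    constructor <;> nlinarith
  by_contra hne
  have hpos := abs_pos.2 hne
  set Q := |(∫ t in Ioo (0:ℝ) T, deriv θ t * m t) + θ 0 * (∫ x in xa 0..xb 0, q₀ x)|
  set D := M * (B * 2) * T + M₀ * (C1 * 2)
  have hD : 0 ≤ D := by positivity
  have := main (Q / (2 * (D + 1))) (by positivity)
  have h2 : D * (Q / (2 * (D + 1))) < Q := by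
    rw [mul_div_assoc', div_lt_iff₀ (by positivity)]
    nlinarith
  linarith

theorem mass_conservation {T M M₀ : ℝ} {K : ℝ≥0} (hT : 0 < T) {q v : ℝ → ℝ → ℝ}
    {q₀ : ℝ → ℝ} (hqm : Measurable (uncurry q)) (hqM : ∀ t x, |q t x| ≤ M)
    (hqc : ∀ s ∈ Icc (0:ℝ) T, ∀ K : Set ℝ, IsCompact K →
      Tendsto (fun t => ∫ x in K, |q t x - q s x|) (nhdsWithin s (Icc (0:ℝ) T)) (nhds 0))
    (hq₀ : Measurable q₀) (hq₀M : ∀ x, |q₀ x| ≤ M₀) (hv : Continuous (uncurry v))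
    (hvL : ∀ t, LipschitzWith K (v t))
    (hweak : ∀ φ : ℝ → ℝ → ℝ, IsTestFun T φ →
      (∫ t in Ioo (0:ℝ) T, ∫ x : ℝ, q t x *
        (deriv (fun s => φ s x) t + deriv (fun y => φ t y) x * v t x))
      + (∫ x : ℝ, φ 0 x * q₀ x) = 0)
    {xa xb : ℝ → ℝ} (ha : ∀ t, HasDerivAt xa (v t (xa t)) t)
    (hb : ∀ t, HasDerivAt xb (v t (xb t)) t) (hab : ∀ t, xa t ≤ xb t) :
    ∀ t ∈ Icc 0 T, ∫ x in xa t..xb t, q t x = ∫ x in xa 0..xb 0, q₀ x := by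
  have hxac : Continuous xa := continuous_iff_continuousAt.2 fun t => (ha t).continuousAt
  have hxbc : Continuous xb := continuous_iff_continuousAt.2 fun t => (hb t).continuousAt
  have hmc := continuousOn_integral_curves hqm hqM hqc hxac hxbc
  set m : ℝ → ℝ := fun t => ∫ x in xa t..xb t, q t x with hmdef
  set c := ∫ x in xa 0..xb 0, q₀ x with hc
  have hmcc : ContinuousOn (fun t => m t - c) (Icc 0 T) := hmc.sub continuousOn_const
  have key : ∀ᵐ t : ℝ, t ∈ Ioo 0 T → m t - c = 0 := by
    refine isOpen_Ioo.ae_eq_zero_of_integral_contDiff_smul_eq_zero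
      ((hmcc.integrableOn_Icc.mono_set Ioo_subset_Icc_self).locallyIntegrableOn) ?_
    intro g hg _ hgs
    have hgc := hg.continuous
    have hg0 : ∀ t, t ∉ Ioo 0 T → g t = 0 := fun t ht =>
      image_eq_zero_of_notMem_tsupport fun h => ht (hgs h)
    have hGd : ∀ t, HasDerivAt (fun u => ∫ x in u..T, g x) (-g t) t := fun t =>
      intervalIntegral.integral_hasDerivAt_left (hgc.intervalIntegrable _ _)
        hgc.stronglyMeasurable.stronglyMeasurableAtFilter hgc.continuousAt
    set θ : ℝ → ℝ := fun t => Real.smoothTransition (t + 2) * ∫ x in t..T, g x with hθ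
    have hG1 : ContDiff ℝ 1 fun u => ∫ x in u..T, g x := by
      refine contDiff_one_iff_deriv.2 ⟨fun t => (hGd t).differentiableAt, ?_⟩
      rw [funext fun t => (hGd t).deriv]
      exact hgc.neg
    have hθ1 : ContDiff ℝ 1 θ :=
      ((Real.smoothTransition.contDiff (n := 1)).comp (contDiff_id.add contDiff_const)).mul hG1
    have hw := weak_mass_identity hT hqm hqM hqc hq₀ hq₀M hv hvL hweak ha hb hab hθ1
      (fun t ht => by
        have : ∫ x in t..T, g x = 0 := by
          rw [intervalIntegral.integral_congr (g := fun _ => 0), intervalIntegral.integral_zero]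
          intro x hx
          rw [uIcc_of_ge ht] at hx
          exact hg0 x fun h => absurd h.2 (not_lt.2 hx.1)
        simp [hθ, this])
      (fun t ht => by
        simp [hθ, Real.smoothTransition.zero_of_nonpos (show t + 2 ≤ 0 by linarith)])
    have hθ' : ∀ t ∈ Ioo 0 T, deriv θ t = -g t := by
      intro t ht
      have : θ =ᶠ[𝓝 t] fun u => ∫ x in u..T, g x := by
        filter_upwards [Ioi_mem_nhds ht.1] with u hu
        rw [mem_Ioi] at hu
        simp [hθ, Real.smoothTransition.one_of_one_le (show 1 ≤ u + 2 by linarith)]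
      rw [this.deriv_eq, (hGd t).deriv]
    have hθ0 : θ 0 = ∫ t in Ioo (0:ℝ) T, g t := by
      simp only [hθ]
      rw [Real.smoothTransition.one_of_one_le (by norm_num), one_mul,
        intervalIntegral.integral_of_le hT.le, integral_Ioc_eq_integral_Ioo]
    have hgi : IntegrableOn g (Ioo 0 T) :=
      hgc.continuousOn.integrableOn_Icc.mono_set Ioo_subset_Icc_self
    have hgm : IntegrableOn (fun t => g t * m t) (Ioo 0 T) :=
      ((hgc.continuousOn.mul hmc).integrableOn_Icc).mono_set Ioo_subset_Icc_self
    have e1 : ∫ t in Ioo (0:ℝ) T, deriv θ t * m t = -∫ t in Ioo (0:ℝ) T, g t * m t := by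
      rw [← integral_neg]
      refine setIntegral_congr_fun measurableSet_Ioo fun t ht => ?_
      simp only [hθ' t ht]; ring
    have e2 : ∫ t, g t • (m t - c) = ∫ t in Ioo (0:ℝ) T, g t • (m t - c) := by
      refine (setIntegral_eq_integral_of_forall_compl_eq_zero fun t ht => ?_).symm
      rw [hg0 t ht, zero_smul]
    rw [e2]
    simp only [smul_eq_mul, mul_sub]
    rw [integral_sub hgm (hgi.mul_const c), integral_mul_const, ← hθ0]
    simp only [hmdef] at e1 ⊢
    rw [e1] at hw
    linarith
  have hae : m =ᵐ[volume.restrict (Icc 0 T)] fun _ => c := by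
    rw [← restrict_Ioo_eq_restrict_Icc]
    refine (ae_restrict_iff' measurableSet_Ioo).2 ?_
    filter_upwards [key] with t ht h using sub_eq_zero.1 (ht h)
  exact Measure.eqOn_Icc_of_ae_eq volume hT.ne hae hmc continuousOn_const

theorem measure_le_of_add_eq_add {α : Type*} [MeasurableSpace α] {P N p n : Measure α}
    (h : P + n = p + N) {D : Set α} (hD : MeasurableSet D) (hP : P Dᶜ = 0) (hN : N D = 0) :
    P ≤ p := by
  refine Measure.le_iff.2 fun E hE => ?_
  have h1 : P E = P (E ∩ D) := by
    rw [← measure_inter_add_sdiff E hD,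
      measure_mono_null (show E \ D ⊆ Dᶜ from fun x hx => hx.2) hP, add_zero]
  have h2 := congrArg (fun μ : Measure α => μ (E ∩ D)) h
  simp only [Measure.add_apply] at h2
  rw [measure_mono_null inter_subset_right hN, add_zero] at h2
  calc P E = P (E ∩ D) := h1
    _ ≤ P (E ∩ D) + n (E ∩ D) := le_self_add
    _ = p (E ∩ D) := h2
    _ ≤ p E := measure_mono inter_subset_left

theorem withDensity_ofReal_Ioc {f : ℝ → ℝ} {M : ℝ} (hf : Measurable f)
    (hM : ∀ x, |f x| ≤ M) {a b : ℝ} (hab : a ≤ b) :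
    (volume.withDensity fun x => ENNReal.ofReal (f x)) (Ioc a b) =
      ENNReal.ofReal (∫ x in a..b, max (f x) 0) := by
  have hi : IntegrableOn (fun x => max (f x) 0) (Ioc a b) := by
    refine (intervalIntegrable_iff_integrableOn_Ioc_of_le hab).1
      (intervalIntegrable_of_bounded (M := M) (hf.max measurable_const) (fun x => ?_) a b)
    rw [abs_of_nonneg (le_max_right _ _)]
    exact max_le ((le_abs_self _).trans (hM x)) ((abs_nonneg _).trans (hM x))
  rw [withDensity_apply _ measurableSet_Ioc, intervalIntegral.integral_of_le hab,
    ofReal_integral_eq_lintegral_ofReal hi (ae_of_all _ fun x => le_max_right _ _)]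
  simp

theorem map_withDensity_ofReal {X f₀ f : ℝ → ℝ} {M : ℝ} (hX : StrictMono X) (hXs : Surjective X)
    (hf₀ : Measurable f₀) (hf₀M : ∀ x, |f₀ x| ≤ M) (hf : Measurable f) (hfM : ∀ x, |f x| ≤ M)
    (h : ∀ a b, a ≤ b → ∫ x in X a..X b, f x = ∫ x in a..b, f₀ x) :
    (volume.withDensity fun x => ENNReal.ofReal (f₀ x)).map X =
      volume.withDensity fun x => ENNReal.ofReal (f x) := by
  have hXm : Measurable X := hX.monotone.measurable
  set e := hX.orderIsoOfSurjective X hXs with he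
  have hem : Measurable e.symm := e.symm.monotone.measurable
  have hXe : ∀ x, X (e.symm x) = x := fun x => e.apply_symm_apply x
  have heX : ∀ a, e.symm (X a) = a := fun a => e.symm_apply_apply a
  have hpre : ∀ a b, X ⁻¹' (Ioc (X a) (X b)) = Ioc a b := fun a b => by
    ext x; simp [hX.lt_iff_lt, hX.le_iff_le]
  set P := (volume.withDensity fun x => ENNReal.ofReal (f₀ x)).map X
  set N := (volume.withDensity fun x => ENNReal.ofReal (-f₀ x)).map X
  set p := volume.withDensity fun x => ENNReal.ofReal (f x)
  set n := volume.withDensity fun x => ENNReal.ofReal (-f x)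
  have hb : ∀ {g : ℝ → ℝ}, (∀ x, |g x| ≤ M) → ∀ x, |-g x| ≤ M := fun hg x => by
    rw [abs_neg]; exact hg x
  have hii : ∀ {g : ℝ → ℝ}, Measurable g → (∀ x, |g x| ≤ M) → ∀ a b,
      IntervalIntegrable (fun x => max (g x) 0) volume a b := fun hg hgM a b =>
    intervalIntegrable_of_bounded (M := M) (hg.max measurable_const) (fun x => by
      rw [abs_of_nonneg (le_max_right _ _)]
      exact max_le ((le_abs_self _).trans (hgM x)) ((abs_nonneg _).trans (hgM x))) a b
  have hsum : P + n = p + N := by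
    refine Measure.ext_of_Ioc' _ _ (fun x y hxy => ?_) fun x y hxy => ?_
    · obtain ⟨a, rfl⟩ := hXs x
      obtain ⟨b, rfl⟩ := hXs y
      have hab := (hX.lt_iff_lt.1 hxy).le
      rw [Measure.add_apply, Measure.map_apply hXm measurableSet_Ioc, hpre,
        withDensity_ofReal_Ioc hf₀ hf₀M hab, withDensity_ofReal_Ioc (f := fun x => -f x) hf.neg (hb hfM) hxy.le]
      exact ENNReal.add_ne_top.2 ⟨ENNReal.ofReal_ne_top, ENNReal.ofReal_ne_top⟩
    · obtain ⟨a, rfl⟩ := hXs x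
      obtain ⟨b, rfl⟩ := hXs y
      have hab := (hX.lt_iff_lt.1 hxy).le
      rw [Measure.add_apply, Measure.add_apply, Measure.map_apply hXm measurableSet_Ioc, hpre,
        Measure.map_apply hXm measurableSet_Ioc, hpre,
        withDensity_ofReal_Ioc hf₀ hf₀M hab, withDensity_ofReal_Ioc (f := fun x => -f x) hf.neg (hb hfM) hxy.le,
        withDensity_ofReal_Ioc hf hfM hxy.le, withDensity_ofReal_Ioc (f := fun x => -f₀ x) hf₀.neg (hb hf₀M) hab,
        ← ENNReal.ofReal_add, ← ENNReal.ofReal_add]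
      · congr 1
        have e1 : ∀ {g : ℝ → ℝ}, Measurable g → (∀ x, |g x| ≤ M) → ∀ a b : ℝ,
            ∫ x in a..b, g x = (∫ x in a..b, max (g x) 0) - ∫ x in a..b, max (-g x) 0 := by
          intro g hg hgM a b
          rw [← intervalIntegral.integral_sub (hii hg hgM a b)
            (hii (g := fun x => -g x) hg.neg (hb hgM) a b)]
          refine intervalIntegral.integral_congr fun x _ => ?_
          rcases le_total (g x) 0 with h | h
          · rw [max_eq_right h, max_eq_left (by linarith)]; ring
          · rw [max_eq_left h, max_eq_right (by linarith)]; ring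
        have := h a b hab
        rw [e1 hf hfM, e1 hf₀ hf₀M] at this
        linarith
      all_goals
        refine intervalIntegral.integral_nonneg ?_ fun x _ => le_max_right _ _
        first | exact hab | exact hxy.le
  refine le_antisymm ?_ ?_
  · have hD : MeasurableSet {x | 0 < f₀ (e.symm x)} :=
      measurableSet_lt measurable_const (hf₀.comp hem)
    refine measure_le_of_add_eq_add hsum hD ?_ ?_
    · rw [Measure.map_apply hXm hD.compl,
        withDensity_apply_eq_zero hf₀.ennreal_ofReal]
      convert measure_empty (μ := (volume : Measure ℝ))
      ext x; simp [heX]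
    · rw [Measure.map_apply hXm hD,
        withDensity_apply_eq_zero (f := fun x => ENNReal.ofReal (-f₀ x)) hf₀.neg.ennreal_ofReal]
      convert measure_empty (μ := (volume : Measure ℝ))
      ext x; simp [heX]; intro h; linarith
  · refine measure_le_of_add_eq_add hsum.symm (D := {x | 0 < f x})
      (measurableSet_lt measurable_const hf) ?_ ?_
    · rw [withDensity_apply_eq_zero hf.ennreal_ofReal]
      convert measure_empty (μ := (volume : Measure ℝ))
      ext x; simp
    · rw [withDensity_apply_eq_zero (f := fun x => ENNReal.ofReal (-f x)) hf.neg.ennreal_ofReal]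
      convert measure_empty (μ := (volume : Measure ℝ))
      ext x; simp; intro h; linarith

theorem map_withDensity_abs {X f₀ f : ℝ → ℝ} {M : ℝ} (hX : StrictMono X) (hXs : Surjective X)
    (hf₀ : Measurable f₀) (hf₀M : ∀ x, |f₀ x| ≤ M) (hf : Measurable f) (hfM : ∀ x, |f x| ≤ M)
    (h : ∀ a b, a ≤ b → ∫ x in X a..X b, f x = ∫ x in a..b, f₀ x) :
    (volume.withDensity fun x => ENNReal.ofReal |f₀ x|).map X =
      volume.withDensity fun x => ENNReal.ofReal |f x| := by
  have hXm : Measurable X := hX.monotone.measurable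
  have key : ∀ {g : ℝ → ℝ}, Measurable g → (volume.withDensity fun x => ENNReal.ofReal |g x|) =
      (volume.withDensity fun x => ENNReal.ofReal (g x)) +
        volume.withDensity fun x => ENNReal.ofReal (-g x) := by
    intro g hg
    rw [← withDensity_add_left hg.ennreal_ofReal]
    congr 1
    funext x
    rw [Pi.add_apply]
    rcases le_total 0 (g x) with h | h
    · rw [abs_of_nonneg h, ENNReal.ofReal_of_nonpos (p := -g x) (by linarith), add_zero]
    · rw [abs_of_nonpos h, ENNReal.ofReal_of_nonpos (p := g x) h, zero_add]
  rw [key hf₀, key hf, Measure.map_add _ _ hXm,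
    map_withDensity_ofReal hX hXs hf₀ hf₀M hf hfM h,
    map_withDensity_ofReal hX hXs (f₀ := fun x => -f₀ x) hf₀.neg (f := fun x => -f x) (M := M) (by simpa using hf₀M)
      hf.neg (by simpa using hfM)
      (by simpa [intervalIntegral.integral_neg] using h)]

/-- Change of variables along a monotone transport of signed densities. -/
theorem integral_comp_mul_abs {X f₀ f : ℝ → ℝ} {M : ℝ} (hX : StrictMono X) (hXs : Surjective X)
    (hf₀ : Measurable f₀) (hf₀M : ∀ x, |f₀ x| ≤ M) (hf : Measurable f) (hfM : ∀ x, |f x| ≤ M)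
    (h : ∀ a b, a ≤ b → ∫ x in X a..X b, f x = ∫ x in a..b, f₀ x) {g : ℝ → ℝ} (hg : Measurable g) :
    ∫ a, g (X a) * |f₀ a| = ∫ x, g x * |f x| := by
  have hXm : Measurable X := hX.monotone.measurable
  have key : ∀ {k : ℝ → ℝ}, Measurable k → ∀ G : ℝ → ℝ, ∫ x, G x * |k x| =
      ∫ x, G x ∂(volume.withDensity fun x => ENNReal.ofReal |k x|) := by
    intro k hk G
    rw [integral_withDensity_eq_integral_toReal_smul hk.abs.ennreal_ofReal
      (ae_of_all _ fun x => ENNReal.ofReal_lt_top)]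
    refine integral_congr_ae (ae_of_all _ fun x => ?_)
    simp [mul_comm]
  rw [key hf₀ fun a => g (X a), key hf g, ← map_withDensity_abs hX hXs hf₀ hf₀M hf hfM h,
    integral_map hXm.aemeasurable hg.aestronglyMeasurable]

theorem integral_abs_transport {X f₀ f : ℝ → ℝ} {M : ℝ} (hX : StrictMono X) (hXs : Surjective X)
    (hf₀ : Measurable f₀) (hf₀M : ∀ x, |f₀ x| ≤ M) (hf : Measurable f) (hfM : ∀ x, |f x| ≤ M)
    (h : ∀ a b, a ≤ b → ∫ x in X a..X b, f x = ∫ x in a..b, f₀ x) {a b : ℝ} (hab : a ≤ b) :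
    ∫ x in X a..X b, |f x| = ∫ x in a..b, |f₀ x| := by
  have := integral_comp_mul_abs hX hXs hf₀ hf₀M hf hfM h
    (g := (Ioc (X a) (X b)).indicator fun _ => 1) (measurable_const.indicator measurableSet_Ioc)
  rw [intervalIntegral.integral_of_le hab, intervalIntegral.integral_of_le (hX.monotone hab),
    ← integral_indicator measurableSet_Ioc, ← integral_indicator measurableSet_Ioc]
  refine Eq.trans (integral_congr_ae (ae_of_all _ fun x => ?_)) (this.symm.trans
    (integral_congr_ae (ae_of_all _ fun x => ?_)))
  · by_cases hx : x ∈ Ioc (X a) (X b)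
    · simp only [indicator_of_mem hx, one_mul]
    · simp only [indicator_of_notMem hx, zero_mul]
  · by_cases hx : x ∈ Ioc a b
    · have hx' : X x ∈ Ioc (X a) (X b) := ⟨hX hx.1, hX.monotone hx.2⟩
      simp only [indicator_of_mem hx, indicator_of_mem hx', one_mul]
    · have hx' : X x ∉ Ioc (X a) (X b) := fun h => hx ⟨hX.lt_iff_lt.1 h.1, hX.le_iff_le.1 h.2⟩
      simp only [indicator_of_notMem hx, indicator_of_notMem hx', zero_mul]

theorem expAvg_abs_transport {η : ℝ} {X f₀ f : ℝ → ℝ} {M : ℝ} (hX : StrictMono X)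
    (hXs : Surjective X)
    (hf₀ : Measurable f₀) (hf₀M : ∀ x, |f₀ x| ≤ M) (hf : Measurable f) (hfM : ∀ x, |f x| ≤ M)
    (h : ∀ a b, a ≤ b → ∫ x in X a..X b, f x = ∫ x in a..b, f₀ x) (A : ℝ) :
    expAvg η (fun x => |f x|) (X A) =
      ∫ a in Iic A, Real.exp ((X a - X A) / η) / η * |f₀ a| := by
  have := integral_comp_mul_abs hX hXs hf₀ hf₀M hf hfM h
    (g := (Iic (X A)).indicator fun y => Real.exp ((y - X A) / η) / η)
    (Measurable.indicator (by fun_prop) measurableSet_Iic)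
  rw [expAvg, ← integral_indicator measurableSet_Iic, ← integral_indicator measurableSet_Iic]
  refine Eq.trans (integral_congr_ae (ae_of_all _ fun x => ?_)) (this.symm.trans
    (integral_congr_ae (ae_of_all _ fun x => ?_)))
  · by_cases hx : x ∈ Iic (X A)
    · simp only [indicator_of_mem hx]
    · simp only [indicator_of_notMem hx, zero_mul]
  · by_cases hx : x ∈ Iic A
    · have hx' : X x ∈ Iic (X A) := hX.monotone hx
      simp only [indicator_of_mem hx, indicator_of_mem hx']
    · have hx' : X x ∉ Iic (X A) := fun h => hx (hX.le_iff_le.1 h)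
      simp only [indicator_of_notMem hx, indicator_of_notMem hx', zero_mul]

/-- A bounded density `q` transported by the characteristics `X` of the velocity field
`v = V(W[q, γ_η])`, on the time interval `[0, T]`. -/
structure CharacteristicFlow (T η M₀ M L C E : ℝ) (V q₀ : ℝ → ℝ) (q v X : ℝ → ℝ → ℝ) : Prop where
  T_pos : 0 < T
  η_pos : 0 < η
  L_nonneg : 0 ≤ L
  meas_initial : Measurable q₀
  abs_initial_le : ∀ x, |q₀ x| ≤ M₀
  meas : ∀ t, Measurable (q t)
  abs_dens_le : ∀ t x, |q t x| ≤ M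
  initial_le : M₀ ≤ M
  mono : Monotone V
  lip : ∀ x y, |V x - V y| ≤ L * |x - y|
  cont : Continuous (uncurry v)
  abs_vel_le : ∀ t x, |v t x| ≤ C
  vel_eq : ∀ t ∈ Icc 0 T, ∀ x, v t x = V (expAvg η (fun y => |q t y|) x)
  flow_zero : ∀ a, X 0 a = a
  flow_deriv : ∀ t a, HasDerivAt (fun s => X s a) (v t (X t a)) t
  flow_mono : ∀ t, StrictMono (X t)
  flow_surj : ∀ t, Surjective (X t)
  E_nonneg : 0 ≤ E
  flow_lip : ∀ t ∈ Icc 0 T, ∀ a b, |X t a - X t b| ≤ E * |a - b|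
  mass : ∀ t ∈ Icc 0 T, ∀ a b, a ≤ b → ∫ x in X t a..X t b, q t x = ∫ x in a..b, q₀ x

/-- The nonlocal term along the characteristic starting at `A`. -/
def lagW (η : ℝ) (q₀ : ℝ → ℝ) (X : ℝ → ℝ → ℝ) (t A : ℝ) : ℝ :=
  ∫ a in Iic A, Real.exp ((X t a - X t A) / η) / η * |q₀ a|

/-- `η` times the time derivative of `lagW`. -/
def lagH (η : ℝ) (q₀ : ℝ → ℝ) (v X : ℝ → ℝ → ℝ) (t A : ℝ) : ℝ :=
  ∫ a in Iic A, Real.exp ((X t a - X t A) / η) / η * |q₀ a| * (v t (X t a) - v t (X t A))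

namespace CharacteristicFlow

variable {T η M₀ M L C E : ℝ} {V q₀ : ℝ → ℝ} {q v X : ℝ → ℝ → ℝ}

theorem C_nonneg (h : CharacteristicFlow T η M₀ M L C E V q₀ q v X) : 0 ≤ C :=
  (abs_nonneg _).trans (h.abs_vel_le 0 0)

theorem M₀_nonneg (h : CharacteristicFlow T η M₀ M L C E V q₀ q v X) : 0 ≤ M₀ :=
  (abs_nonneg _).trans (h.abs_initial_le 0)

theorem abs_flow_sub_le (h : CharacteristicFlow T η M₀ M L C E V q₀ q v X) (t a : ℝ) :
    |X t a - a| ≤ C * |t| := by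
  have := Convex.norm_image_sub_le_of_norm_hasDerivWithin_le (f := fun s => X s a)
    (f' := fun s => v s (X s a)) (s := univ) (C := C) (x := 0) (y := t)
    (fun s _ => (h.flow_deriv s a).hasDerivWithinAt) (fun s _ => h.abs_vel_le s _) convex_univ
    trivial trivial
  simpa [h.flow_zero] using this

theorem meas_flow (h : CharacteristicFlow T η M₀ M L C E V q₀ q v X) (t : ℝ) :
    Measurable (X t) := (h.flow_mono t).monotone.measurable

theorem meas_vel (h : CharacteristicFlow T η M₀ M L C E V q₀ q v X) (t : ℝ) :
    Measurable fun a => v t (X t a) :=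
  (h.cont.measurable.comp measurable_prodMk_left).comp (h.meas_flow t)

theorem cont_flow (h : CharacteristicFlow T η M₀ M L C E V q₀ q v X) (a : ℝ) :
    Continuous fun t => X t a :=
  continuous_iff_continuousAt.2 fun t => (h.flow_deriv t a).continuousAt

theorem cont_vel (h : CharacteristicFlow T η M₀ M L C E V q₀ q v X) (a : ℝ) :
    Continuous fun t => v t (X t a) := h.cont.comp (continuous_id.prodMk (h.cont_flow a))

theorem weight_le (h : CharacteristicFlow T η M₀ M L C E V q₀ q v X) {t s : ℝ}
    (hs : |s| ≤ t) (a A : ℝ) :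
    Real.exp ((X s a - X s A) / η) / η ≤
      Real.exp ((a - A) / η) / η * Real.exp (2 * C * t / η) := by
  have h1 := abs_le.1 (h.abs_flow_sub_le s a)
  have h2 := abs_le.1 (h.abs_flow_sub_le s A)
  have h3 := mul_le_mul_of_nonneg_left hs h.C_nonneg
  have hη := h.η_pos
  rw [div_mul_eq_mul_div, ← Real.exp_add, ← add_div]
  gcongr
  linarith

theorem integrableOn_weight (h : CharacteristicFlow T η M₀ M L C E V q₀ q v X) (t A b : ℝ) :
    IntegrableOn (fun a => Real.exp ((X t a - X t A) / η) / η) (Iic b) := by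
  have hη := h.η_pos
  have hX := h.meas_flow t
  refine ((integrableOn_expWeight hη A b).mul_const (Real.exp (2 * C * |t| / η))).mono'
    (Measurable.aestronglyMeasurable (by fun_prop)) (ae_of_all _ fun a => ?_)
  rw [Real.norm_of_nonneg (by positivity)]
  exact h.weight_le le_rfl a A

theorem integrableOn_weight_mul (h : CharacteristicFlow T η M₀ M L C E V q₀ q v X) (t A b : ℝ)
    {f : ℝ → ℝ} {D : ℝ} (hf : Measurable f) (hD : ∀ x, |f x| ≤ D) :
    IntegrableOn (fun a => Real.exp ((X t a - X t A) / η) / η * |q₀ a| * f a) (Iic b) := by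
  simp only [mul_assoc]
  refine (h.integrableOn_weight t A b).mul_bdd (c := M₀ * D)
    (h.meas_initial.abs.mul hf).aestronglyMeasurable (ae_of_all _ fun a => ?_)
  rw [norm_mul, Real.norm_eq_abs, Real.norm_eq_abs, abs_abs]
  exact mul_le_mul (h.abs_initial_le a) (hD a) (abs_nonneg _) h.M₀_nonneg

theorem integrableOn_weight_initial (h : CharacteristicFlow T η M₀ M L C E V q₀ q v X) (t A b : ℝ) :
    IntegrableOn (fun a => Real.exp ((X t a - X t A) / η) / η * |q₀ a|) (Iic b) := by
  simpa using h.integrableOn_weight_mul t A b (f := fun _ => 1) (D := 1) measurable_const (by simp)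

theorem hasDerivAt_lagW (h : CharacteristicFlow T η M₀ M L C E V q₀ q v X) (t A : ℝ) :
    HasDerivAt (fun s => lagW η q₀ X s A) (lagH η q₀ v X t A / η) t := by
  have hη := h.η_pos
  have hC := h.C_nonneg
  have hM := h.M₀_nonneg
  have hq₀ := h.meas_initial
  have key := hasDerivAt_integral_of_dominated_loc_of_deriv_le (μ := volume.restrict (Iic A))
    (F := fun s a => Real.exp ((X s a - X s A) / η) / η * |q₀ a|)
    (F' := fun s a => Real.exp ((X s a - X s A) / η) * ((v s (X s a) - v s (X s A)) / η) / η * |q₀ a|)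
    (x₀ := t) (s := Metric.ball t 1)
    (bound := fun a => Real.exp ((a - A) / η) / η *
      (Real.exp (2 * C * (|t| + 1) / η) * (2 * C / η) * M₀)) (Metric.ball_mem_nhds t one_pos)
    (Eventually.of_forall fun s => by
      have := h.meas_flow s
      exact Measurable.aestronglyMeasurable (by fun_prop))
    (h.integrableOn_weight_initial t A A)
    (by
      have hX := h.meas_flow t
      have hv := h.meas_vel t
      exact ((((hX.sub_const _).div_const η).exp.mul ((hv.sub_const _).div_const η)).div_const
        η).mul hq₀.abs |>.aestronglyMeasurable)
    (ae_of_all _ fun a s hs => by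
      have hs' : |s| ≤ |t| + 1 := by
        rw [Metric.mem_ball, Real.dist_eq] at hs
        have := abs_sub_abs_le_abs_sub s t
        linarith
      have h1 := h.weight_le hs' a A
      have h2 : |(v s (X s a) - v s (X s A)) / η| ≤ 2 * C / η := by
        rw [abs_div, abs_of_pos hη]
        have e1 := h.abs_vel_le s (X s a)
        have e2 := h.abs_vel_le s (X s A)
        have := (abs_sub (v s (X s a)) (v s (X s A)))
        gcongr
        linarith
      calc ‖Real.exp ((X s a - X s A) / η) * ((v s (X s a) - v s (X s A)) / η) / η * |q₀ a|‖
          = Real.exp ((X s a - X s A) / η) / η * |(v s (X s a) - v s (X s A)) / η| * |q₀ a| := by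
            rw [norm_mul, norm_div, norm_mul, Real.norm_of_nonneg (Real.exp_pos _).le,
              Real.norm_of_nonneg hη.le, Real.norm_eq_abs, Real.norm_eq_abs, abs_abs]
            ring
        _ ≤ (Real.exp ((a - A) / η) / η * Real.exp (2 * C * (|t| + 1) / η)) * (2 * C / η) * M₀ := by
            gcongr
            exact h.abs_initial_le a
        _ = _ := by ring)
    ((integrableOn_expWeight hη A A).mul_const _)
    (ae_of_all _ fun a s _ => by
      exact (((((h.flow_deriv s a).sub (h.flow_deriv s A)).div_const η).exp).div_const η).mul_const _)
  refine key.2.congr_deriv ?_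
  rw [lagH, ← integral_div]
  refine integral_congr_ae (ae_of_all _ fun a => ?_)
  simp only
  ring

theorem continuous_lagH (h : CharacteristicFlow T η M₀ M L C E V q₀ q v X) (A : ℝ) :
    Continuous fun t => lagH η q₀ v X t A := by
  have hη := h.η_pos
  have hC := h.C_nonneg
  have hM := h.M₀_nonneg
  have hq₀ := h.meas_initial
  refine continuous_iff_continuousAt.2 fun t => ?_
  refine continuousAt_of_dominated (bound := fun a => Real.exp ((a - A) / η) / η *
      (Real.exp (2 * C * (|t| + 1) / η) * M₀ * (2 * C))) ?_ ?_
    ((integrableOn_expWeight hη A A).mul_const _) (ae_of_all _ fun a => ?_)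
  · refine Eventually.of_forall fun s => ?_
    have hX := h.meas_flow s
    have hv := h.meas_vel s
    exact (((((hX.sub_const _).div_const η).exp).div_const η).mul hq₀.abs).mul
      (hv.sub_const _) |>.aestronglyMeasurable
  · filter_upwards [Metric.ball_mem_nhds t one_pos] with s hs
    refine ae_of_all _ fun a => ?_
    have hs' : |s| ≤ |t| + 1 := by
      rw [Metric.mem_ball, Real.dist_eq] at hs
      have := abs_sub_abs_le_abs_sub s t
      linarith
    have h1 := h.weight_le hs' a A
    have h2 : |v s (X s a) - v s (X s A)| ≤ 2 * C := by
      have e1 := h.abs_vel_le s (X s a)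
      have e2 := h.abs_vel_le s (X s A)
      have := (abs_sub (v s (X s a)) (v s (X s A)))
      linarith
    rw [norm_mul, norm_mul, Real.norm_of_nonneg (by positivity), Real.norm_eq_abs,
      Real.norm_eq_abs, abs_abs]
    calc _ ≤ (Real.exp ((a - A) / η) / η * Real.exp (2 * C * (|t| + 1) / η)) * M₀ * (2 * C) := by
          gcongr
          exact h.abs_initial_le a
      _ = _ := by ring
  · have h1 := h.cont_flow a
    have h2 := h.cont_flow A
    have h3 := h.cont_vel a
    have h4 := h.cont_vel A
    exact (Continuous.mul (by fun_prop) (h3.sub h4)).continuousAt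

theorem lagW_eq (h : CharacteristicFlow T η M₀ M L C E V q₀ q v X) {t : ℝ} (ht : t ∈ Icc 0 T)
    (A : ℝ) : lagW η q₀ X t A = expAvg η (fun y => |q t y|) (X t A) :=
  (expAvg_abs_transport (h.flow_mono t) (h.flow_surj t) h.meas_initial
    (fun x => (h.abs_initial_le x).trans h.initial_le) (h.meas t) (h.abs_dens_le t) (h.mass t ht) A).symm

theorem vel_flow_eq (h : CharacteristicFlow T η M₀ M L C E V q₀ q v X) {t : ℝ} (ht : t ∈ Icc 0 T)
    (A : ℝ) : v t (X t A) = V (lagW η q₀ X t A) := by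
  rw [h.lagW_eq ht, h.vel_eq t ht]

theorem integral_abs_eq (h : CharacteristicFlow T η M₀ M L C E V q₀ q v X) {t : ℝ}
    (ht : t ∈ Icc 0 T) {a b : ℝ} (hab : a ≤ b) :
    ∫ x in X t a..X t b, |q t x| = ∫ x in a..b, |q₀ x| :=
  integral_abs_transport (h.flow_mono t) (h.flow_surj t) h.meas_initial
    (fun x => (h.abs_initial_le x).trans h.initial_le) (h.meas t) (h.abs_dens_le t) (h.mass t ht) hab

theorem lagW_nonneg (h : CharacteristicFlow T η M₀ M L C E V q₀ q v X) (t A : ℝ) :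
    0 ≤ lagW η q₀ X t A := by
  have := h.η_pos
  exact integral_nonneg fun a => by positivity

theorem lagW_le_bound (h : CharacteristicFlow T η M₀ M L C E V q₀ q v X) {t : ℝ}
    (ht : t ∈ Icc 0 T) (A : ℝ) : lagW η q₀ X t A ≤ M := by
  rw [h.lagW_eq ht]
  exact (le_abs_self _).trans (abs_expAvg_le h.η_pos (fun x => by simpa using h.abs_dens_le t x) _)

theorem lagW_zero_le (h : CharacteristicFlow T η M₀ M L C E V q₀ q v X) (A : ℝ) :
    lagW η q₀ X 0 A ≤ M₀ := by
  have : lagW η q₀ X 0 A = expAvg η (fun y => |q₀ y|) A := by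
    simp only [lagW, expAvg, h.flow_zero]
  rw [this]
  exact (le_abs_self _).trans (abs_expAvg_le h.η_pos (fun x => by simpa using h.abs_initial_le x) _)

theorem lagH_le (h : CharacteristicFlow T η M₀ M L C E V q₀ q v X) {t S : ℝ} (ht : t ∈ Icc 0 T)
    (hS : ∀ a, lagW η q₀ X t a ≤ S) (A : ℝ) :
    lagH η q₀ v X t A ≤ L * (S - lagW η q₀ X t A) * lagW η q₀ X t A := by
  have hη := h.η_pos
  rw [lagH, lagW, ← integral_const_mul, ← lagW]
  refine setIntegral_mono (h.integrableOn_weight_mul t A A (D := 2 * C)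
      ((h.meas_vel t).sub measurable_const) fun a => ?_)
    ((h.integrableOn_weight_initial t A A).const_mul _) fun a => ?_
  · have e1 := h.abs_vel_le t (X t a)
    have e2 := h.abs_vel_le t (X t A)
    have := (abs_sub (v t (X t a)) (v t (X t A)))
    linarith
  · have h1 : v t (X t a) - v t (X t A) ≤ L * (S - lagW η q₀ X t A) := by
      rw [h.vel_flow_eq ht, h.vel_flow_eq ht]
      have e1 := h.mono (hS a)
      have e2 := (le_abs_self _).trans (h.lip S (lagW η q₀ X t A))
      rw [abs_of_nonneg (sub_nonneg.2 (hS A))] at e2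
      linarith
    rw [mul_comm (L * (S - lagW η q₀ X t A))]
    exact mul_le_mul_of_nonneg_left h1 (by positivity)

theorem lagW_le_of_le (h : CharacteristicFlow T η M₀ M L C E V q₀ q v X) {S : ℝ}
    (hS : ∀ t ∈ Icc 0 T, ∀ a, lagW η q₀ X t a ≤ S) {t : ℝ} (ht : t ∈ Icc 0 T) (A : ℝ) :
    lagW η q₀ X t A ≤ S - (S - M₀) * Real.exp (-(L * M / η * t)) := by
  have hη := h.η_pos
  set K := L * M / η with hK
  have hmono : MonotoneOn (fun s => Real.exp (K * s) * (S - lagW η q₀ X s A)) (Icc 0 T) := by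
    refine monotoneOn_of_hasDerivWithinAt_nonneg (convex_Icc 0 T)
      (f' := fun s => Real.exp (K * s) * (K * 1) * (S - lagW η q₀ X s A) +
        Real.exp (K * s) * (-(lagH η q₀ v X s A / η))) ?_ ?_ ?_
    · refine fun s _ => ContinuousAt.continuousWithinAt ?_
      refine ContinuousAt.mul (by fun_prop) ?_
      exact continuousAt_const.sub (h.hasDerivAt_lagW s A).continuousAt
    · intro s _
      refine HasDerivAt.hasDerivWithinAt ?_
      exact (((hasDerivAt_id s).const_mul K).exp).mul ((h.hasDerivAt_lagW s A).const_sub S)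
    · intro s hs
      rw [interior_Icc] at hs
      have hs' := Ioo_subset_Icc_self hs
      have h1 := h.lagH_le hs' (hS s hs') A
      have h2 : lagH η q₀ v X s A / η ≤ K * (S - lagW η q₀ X s A) := by
        rw [hK, div_mul_eq_mul_div]
        gcongr
        refine h1.trans ?_
        have := mul_le_mul_of_nonneg_left (h.lagW_le_bound hs' A)
          (mul_nonneg h.L_nonneg (sub_nonneg.2 (hS s hs' A)))
        linarith
      have := mul_le_mul_of_nonneg_left h2 (Real.exp_pos (K * s)).le
      linarith
  have h0 := hmono ⟨le_rfl, h.T_pos.le⟩ ht ht.1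
  simp only [mul_zero, Real.exp_zero, one_mul] at h0
  have h1 := h.lagW_zero_le A
  have h2 : S - M₀ ≤ Real.exp (K * t) * (S - lagW η q₀ X t A) := by linarith
  have h3 := mul_le_mul_of_nonneg_left h2 (Real.exp_pos (-(K * t))).le
  rw [← mul_assoc, ← Real.exp_add] at h3
  simp only [neg_add_cancel, Real.exp_zero, one_mul] at h3
  linarith

/-- Maximum principle for the nonlocal term. -/
theorem lagW_le (h : CharacteristicFlow T η M₀ M L C E V q₀ q v X) {t : ℝ} (ht : t ∈ Icc 0 T)
    (A : ℝ) : lagW η q₀ X t A ≤ M₀ := by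
  set I : Set ℝ := (fun p : ℝ × ℝ => lagW η q₀ X p.1 p.2) '' (Icc 0 T ×ˢ univ) with hI
  have hbdd : BddAbove I := ⟨M, by
    rintro _ ⟨p, hp, rfl⟩
    exact h.lagW_le_bound hp.1 p.2⟩
  have hmem : ∀ s ∈ Icc 0 T, ∀ a, lagW η q₀ X s a ≤ sSup I := fun s hs a =>
    le_csSup hbdd ⟨(s, a), ⟨hs, trivial⟩, rfl⟩
  by_contra hlt
  have hS : M₀ < sSup I := (not_le.1 hlt).trans_le (hmem t ht A)
  set K := L * M / η with hK
  have hK0 : 0 ≤ K := div_nonneg (mul_nonneg h.L_nonneg (h.M₀_nonneg.trans h.initial_le)) h.η_pos.le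
  have : sSup I ≤ sSup I - (sSup I - M₀) * Real.exp (-(K * T)) := by
    refine csSup_le ⟨_, (t, A), ⟨ht, trivial⟩, rfl⟩ ?_
    rintro _ ⟨p, hp, rfl⟩
    refine (h.lagW_le_of_le hmem hp.1 p.2).trans ?_
    have e1 : Real.exp (-(K * T)) ≤ Real.exp (-(K * p.1)) := by
      gcongr
      exact hp.1.2
    have := mul_le_mul_of_nonneg_left e1 (sub_nonneg.2 hS.le)
    linarith
  have := mul_pos (sub_pos.2 hS) (Real.exp_pos (-(K * T)))
  linarith

end CharacteristicFlow

theorem expAvg_eq_shift (η : ℝ) (u : ℝ → ℝ) (x : ℝ) :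
    expAvg η u x = ∫ z in Iic (0:ℝ), Real.exp (z / η) / η * u (z + x) := by
  rw [expAvg, ← integral_indicator measurableSet_Iic, ← integral_indicator measurableSet_Iic,
    ← integral_add_right_eq_self _ x]
  refine integral_congr_ae (ae_of_all _ fun z => ?_)
  by_cases hz : z ∈ Iic (0:ℝ)
  · have hz' : z + x ∈ Iic x := by
      rw [mem_Iic] at hz ⊢; linarith
    simp only [indicator_of_mem hz, indicator_of_mem hz', add_sub_cancel_right]
  · have hz' : z + x ∉ Iic x := by
      rw [mem_Iic] at hz ⊢; intro h; exact hz (by linarith)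
    simp only [indicator_of_notMem hz, indicator_of_notMem hz']

theorem monotone_expAvg {η B : ℝ} (hη : 0 < η) {τ : ℝ → ℝ} (hτ : Monotone τ)
    (hB : ∀ x, |τ x| ≤ B) : Monotone (expAvg η τ) := by
  have hi : ∀ x, IntegrableOn (fun z => Real.exp (z / η) / η * τ (z + x)) (Iic 0) := fun x => by
    have := integrableOn_expWeight_mul hη (u := fun z => τ (z + x))
      (hτ.measurable.comp (measurable_add_const x)) (fun z => hB _) 0 0
    simpa using this
  intro x y hxy
  rw [expAvg_eq_shift, expAvg_eq_shift]
  exact setIntegral_mono (hi x) (hi y) fun z =>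
    mul_le_mul_of_nonneg_left (hτ (by linarith)) (by positivity)

theorem expAvg_add {η M M' : ℝ} (hη : 0 < η) {u w : ℝ → ℝ} (hu : Measurable u)
    (hw : Measurable w) (hM : ∀ x, |u x| ≤ M) (hM' : ∀ x, |w x| ≤ M') (x : ℝ) :
    expAvg η (fun y => u y + w y) x = expAvg η u x + expAvg η w x := by
  rw [expAvg, expAvg, expAvg, ← integral_add (integrableOn_expWeight_mul hη hu hM x x)
    (integrableOn_expWeight_mul hη hw hM' x x)]
  simp only [mul_add]

/-- The average of a dominated function is dominated by the average of the dominator. -/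
theorem abs_expAvg_sub_le_of_dominated {η M B : ℝ} (hη : 0 < η) {u τ : ℝ → ℝ}
    (hu : Measurable u) (hM : ∀ x, |u x| ≤ M) (hτ : Monotone τ) (hB : ∀ x, |τ x| ≤ B)
    (h : ∀ x y, x ≤ y → |u y - u x| ≤ τ y - τ x) {x y : ℝ} (hxy : x ≤ y) :
    |expAvg η u y - expAvg η u x| ≤ expAvg η τ y - expAvg η τ x := by
  have hb : ∀ s : ℝ → ℝ, (∀ x, |s x| ≤ M) → ∀ x, |τ x + s x| ≤ B + M := fun s hs x =>
    (abs_add_le _ _).trans (add_le_add (hB x) (hs x))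
  have h1 := monotone_expAvg hη (τ := fun x => τ x + u x) (fun a b hab => by
    have := (abs_le.1 (h a b hab)).1; simp only; linarith) (hb u hM) hxy
  have h2 := monotone_expAvg hη (τ := fun x => τ x + (-u x)) (fun a b hab => by
    have := (abs_le.1 (h a b hab)).2; simp only; linarith) (hb (fun x => -u x) (by simpa using hM)) hxy
  have hneg : ∀ z, expAvg η (fun y => -u y) z = -expAvg η u z := fun z => by
    simp only [expAvg, mul_neg, integral_neg]
  rw [expAvg_add hη hτ.measurable hu hB hM, expAvg_add hη hτ.measurable hu hB hM] at h1
  rw [expAvg_add (w := fun y => -u y) hη hτ.measurable hu.neg hB (by simpa using hM),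
    expAvg_add (w := fun y => -u y) hη hτ.measurable hu.neg hB (by simpa using hM), hneg, hneg] at h2
  rw [abs_le]
  constructor <;> linarith

theorem abs_le_add_integral_of_deriv {T : ℝ} {D D' β : ℝ → ℝ} (hD : ∀ t, HasDerivAt D (D' t) t)
    (hβ : Continuous β) (hpos : ∀ t ∈ Icc 0 T, 0 < D t → D' t ≤ β t)
    (hneg : ∀ t ∈ Icc 0 T, D t < 0 → -D' t ≤ β t)
    (hzero : ∀ t ∈ Icc 0 T, D t = 0 → |D' t| ≤ β t) {t : ℝ} (ht : t ∈ Icc 0 T) :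
    |D t| ≤ |D 0| + ∫ s in (0:ℝ)..t, β s := by
  have hDc : Continuous D := continuous_iff_continuousAt.2 fun t => (hD t).continuousAt
  have hI : ∀ t, HasDerivAt (fun u => |D 0| + ∫ s in (0:ℝ)..u, β s) (β t) t := fun t =>
    (intervalIntegral.integral_hasDerivAt_right (hβ.intervalIntegrable _ _)
      hβ.stronglyMeasurable.stronglyMeasurableAtFilter hβ.continuousAt).const_add _
  refine image_le_of_liminf_slope_right_le_deriv_boundary (f := fun t => |D t|)
    (B := fun u => |D 0| + ∫ s in (0:ℝ)..u, β s) (B' := β)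
    hDc.abs.continuousOn (by simp) (fun s _ => (hI s).continuousAt.continuousWithinAt)
    (fun s _ => (hI s).hasDerivWithinAt) ?_ ht
  intro x hx r hr
  have hx' := Ico_subset_Icc_self hx
  refine Eventually.frequently ?_
  have hlim : ∃ d, d ≤ β x ∧ Tendsto (slope (fun t => |D t|) x) (𝓝[>] x) (𝓝 d) := by
    rcases lt_trichotomy (D x) 0 with h | h | h
    · refine ⟨-D' x, hneg x hx' h, ?_⟩
      have : HasDerivAt (fun t => |D t|) (-D' x) x := by
        refine (hD x).neg.congr_of_eventuallyEq ?_
        filter_upwards [hDc.continuousAt.eventually (Iio_mem_nhds h)] with y hy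
        exact abs_of_neg hy
      exact (hasDerivWithinAt_iff_tendsto_slope' self_notMem_Ioi).1 this.hasDerivWithinAt
    · refine ⟨|D' x|, hzero x hx' h, ?_⟩
      have h1 := ((hasDerivWithinAt_iff_tendsto_slope' self_notMem_Ioi).1
        ((hD x).hasDerivWithinAt (s := Ioi x))).abs
      refine h1.congr' ?_
      filter_upwards [self_mem_nhdsWithin] with y hy
      rw [slope_def_field, slope_def_field, h, abs_zero, sub_zero, sub_zero, abs_div,
        abs_of_pos (sub_pos.2 hy)]
    · refine ⟨D' x, hpos x hx' h, ?_⟩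
      have : HasDerivAt (fun t => |D t|) (D' x) x := by
        refine (hD x).congr_of_eventuallyEq ?_
        filter_upwards [hDc.continuousAt.eventually (Ioi_mem_nhds h)] with y hy
        exact abs_of_pos hy
      exact (hasDerivWithinAt_iff_tendsto_slope' self_notMem_Ioi).1 this.hasDerivWithinAt
  obtain ⟨d, hd, hl⟩ := hlim
  exact hl.eventually (Iio_mem_nhds (hd.trans_lt hr))

/-- A quadratic error in a telescoping bound disappears under refinement. -/
theorem abs_sub_le_of_quadratic {w F : ℝ → ℝ} {C : ℝ}
    (h : ∀ a b, a ≤ b → |w b - w a| ≤ F b - F a + C * (b - a) ^ 2) {a b : ℝ} (hab : a ≤ b) :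
    |w b - w a| ≤ F b - F a := by
  have key : ∀ n : ℕ, |w b - w a| ≤ F b - F a + C * (b - a) ^ 2 / (n + 1) := by
    intro n
    set δ := (b - a) / (n + 1) with hδ
    have hδ0 : 0 ≤ δ := div_nonneg (by linarith) (by positivity)
    have ind : ∀ k : ℕ, |w (a + k * δ) - w a| ≤ F (a + k * δ) - F a + k * (C * δ ^ 2) := by
      intro k
      induction k with
      | zero => simp
      | succ k ih =>
        have h1 := h (a + k * δ) (a + (k + 1 : ℕ) * δ) (by push_cast; nlinarith)
        have h2 : a + ((k + 1 : ℕ) : ℝ) * δ - (a + k * δ) = δ := by push_cast; ring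
        rw [h2] at h1
        have h3 := abs_sub_le (w (a + (k + 1 : ℕ) * δ)) (w (a + k * δ)) (w a)
        push_cast at h1 h3 ⊢
        linarith
    have h1 := ind (n + 1)
    have h2 : a + ((n + 1 : ℕ) : ℝ) * δ = b := by
      rw [hδ]; push_cast; field_simp; ring
    have h3 : ((n + 1 : ℕ) : ℝ) * (C * δ ^ 2) = C * (b - a) ^ 2 / (n + 1) := by
      rw [hδ]; push_cast; field_simp
    rwa [h2, h3] at h1
  have hl : Tendsto (fun n : ℕ => F b - F a + C * (b - a) ^ 2 / ((n : ℝ) + 1)) atTop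
      (𝓝 (F b - F a + 0)) :=
    tendsto_const_nhds.add (((tendsto_const_div_atTop_nhds_zero_nat (C * (b - a) ^ 2)).comp
      (tendsto_add_atTop_nat 1)).congr fun n => by simp)
  rw [add_zero] at hl
  exact ge_of_tendsto' hl key

theorem ae_le_of_integral_le {u : ℝ → ℝ} {M M₀ : ℝ} (hu : Measurable u) (hM : ∀ x, |u x| ≤ M)
    (h : ∀ x y, x ≤ y → ∫ z in x..y, u z ≤ M₀ * (y - x)) : ∀ᵐ x, u x ≤ M₀ := by
  filter_upwards [LocallyIntegrable.ae_hasDerivAt_integral (locallyIntegrable_of_bounded hu hM)] with x hx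
  have h1 := (hasDerivWithinAt_iff_tendsto_slope' self_notMem_Ioi).1
    ((hx x).hasDerivWithinAt (s := Ioi x))
  refine le_of_tendsto h1 ?_
  filter_upwards [self_mem_nhdsWithin] with y hy
  rw [mem_Ioi] at hy
  rw [slope_def_field, intervalIntegral.integral_same, sub_zero, div_le_iff₀ (sub_pos.2 hy)]
  exact h x y hy.le

namespace CharacteristicFlow

variable {T η M₀ M L C E : ℝ} {V q₀ : ℝ → ℝ} {q v X : ℝ → ℝ → ℝ}

theorem expAvg_le (h : CharacteristicFlow T η M₀ M L C E V q₀ q v X) {t : ℝ} (ht : t ∈ Icc 0 T)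
    (x : ℝ) : expAvg η (fun y => |q t y|) x ≤ M₀ := by
  obtain ⟨A, rfl⟩ := h.flow_surj t x
  rw [← h.lagW_eq ht]
  exact h.lagW_le ht A

theorem integral_abs_initial_le (h : CharacteristicFlow T η M₀ M L C E V q₀ q v X) {t : ℝ}
    (ht : t ∈ Icc 0 T) {a b : ℝ} (hab : a ≤ b) :
    ∫ x in a..b, |q₀ x| ≤ M₀ * (X t b - X t a) := by
  have hη := h.η_pos
  set m := ∫ x in a..b, |q₀ x| with hm
  have hderiv : ∀ s, HasDerivAt (fun s => m - M₀ * (X s b - X s a))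
      (-(M₀ * (v s (X s b) - v s (X s a)))) s := fun s =>
    (((h.flow_deriv s b).sub (h.flow_deriv s a)).const_mul M₀).const_sub m
  have key : ∀ ε : ℝ, 0 < ε → m - M₀ * (X t b - X t a) ≤ ε * (1 + t) := by
    intro ε hε
    refine image_le_of_deriv_right_lt_deriv_boundary' (f := fun s => m - M₀ * (X s b - X s a))
      (B := fun s => ε * (1 + s)) (B' := fun _ => ε * 1)
      (fun s _ => (hderiv s).continuousAt.continuousWithinAt)
      (fun s _ => (hderiv s).hasDerivWithinAt) ?_ (by fun_prop)
      (fun s _ => (((hasDerivAt_id s).const_add 1).const_mul ε).hasDerivWithinAt) ?_ ht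
    · rw [h.flow_zero, h.flow_zero]
      have : m ≤ M₀ * (b - a) := by
        have := (intervalIntegral.norm_integral_le_of_norm_le_const (a := a) (b := b)
          (f := fun x => |q₀ x|) (C := M₀) fun x _ => by simpa using h.abs_initial_le x)
        rw [abs_of_nonneg (sub_nonneg.2 hab)] at this
        exact (le_abs_self _).trans this
      simp only [add_zero, mul_one]
      linarith
    · intro s hs heq
      have hs' := Ico_subset_Icc_self hs
      have hpos : 0 < m - M₀ * (X s b - X s a) := by
        rw [heq]; have := hs.1; positivity
      have hX := (h.flow_mono s).monotone hab
      have hqa : Measurable fun y => |q s y| := (h.meas s).abs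
      have hqb : ∀ x, |(|q s x|)| ≤ M := fun x => by simpa using h.abs_dens_le s x
      have h1 := integral_sub_expAvg hη hqa hqb hX
      rw [intervalIntegral.integral_sub (intervalIntegrable_of_bounded hqa hqb _ _)
        ((continuous_expAvg hη hqa hqb).intervalIntegrable _ _), h.integral_abs_eq hs' hab] at h1
      have h2 : ∫ z in X s a..X s b, expAvg η (fun y => |q s y|) z ≤ M₀ * (X s b - X s a) := by
        refine (intervalIntegral.integral_mono_on hX
          ((continuous_expAvg hη hqa hqb).intervalIntegrable _ _)
          (intervalIntegrable_const (c := M₀)) fun z _ => h.expAvg_le hs' z).trans (le_of_eq ?_)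
        simp [mul_comm]
      have h3 : 0 < η * (expAvg η (fun y => |q s y|) (X s b) -
          expAvg η (fun y => |q s y|) (X s a)) := by linarith
      have h4 := (pos_iff_pos_of_mul_pos h3).1 hη
      have h5 := h.mono (sub_pos.1 h4).le
      rw [h.vel_eq s hs', h.vel_eq s hs']
      have := mul_nonneg h.M₀_nonneg (sub_nonneg.2 h5)
      linarith
  by_contra hlt
  have h0 : 0 < m - M₀ * (X t b - X t a) := by linarith [not_le.1 hlt]
  have ht1 : 0 < 1 + t := by linarith [ht.1]
  have := key ((m - M₀ * (X t b - X t a)) / (2 * (1 + t))) (by positivity)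
  have e : (m - M₀ * (X t b - X t a)) / (2 * (1 + t)) * (1 + t) =
    (m - M₀ * (X t b - X t a)) / 2 := by field_simp
  linarith

/-- Maximum principle for the density. -/
theorem ae_abs_le (h : CharacteristicFlow T η M₀ M L C E V q₀ q v X) {t : ℝ} (ht : t ∈ Icc 0 T) :
    ∀ᵐ x, |q t x| ≤ M₀ := by
  refine ae_le_of_integral_le (M := M) (h.meas t).abs (fun x => by simpa using h.abs_dens_le t x)
    fun x y hxy => ?_
  obtain ⟨a, rfl⟩ := h.flow_surj t x
  obtain ⟨b, rfl⟩ := h.flow_surj t y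
  have hab := (h.flow_mono t).le_iff_le.1 hxy
  rw [h.integral_abs_eq ht hab]
  exact h.integral_abs_initial_le ht hab

theorem abs_lagW_sub_le (h : CharacteristicFlow T η M₀ M L C E V q₀ q v X) {t : ℝ}
    (ht : t ∈ Icc 0 T) (a b : ℝ) :
    |lagW η q₀ X t a - lagW η q₀ X t b| ≤ 2 * M / η * E * |a - b| := by
  rw [h.lagW_eq ht, h.lagW_eq ht]
  refine (abs_expAvg_sub_le h.η_pos (h.meas t).abs (M := M)
    (fun x => by simpa using h.abs_dens_le t x) _ _).trans ?_
  rw [mul_assoc]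
  have hM := h.M₀_nonneg.trans h.initial_le
  have hη := h.η_pos
  exact mul_le_mul_of_nonneg_left (h.flow_lip t ht a b) (by positivity)

theorem abs_vel_sub_le (h : CharacteristicFlow T η M₀ M L C E V q₀ q v X) (t x y : ℝ) :
    |v t x - v t y| ≤ 2 * C := by
  have e1 := h.abs_vel_le t x
  have e2 := h.abs_vel_le t y
  have := abs_sub (v t x) (v t y)
  linarith

theorem abs_lagH_cell_le (h : CharacteristicFlow T η M₀ M L C E V q₀ q v X) {t : ℝ}
    (ht : t ∈ Icc 0 T) {A B : ℝ} (hAB : A ≤ B) :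
    |lagH η q₀ v X t B - Real.exp ((X t A - X t B) / η) * (lagH η q₀ v X t A -
      lagW η q₀ X t A * (V (lagW η q₀ X t B) - V (lagW η q₀ X t A)))| ≤
      1 / η * M₀ * (L * (2 * M / η * E)) * (B - A) ^ 2 := by
  have hη := h.η_pos
  have hM₀ := h.M₀_nonneg
  have hL := h.L_nonneg
  have hE := h.E_nonneg
  have hM := h.M₀_nonneg.trans h.initial_le
  have hintg := h.integrableOn_weight_mul t B B (f := fun a => v t (X t a) - v t (X t B))
    ((h.meas_vel t).sub_const _) (fun a => h.abs_vel_sub_le t _ _)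
  have hintA := h.integrableOn_weight_mul t A A (f := fun a => v t (X t a) - v t (X t A))
    ((h.meas_vel t).sub_const _) (fun a => h.abs_vel_sub_le t _ _)
  have h1 : ∫ a in Iic A, Real.exp ((X t a - X t B) / η) / η * |q₀ a| * (v t (X t a) - v t (X t B)) =
      Real.exp ((X t A - X t B) / η) * (lagH η q₀ v X t A -
      lagW η q₀ X t A * (V (lagW η q₀ X t B) - V (lagW η q₀ X t A))) := by
    rw [← h.vel_flow_eq ht, ← h.vel_flow_eq ht, lagH, lagW, ← integral_mul_const, ← integral_sub
      hintA ((h.integrableOn_weight_initial t A A).mul_const _), ← integral_const_mul]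
    refine integral_congr_ae (ae_of_all _ fun a => ?_)
    have : Real.exp ((X t a - X t B) / η) =
        Real.exp ((X t A - X t B) / η) * Real.exp ((X t a - X t A) / η) := by
      rw [← Real.exp_add]; congr 1; ring
    simp only [this]
    ring
  have h2 : lagH η q₀ v X t B - Real.exp ((X t A - X t B) / η) * (lagH η q₀ v X t A -
      lagW η q₀ X t A * (V (lagW η q₀ X t B) - V (lagW η q₀ X t A))) =
      ∫ a in Ioc A B, Real.exp ((X t a - X t B) / η) / η * |q₀ a| *
        (v t (X t a) - v t (X t B)) := by
    rw [← h1, lagH, ← Iic_union_Ioc_eq_Iic hAB, setIntegral_union (Iic_disjoint_Ioc le_rfl)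
      measurableSet_Ioc (hintg.mono_set (Iic_subset_Iic.2 hAB)) (hintg.mono_set Ioc_subset_Iic_self)]
    ring
  rw [h2, ← Real.norm_eq_abs]
  have h3 : ∀ a ∈ Ioc A B, ‖Real.exp ((X t a - X t B) / η) / η * |q₀ a| *
      (v t (X t a) - v t (X t B))‖ ≤ 1 / η * M₀ * (L * (2 * M / η * E * (B - A))) := by
    intro a ha
    rw [norm_mul, norm_mul, Real.norm_of_nonneg (by positivity), Real.norm_eq_abs,
      Real.norm_eq_abs, abs_abs]
    have e1 : Real.exp ((X t a - X t B) / η) ≤ 1 := by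
      rw [Real.exp_le_one_iff]
      exact div_nonpos_of_nonpos_of_nonneg (sub_nonpos.2 ((h.flow_mono t).monotone ha.2)) hη.le
    have e2 : |v t (X t a) - v t (X t B)| ≤ L * (2 * M / η * E * (B - A)) := by
      rw [h.vel_flow_eq ht, h.vel_flow_eq ht]
      refine (h.lip _ _).trans (mul_le_mul_of_nonneg_left ((h.abs_lagW_sub_le ht a B).trans ?_) hL)
      refine mul_le_mul_of_nonneg_left ?_ (by positivity)
      rw [abs_sub_comm, abs_of_nonneg (by linarith [ha.2])]
      linarith [ha.1]
    gcongr
    exact h.abs_initial_le a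
  refine (norm_setIntegral_le_of_norm_le_const (by simp) h3).trans (le_of_eq ?_)
  simp [hAB]
  ring

end CharacteristicFlow

/-- Lagrangian dominator of the nonlocal term. -/
def lagF (η : ℝ) (q₀ τ : ℝ → ℝ) (v X : ℝ → ℝ → ℝ) (t A : ℝ) : ℝ :=
  expAvg η τ A - 1 / η * ∫ s in (0:ℝ)..t, |lagH η q₀ v X s A|

theorem sub_le_of_damped {hA hB e k ρ : ℝ} (he : 0 ≤ e) (he1 : e ≤ 1) (hk : 0 ≤ k)
    (hr : |hB - (e * hA - k)| ≤ ρ) : hB - hA ≤ |hA| - |hB| + 2 * ρ := by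
  have hr1 := (abs_le.1 hr).2
  have hρ := (abs_nonneg _).trans hr
  have h1 : e * hA ≤ |hA| := by
    have := mul_le_mul_of_nonneg_left (le_abs_self hA) he
    have := mul_le_mul_of_nonneg_right he1 (abs_nonneg hA)
    linarith
  rcases le_total hB 0 with h | h
  · rw [abs_of_nonpos h]; linarith [neg_abs_le hA]
  · rw [abs_of_nonneg h]
    rcases le_total hA 0 with h' | h'
    · have : e * hA ≤ 0 := mul_nonpos_of_nonneg_of_nonpos he h'
      linarith [neg_abs_le hA]
    · rw [abs_of_nonneg h'] at h1 ⊢; linarith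

theorem abs_sub_le_of_damped {hA hB e ρ : ℝ} (he : 0 ≤ e) (he1 : e ≤ 1)
    (hr : |hB - e * hA| ≤ ρ) : |hB - hA| ≤ |hA| - |hB| + 2 * ρ := by
  have h1 : |hB - hA| ≤ |hB - e * hA| + (1 - e) * |hA| := by
    have : hB - hA = (hB - e * hA) - (1 - e) * hA := by ring
    rw [this]
    refine (abs_sub _ _).trans ?_
    rw [abs_mul, abs_of_nonneg (sub_nonneg.2 he1)]
  have h2 : |hB| ≤ |hB - e * hA| + e * |hA| := by
    have : hB = (hB - e * hA) + e * hA := by ring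
    calc |hB| = |(hB - e * hA) + e * hA| := by rw [← this]
      _ ≤ _ := (abs_add_le _ _).trans (by rw [abs_mul, abs_of_nonneg he])
  linarith

namespace CharacteristicFlow

variable {T η M₀ M L C E B : ℝ} {V q₀ τ : ℝ → ℝ} {q v X : ℝ → ℝ → ℝ}

theorem abs_lagW_sub_le_quadratic (h : CharacteristicFlow T η M₀ M L C E V q₀ q v X)
    (hτ : Monotone τ) (hB : ∀ x, |τ x| ≤ B) (hd : ∀ x y, x ≤ y → |q₀ y - q₀ x| ≤ τ y - τ x)
    {t : ℝ} (ht : t ∈ Icc 0 T) {a b : ℝ} (hab : a ≤ b) :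
    |lagW η q₀ X t b - lagW η q₀ X t a| ≤ lagF η q₀ τ v X t b - lagF η q₀ τ v X t a +
      1 / η * (T * (2 * (1 / η * M₀ * (L * (2 * M / η * E))))) * (b - a) ^ 2 := by
  have hη := h.η_pos
  have hM₀ := h.M₀_nonneg
  have hL := h.L_nonneg
  have hE := h.E_nonneg
  have hM := h.M₀_nonneg.trans h.initial_le
  set ρ := 1 / η * M₀ * (L * (2 * M / η * E)) * (b - a) ^ 2 with hρ
  have hρ0 : 0 ≤ ρ := by positivity
  have ha := (h.continuous_lagH a).abs
  have hb := (h.continuous_lagH b).abs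
  have hcell : ∀ s ∈ Icc 0 T, ∃ e, 0 ≤ e ∧ e ≤ 1 ∧
      |lagH η q₀ v X s b - (e * lagH η q₀ v X s a -
        e * (lagW η q₀ X s a * (V (lagW η q₀ X s b) - V (lagW η q₀ X s a))))| ≤ ρ := by
    intro s hs
    refine ⟨Real.exp ((X s a - X s b) / η), (Real.exp_pos _).le, ?_, ?_⟩
    · rw [Real.exp_le_one_iff]
      exact div_nonpos_of_nonpos_of_nonneg (sub_nonpos.2 ((h.flow_mono s).monotone hab)) hη.le
    · rw [← mul_sub]; exact h.abs_lagH_cell_le hs hab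
  have key := abs_le_add_integral_of_deriv (T := T)
    (D := fun s => lagW η q₀ X s b - lagW η q₀ X s a)
    (D' := fun s => lagH η q₀ v X s b / η - lagH η q₀ v X s a / η)
    (β := fun s => 1 / η * (|lagH η q₀ v X s a| - |lagH η q₀ v X s b| + 2 * ρ))
    (fun s => (h.hasDerivAt_lagW s b).sub (h.hasDerivAt_lagW s a)) (by fun_prop)
    (fun s hs hpos => ?_) (fun s hs hneg => ?_) (fun s hs hzero => ?_) ht
  · have h0 : |lagW η q₀ X 0 b - lagW η q₀ X 0 a| ≤ expAvg η τ b - expAvg η τ a := by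
      have e : ∀ A, lagW η q₀ X 0 A = expAvg η (fun y => |q₀ y|) A := fun A => by
        simp only [lagW, expAvg, h.flow_zero]
      rw [e, e]
      refine abs_expAvg_sub_le_of_dominated hη h.meas_initial.abs (M := M₀)
        (fun x => by simpa using h.abs_initial_le x) hτ hB (fun x y hxy => ?_) hab
      exact (abs_abs_sub_abs_le _ _).trans (hd x y hxy)
    have h1 : ∫ s in (0:ℝ)..t, 1 / η * (|lagH η q₀ v X s a| - |lagH η q₀ v X s b| + 2 * ρ) =
        1 / η * ((∫ s in (0:ℝ)..t, |lagH η q₀ v X s a|) - (∫ s in (0:ℝ)..t, |lagH η q₀ v X s b|) +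
          t * (2 * ρ)) := by
      rw [intervalIntegral.integral_const_mul, intervalIntegral.integral_add
        (f := fun s => |lagH η q₀ v X s a| - |lagH η q₀ v X s b|) (g := fun _ => 2 * ρ)
        ((ha.sub hb).intervalIntegrable _ _) intervalIntegrable_const, intervalIntegral.integral_sub
        (ha.intervalIntegrable _ _) (hb.intervalIntegrable _ _),
        intervalIntegral.integral_const, sub_zero, smul_eq_mul]
    have h2 : 1 / η * (t * (2 * ρ)) ≤ 1 / η * (T * (2 * ρ)) := by
      have := ht.2; gcongr
    rw [h1] at key
    have e2 : 1 / η * (T * (2 * (1 / η * M₀ * (L * (2 * M / η * E))))) * (b - a) ^ 2 =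
      1 / η * (T * (2 * ρ)) := by rw [hρ]; ring
    rw [e2, lagF, lagF]
    linarith
  · obtain ⟨e, he, he1, hc⟩ := hcell s hs
    have hk : 0 ≤ e * (lagW η q₀ X s a * (V (lagW η q₀ X s b) - V (lagW η q₀ X s a))) :=
      mul_nonneg he (mul_nonneg (h.lagW_nonneg s a) (sub_nonneg.2 (h.mono (sub_pos.1 hpos).le)))
    rw [← sub_div, div_eq_inv_mul, one_div]
    exact mul_le_mul_of_nonneg_left (sub_le_of_damped he he1 hk hc) (inv_nonneg.2 hη.le)
  · obtain ⟨e, he, he1, hc⟩ := hcell s hs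
    have hk : 0 ≤ e * (lagW η q₀ X s a * (V (lagW η q₀ X s a) - V (lagW η q₀ X s b))) :=
      mul_nonneg he (mul_nonneg (h.lagW_nonneg s a) (sub_nonneg.2 (h.mono (sub_neg.1 hneg).le)))
    rw [← sub_div, div_eq_inv_mul, one_div, ← mul_neg]
    refine mul_le_mul_of_nonneg_left ?_ (inv_nonneg.2 hη.le)
    have := sub_le_of_damped (hA := -lagH η q₀ v X s a) (hB := -lagH η q₀ v X s b) (ρ := ρ) he he1 hk
      (by rw [← abs_neg]; refine le_trans (le_of_eq ?_) hc; congr 1; ring)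
    rw [abs_neg, abs_neg] at this
    linarith
  · obtain ⟨e, he, he1, hc⟩ := hcell s hs
    rw [sub_eq_zero] at hzero
    rw [hzero, sub_self, mul_zero, mul_zero, sub_zero] at hc
    rw [← sub_div, div_eq_inv_mul, one_div, abs_mul, abs_of_pos (inv_pos.2 hη)]
    exact mul_le_mul_of_nonneg_left (abs_sub_le_of_damped he he1 hc) (inv_nonneg.2 hη.le)

theorem abs_lagW_sub_le_lagF (h : CharacteristicFlow T η M₀ M L C E V q₀ q v X)
    (hτ : Monotone τ) (hB : ∀ x, |τ x| ≤ B) (hd : ∀ x y, x ≤ y → |q₀ y - q₀ x| ≤ τ y - τ x)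
    {t : ℝ} (ht : t ∈ Icc 0 T) {a b : ℝ} (hab : a ≤ b) :
    |lagW η q₀ X t b - lagW η q₀ X t a| ≤ lagF η q₀ τ v X t b - lagF η q₀ τ v X t a :=
  abs_sub_le_of_quadratic (fun _ _ => h.abs_lagW_sub_le_quadratic hτ hB hd ht) hab

theorem monotone_lagF (h : CharacteristicFlow T η M₀ M L C E V q₀ q v X)
    (hτ : Monotone τ) (hB : ∀ x, |τ x| ≤ B) (hd : ∀ x y, x ≤ y → |q₀ y - q₀ x| ≤ τ y - τ x)
    {t : ℝ} (ht : t ∈ Icc 0 T) : Monotone (lagF η q₀ τ v X t) := fun _ _ hab =>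
  sub_nonneg.1 ((abs_nonneg _).trans (h.abs_lagW_sub_le_lagF hτ hB hd ht hab))

theorem abs_lagH_le (h : CharacteristicFlow T η M₀ M L C E V q₀ q v X) {t A D : ℝ}
    (hD : ∀ a ≤ A, |v t (X t a) - v t (X t A)| ≤ D) :
    |lagH η q₀ v X t A| ≤ D * lagW η q₀ X t A := by
  have hη := h.η_pos
  rw [← Real.norm_eq_abs, lagH, lagW, ← integral_const_mul]
  refine norm_integral_le_of_norm_le ((h.integrableOn_weight_initial t A A).const_mul D) ?_
  filter_upwards [ae_restrict_mem measurableSet_Iic] with a ha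
  rw [norm_mul, Real.norm_of_nonneg (by positivity), Real.norm_eq_abs, mul_comm]
  exact mul_le_mul_of_nonneg_right (hD a ha) (by positivity)

theorem abs_lagH_le_const (h : CharacteristicFlow T η M₀ M L C E V q₀ q v X) {t : ℝ}
    (ht : t ∈ Icc 0 T) (A : ℝ) : |lagH η q₀ v X t A| ≤ 2 * C * M₀ := by
  refine (h.abs_lagH_le fun a _ => h.abs_vel_sub_le t _ _).trans ?_
  have := h.C_nonneg
  exact mul_le_mul_of_nonneg_left (h.lagW_le ht A) (by positivity)

theorem neg_le_lagF (h : CharacteristicFlow T η M₀ M L C E V q₀ q v X)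
    (hB : ∀ x, |τ x| ≤ B) {t : ℝ} (ht : t ∈ Icc 0 T) (A : ℝ) :
    -B - 1 / η * (2 * C * M₀ * t) ≤ lagF η q₀ τ v X t A := by
  have hη := h.η_pos
  have h1 := (abs_le.1 (abs_expAvg_le hη hB A)).1
  have h2 : ∫ s in (0:ℝ)..t, |lagH η q₀ v X s A| ≤ 2 * C * M₀ * t := by
    have := intervalIntegral.norm_integral_le_of_norm_le_const (a := 0) (b := t)
      (f := fun s => |lagH η q₀ v X s A|) (C := 2 * C * M₀) fun s hs => by
        rw [uIoc_of_le ht.1] at hs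
        rw [Real.norm_eq_abs, abs_abs]
        exact h.abs_lagH_le_const ⟨hs.1.le, hs.2.trans ht.2⟩ A
    rw [sub_zero, abs_of_nonneg ht.1] at this
    exact (le_abs_self _).trans this
  have h3 := mul_le_mul_of_nonneg_left h2 (one_div_pos.2 hη).le
  rw [lagF]
  linarith

theorem tendsto_lagH_atBot (h : CharacteristicFlow T η M₀ M L C E V q₀ q v X)
    (hτ : Monotone τ) (hB : ∀ x, |τ x| ≤ B) (hd : ∀ x y, x ≤ y → |q₀ y - q₀ x| ≤ τ y - τ x)
    {t : ℝ} (ht : t ∈ Icc 0 T) : Tendsto (fun A => |lagH η q₀ v X t A|) atBot (𝓝 0) := by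
  have hL := h.L_nonneg
  have hmono := h.monotone_lagF hτ hB hd ht
  have hbdd : BddBelow (range (lagF η q₀ τ v X t)) := ⟨_, by
    rintro _ ⟨A, rfl⟩
    exact h.neg_le_lagF hB ht A⟩
  have hl := tendsto_atBot_ciInf hmono hbdd
  have hlim : Tendsto (fun A => L * (lagF η q₀ τ v X t A - ⨅ a, lagF η q₀ τ v X t a) * M₀) atBot
      (𝓝 (L * ((⨅ a, lagF η q₀ τ v X t a) - ⨅ a, lagF η q₀ τ v X t a) * M₀)) :=
    ((hl.sub_const _).const_mul L).mul_const M₀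
  rw [sub_self, mul_zero, zero_mul] at hlim
  refine squeeze_zero (fun _ => abs_nonneg _) (fun A => ?_) hlim
  have hnn : 0 ≤ lagF η q₀ τ v X t A - ⨅ a, lagF η q₀ τ v X t a := sub_nonneg.2 (ciInf_le hbdd A)
  refine (h.abs_lagH_le (D := L * (lagF η q₀ τ v X t A - ⨅ a, lagF η q₀ τ v X t a))
    fun a ha => ?_).trans (mul_le_mul_of_nonneg_left (h.lagW_le ht A) (by positivity))
  rw [h.vel_flow_eq ht, h.vel_flow_eq ht, abs_sub_comm]
  refine (h.lip _ _).trans (mul_le_mul_of_nonneg_left ?_ hL)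
  exact (h.abs_lagW_sub_le_lagF hτ hB hd ht ha).trans (sub_le_sub_left (ciInf_le hbdd a) _)

theorem abs_lagF_le (h : CharacteristicFlow T η M₀ M L C E V q₀ q v X)
    (hτ : Monotone τ) (hB : ∀ x, |τ x| ≤ B) (hd : ∀ x y, x ≤ y → |q₀ y - q₀ x| ≤ τ y - τ x)
    {t : ℝ} (ht : t ∈ Icc 0 T) (A : ℝ) : |lagF η q₀ τ v X t A| ≤ B := by
  have hη := h.η_pos
  have hnn : ∀ a, 0 ≤ ∫ s in (0:ℝ)..t, |lagH η q₀ v X s a| := fun a =>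
    intervalIntegral.integral_nonneg ht.1 fun _ _ => abs_nonneg _
  rw [abs_le]
  constructor
  · have hlim : Tendsto (fun a => ∫ s in (0:ℝ)..t, |lagH η q₀ v X s a|) atBot
        (𝓝 (∫ s in (0:ℝ)..t, (0:ℝ))) := by
      refine intervalIntegral.tendsto_integral_filter_of_dominated_convergence
        (fun _ => 2 * C * M₀) (Eventually.of_forall fun a =>
          (h.continuous_lagH a).abs.aestronglyMeasurable)
        (Eventually.of_forall fun a => ae_of_all _ fun s hs => ?_) (by simp)
        (ae_of_all _ fun s hs => ?_)
      · rw [uIoc_of_le ht.1] at hs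
        rw [Real.norm_eq_abs, abs_abs]
        exact h.abs_lagH_le_const ⟨hs.1.le, hs.2.trans ht.2⟩ a
      · rw [uIoc_of_le ht.1] at hs
        exact h.tendsto_lagH_atBot hτ hB hd ⟨hs.1.le, hs.2.trans ht.2⟩
    rw [intervalIntegral.integral_zero] at hlim
    have hlim2 := (hlim.const_mul (1 / η)).const_sub (-B)
    rw [mul_zero, sub_zero] at hlim2
    refine le_of_tendsto hlim2 ?_
    filter_upwards [eventually_le_atBot A] with a ha
    refine le_trans ?_ (h.monotone_lagF hτ hB hd ht ha)
    rw [lagF]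
    linarith [(abs_le.1 (abs_expAvg_le hη hB a)).1]
  · have h1 := (abs_le.1 (abs_expAvg_le hη hB A)).2
    have h2 := mul_nonneg (one_div_pos.2 hη).le (hnn A)
    rw [lagF]; linarith

/-- Uniform total variation bound for the nonlocal term, through a monotone dominator. -/
theorem exists_dominator (h : CharacteristicFlow T η M₀ M L C E V q₀ q v X)
    (hτ : Monotone τ) (hB : ∀ x, |τ x| ≤ B) (hd : ∀ x y, x ≤ y → |q₀ y - q₀ x| ≤ τ y - τ x)
    {t : ℝ} (ht : t ∈ Icc 0 T) : ∃ F : ℝ → ℝ, Monotone F ∧ (∀ x, |F x| ≤ B) ∧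
      ∀ x y, x ≤ y → |expAvg η (fun z => |q t z|) y - expAvg η (fun z => |q t z|) x| ≤
        F y - F x := by
  have key : ∀ x y, x ≤ y → |expAvg η (fun z => |q t z|) y - expAvg η (fun z => |q t z|) x| ≤
      lagF η q₀ τ v X t (surjInv (h.flow_surj t) y) -
        lagF η q₀ τ v X t (surjInv (h.flow_surj t) x) := by
    intro x y hxy
    have h1 := surjInv_eq (h.flow_surj t) x
    have h2 := surjInv_eq (h.flow_surj t) y
    have h3 : surjInv (h.flow_surj t) x ≤ surjInv (h.flow_surj t) y := by
      rw [← (h.flow_mono t).le_iff_le, h1, h2]; exact hxy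
    have := h.abs_lagW_sub_le_lagF hτ hB hd ht h3
    rwa [h.lagW_eq ht, h.lagW_eq ht, h1, h2] at this
  exact ⟨fun x => lagF η q₀ τ v X t (surjInv (h.flow_surj t) x), fun x y hxy =>
    sub_nonneg.1 ((abs_nonneg _).trans (key x y hxy)), fun x => h.abs_lagF_le hτ hB hd ht _, key⟩

end CharacteristicFlow

theorem abs_max_min_sub_le (a b x y : ℝ) :
    |max a (min x b) - max a (min y b)| ≤ |x - y| :=
  (abs_max_sub_max_le_abs _ _ _).trans (abs_min_sub_min_le_max x b y b |>.trans (by simp)) |>.trans'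
    (by rw [max_comm a, max_comm a])

theorem max_min_of_mem {a b x : ℝ} (hx : x ∈ Icc a b) : max a (min x b) = x := by
  rw [min_eq_left hx.2, max_eq_right hx.1]

theorem max_min_mem {a b : ℝ} (hab : a ≤ b) (x : ℝ) : max a (min x b) ∈ Icc a b :=
  ⟨le_max_left _ _, max_le hab (min_le_right _ _)⟩

theorem integral_expWeight_Iic_sub {η : ℝ} (hη : 0 < η) (x R : ℝ) :
    ∫ y in Iic (x - R), Real.exp ((y - x) / η) / η = Real.exp (-R / η) := by
  rw [← mul_one (Real.exp (-R / η)), ← integral_expWeight hη (x - R), ← integral_const_mul]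
  refine integral_congr_ae (ae_of_all _ fun y => ?_)
  simp only
  rw [mul_div_assoc', ← Real.exp_add]
  congr 2
  ring

theorem abs_expAvg_sub_expAvg_le {η M R : ℝ} (hη : 0 < η) (hR : 0 ≤ R) {u w : ℝ → ℝ}
    (hu : Measurable u) (hw : Measurable w) (hM : ∀ x, |u x| ≤ M) (hM' : ∀ x, |w x| ≤ M) (x : ℝ) :
    |expAvg η u x - expAvg η w x| ≤
      1 / η * (∫ y in Icc (x - R) x, |u y - w y|) + 2 * M * Real.exp (-R / η) := by
  have hb : ∀ y, |(|u y - w y|)| ≤ 2 * M := fun y => by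
    rw [abs_abs]; have := abs_sub (u y) (w y); linarith [hM y, hM' y]
  have hi := integrableOn_expWeight_mul hη (u := fun y => |u y - w y|) (hu.sub hw).abs hb x x
  have h1 : |expAvg η u x - expAvg η w x| ≤
      ∫ y in Iic x, Real.exp ((y - x) / η) / η * |u y - w y| := by
    rw [expAvg, expAvg, ← integral_sub (integrableOn_expWeight_mul hη hu hM x x)
      (integrableOn_expWeight_mul hη hw hM' x x), ← Real.norm_eq_abs]
    refine norm_integral_le_of_norm_le hi (ae_of_all _ fun y => le_of_eq ?_)
    rw [← mul_sub, norm_mul, Real.norm_of_nonneg (by positivity), Real.norm_eq_abs]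
  refine h1.trans ?_
  have hx : x - R ≤ x := by linarith
  rw [← Iic_union_Ioc_eq_Iic hx, setIntegral_union (Iic_disjoint_Ioc le_rfl) measurableSet_Ioc
    (hi.mono_set (Iic_subset_Iic.2 hx)) (hi.mono_set Ioc_subset_Iic_self), add_comm]
  refine add_le_add ?_ ?_
  · rw [integral_Icc_eq_integral_Ioc, ← integral_const_mul]
    refine setIntegral_mono_on (hi.mono_set Ioc_subset_Iic_self) ?_ measurableSet_Ioc fun y hy => ?_
    · exact (((locallyIntegrable_of_bounded (hu.sub hw).abs hb).integrableOn_isCompact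
        isCompact_Icc).mono_set Ioc_subset_Icc_self).const_mul _
    · have : Real.exp ((y - x) / η) ≤ 1 := by
        rw [Real.exp_le_one_iff]
        exact div_nonpos_of_nonpos_of_nonneg (sub_nonpos.2 hy.2) hη.le
      gcongr
  · rw [← integral_expWeight_Iic_sub hη x R, ← integral_const_mul]
    refine setIntegral_mono (hi.mono_set (Iic_subset_Iic.2 hx))
      ((integrableOn_expWeight hη x (x - R)).const_mul _) fun y => ?_
    simp only
    rw [mul_comm]
    exact mul_le_mul_of_nonneg_right ((le_abs_self _).trans (hb y)) (by positivity)

theorem continuousOn_expAvg_time {T η M : ℝ} (hη : 0 < η) {q : ℝ → ℝ → ℝ}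
    (hqm : ∀ t, Measurable (q t)) (hqM : ∀ t x, |q t x| ≤ M)
    (hqc : ∀ s ∈ Icc (0:ℝ) T, ∀ K : Set ℝ, IsCompact K →
      Tendsto (fun t => ∫ x in K, |q t x - q s x|) (nhdsWithin s (Icc (0:ℝ) T)) (nhds 0)) (x : ℝ) :
    ContinuousOn (fun t => expAvg η (fun y => |q t y|) x) (Icc 0 T) := by
  intro s hs
  rw [ContinuousWithinAt, Metric.tendsto_nhds]
  intro ε hε
  have hexp : Tendsto (fun R : ℝ => 2 * M * Real.exp (-R / η)) atTop (𝓝 (2 * M * 0)) := by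
    refine (Real.tendsto_exp_atBot.comp ?_).const_mul _
    exact (tendsto_neg_atTop_atBot.atBot_div_const hη)
  rw [mul_zero] at hexp
  obtain ⟨R, hR, hR0⟩ := ((hexp.eventually (Iio_mem_nhds (half_pos hε))).and
    (eventually_ge_atTop 0)).exists
  have h1 := (hqc s hs (Icc (x - R) x) isCompact_Icc).const_mul (1 / η)
  rw [mul_zero] at h1
  filter_upwards [h1.eventually (Iio_mem_nhds (half_pos hε))] with t ht
  rw [Real.dist_eq]
  have h2 := abs_expAvg_sub_expAvg_le hη hR0 (hqm t).abs (hqm s).abs (M := M)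
    (fun x => by simpa using hqM t x) (fun x => by simpa using hqM s x) x
  have h3 : ∫ y in Icc (x - R) x, |(|q t y| - |q s y|)| ≤ ∫ y in Icc (x - R) x, |q t y - q s y| := by
    have hloc : ∀ u : ℝ → ℝ, Measurable u → (∀ x, |u x| ≤ 2 * M) → IntegrableOn u (Icc (x - R) x) :=
      fun u hu hM => (locallyIntegrable_of_bounded hu hM).integrableOn_isCompact isCompact_Icc
    refine setIntegral_mono (hloc _ ((hqm t).abs.sub (hqm s).abs).abs fun y => ?_)
      (hloc _ ((hqm t).sub (hqm s)).abs fun y => ?_) fun y => abs_abs_sub_abs_le _ _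
    · rw [abs_abs]
      refine (abs_abs_sub_abs_le _ _).trans ((abs_sub _ _).trans ?_)
      linarith [hqM t y, hqM s y]
    · rw [abs_abs]
      refine (abs_sub _ _).trans ?_
      linarith [hqM t y, hqM s y]
  have h4 := mul_le_mul_of_nonneg_left h3 (one_div_pos.2 hη).le
  linarith

theorem exists_characteristicFlow {T η M₀ : ℝ} (hT : 0 < T) (hη : 0 < η) {V : ℝ → ℝ}
    (hV : LocallyLipschitz V) (hVm : Monotone V) {q₀ : ℝ → ℝ} (hq₀ : Measurable q₀)
    (hM₀ : ∀ x, |q₀ x| ≤ M₀) {q : ℝ → ℝ → ℝ} (hq : InSolutionClass T q)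
    (hw : IsWeakSolutionNonlocal T V (expKernel η) q₀ q) :
    ∃ M L C E V' v X, M₀ ≤ M ∧ (∀ x ∈ Icc 0 M, V' x = V x) ∧
      CharacteristicFlow T η M₀ M L C E V' q₀ q v X := by
  obtain ⟨M₁, hM₁⟩ := hq.bdd
  set M := max M₁ M₀ with hMdef
  have hqM : ∀ t x, |q t x| ≤ M := fun t x => (hM₁ t x).trans (le_max_left _ _)
  have hM0 : 0 ≤ M := (abs_nonneg _).trans (hqM 0 0)
  have hqm : ∀ t, Measurable (q t) := fun t => hq.meas.comp measurable_prodMk_left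
  obtain ⟨L, hL⟩ := (hV.locallyLipschitzOn (s := Icc 0 M)).exists_lipschitzOnWith_of_compact
    isCompact_Icc
  set V' : ℝ → ℝ := fun x => V (max 0 (min x M)) with hV'
  have hlip : ∀ x y, |V' x - V' y| ≤ L * |x - y| := fun x y => by
    have h1 := hL.dist_le_mul _ (max_min_mem hM0 x) _ (max_min_mem hM0 y)
    rw [Real.dist_eq, Real.dist_eq] at h1
    exact h1.trans (mul_le_mul_of_nonneg_left (abs_max_min_sub_le 0 M x y) L.2)
  have hV'c : Continuous V' :=
    (LipschitzWith.of_dist_le_mul (K := L) fun x y => hlip x y).continuous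
  have hV'm : Monotone V' := fun x y hxy => hVm (max_le_max_left _ (min_le_min_right _ hxy))
  have hV'b : ∀ x, |V' x| ≤ |V 0| + |V M| := fun x => by
    have h1 := hVm (max_min_mem hM0 x).1
    have h2 := hVm (max_min_mem hM0 x).2
    rw [abs_le]
    constructor
    · linarith [neg_abs_le (V 0), abs_nonneg (V M)]
    · linarith [le_abs_self (V M), abs_nonneg (V 0)]
  have hqa : ∀ t x, |(|q t x|)| ≤ M := fun t x => by simpa using hqM t x
  set v : ℝ → ℝ → ℝ := fun t x => V' (expAvg η (fun y => |q (max 0 (min t T)) y|) x) with hv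
  have hvb : ∀ t x, |v t x| ≤ |V 0| + |V M| := fun t x => hV'b _
  have hvL : ∀ t, LipschitzWith (L * (2 * M / η).toNNReal) (v t) := fun t =>
    LipschitzWith.of_dist_le_mul fun x y => by
      rw [Real.dist_eq, Real.dist_eq, NNReal.coe_mul, mul_assoc]
      refine (hlip _ _).trans (mul_le_mul_of_nonneg_left ?_ L.2)
      refine (abs_expAvg_sub_le hη (hqm _).abs (hqa _) y x).trans ?_
      exact mul_le_mul_of_nonneg_right (Real.le_coe_toNNReal _) (abs_nonneg _)
  have hvt : ∀ x, Continuous fun t => v t x := fun x =>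
    hV'c.comp ((continuousOn_expAvg_time hη hqm hqM hq.timeCont x).comp_continuous
      (by fun_prop) fun t => max_min_mem hT.le t)
  have hvc : Continuous (uncurry v) := continuous_prod_of_continuous_lipschitzWith' (uncurry v)
    (L * (2 * M / η).toNNReal) hvL hvt
  have hve : ∀ t ∈ Icc 0 T, ∀ x, v t x = V' (expAvg η (fun y => |q t y|) x) := fun t ht x => by
    rw [hv]; simp only [max_min_of_mem ht]
  have hVV' : ∀ x ∈ Icc 0 M, V' x = V x := fun x hx => by
    rw [hV']; simp only [max_min_of_mem hx]
  obtain ⟨X, hX0, hXd, hXm, hXs, hXl⟩ := exists_flow (C := (|V 0| + |V M|).toNNReal) hvL hvt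
    fun t x => (hvb t x).trans (Real.le_coe_toNNReal _)
  refine ⟨M, L, |V 0| + |V M|, Real.exp ((L * (2 * M / η).toNNReal : ℝ≥0) * T), V', v, X,
    le_max_right _ _, hVV', ?_⟩
  refine ⟨hT, hη, L.2, hq₀, hM₀, hqm, hqM, le_max_right _ _, hV'm, hlip, hvc, hvb, hve, hX0, hXd,
    hXm, hXs, (Real.exp_pos _).le, ?_, ?_⟩
  · intro t ht a b
    rw [mul_comm]
    refine (hXl t ht.1 a b).trans (mul_le_mul_of_nonneg_left ?_ (abs_nonneg _))
    exact Real.exp_le_exp.2 (mul_le_mul_of_nonneg_left ht.2 (NNReal.coe_nonneg _))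
  · intro t ht a b hab
    have := mass_conservation hT hq.meas hqM hq.timeCont hq₀ hM₀ hvc hvL (fun φ hφ => ?_)
      (xa := fun s => X s a) (xb := fun s => X s b) (fun s => hXd s a) (fun s => hXd s b)
      (fun s => (hXm s).monotone hab) t ht
    · simpa only [hX0] using this
    · refine Eq.trans ?_ (hw φ hφ)
      congr 1
      refine setIntegral_congr_fun (measurableSet_Ioo (a := (0:ℝ)) (b := T)) fun s hs => ?_
      refine integral_congr_ae (ae_of_all _ fun x => ?_)
      simp only
      rw [hve s (Ioo_subset_Icc_self hs), hVV']
      · rfl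
      · exact ⟨expAvg_nonneg hη (fun _ => abs_nonneg _) x,
          (le_abs_self _).trans (abs_expAvg_le hη (hqa s) x)⟩

/-- Quantitative properties, uniform in `η`, of a density transported by characteristics. -/
structure TransportedDensity (T η M₀ B C : ℝ) (q₀ : ℝ → ℝ) (q X : ℝ → ℝ → ℝ) : Prop where
  η_pos : 0 < η
  meas : ∀ t, Measurable (q t)
  bdd : ∃ M, ∀ t x, |q t x| ≤ M
  flow_zero : ∀ a, X 0 a = a
  flow_mono : ∀ t, StrictMono (X t)
  flow_lip : ∀ s ∈ Icc 0 T, ∀ t ∈ Icc 0 T, ∀ a, |X t a - X s a| ≤ C * |t - s|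
  mass : ∀ t ∈ Icc 0 T, ∀ a b, a ≤ b → ∫ x in X t a..X t b, q t x = ∫ x in a..b, q₀ x
  mass_abs : ∀ t ∈ Icc 0 T, ∀ a b, a ≤ b → ∫ x in X t a..X t b, |q t x| = ∫ x in a..b, |q₀ x|
  ae_abs_le : ∀ t ∈ Icc 0 T, ∀ᵐ x, |q t x| ≤ M₀
  expAvg_le : ∀ t ∈ Icc 0 T, ∀ x, expAvg η (fun y => |q t y|) x ≤ M₀
  dominator : ∀ t ∈ Icc 0 T, ∃ F : ℝ → ℝ, Monotone F ∧ (∀ x, |F x| ≤ B) ∧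
    ∀ x y, x ≤ y → |expAvg η (fun z => |q t z|) y - expAvg η (fun z => |q t z|) x| ≤ F y - F x

theorem exists_transportedDensity {T η M₀ B : ℝ} (hT : 0 < T) (hη : 0 < η) {V : ℝ → ℝ}
    (hV : LocallyLipschitz V) (hVm : Monotone V) {q₀ τ : ℝ → ℝ} (hq₀ : Measurable q₀)
    (hM₀ : ∀ x, |q₀ x| ≤ M₀) (hτ : Monotone τ) (hB : ∀ x, |τ x| ≤ B)
    (hd : ∀ x y, x ≤ y → |q₀ y - q₀ x| ≤ τ y - τ x) {q : ℝ → ℝ → ℝ} (hq : InSolutionClass T q)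
    (hw : IsWeakSolutionNonlocal T V (expKernel η) q₀ q) :
    ∃ X, TransportedDensity T η M₀ B (|V 0| + |V M₀|) q₀ q X := by
  obtain ⟨M, L, C, E, V', v, X, hM, hVV', h⟩ :=
    exists_characteristicFlow hT hη hV hVm hq₀ hM₀ hq hw
  refine ⟨X, hη, h.meas, ⟨M, h.abs_dens_le⟩, h.flow_zero, h.flow_mono, ?_, h.mass,
    fun t ht a b hab => h.integral_abs_eq ht hab, fun t ht => h.ae_abs_le ht,
    fun t ht x => h.expAvg_le ht x, fun t ht => h.exists_dominator hτ hB hd ht⟩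
  intro s hs t ht a
  have := Convex.norm_image_sub_le_of_norm_hasDerivWithin_le (f := fun s => X s a)
    (f' := fun s => v s (X s a)) (s := Icc 0 T) (C := |V 0| + |V M₀|) (x := s) (y := t)
    (fun s _ => (h.flow_deriv s a).hasDerivWithinAt) (fun s hs => ?_) (convex_Icc 0 T) hs ht
  · simpa using this
  · have h0 := expAvg_nonneg hη (u := fun y => |q s y|) (fun _ => abs_nonneg _) (X s a)
    have h1 := h.expAvg_le hs (X s a)
    rw [h.vel_eq s hs, hVV' _ ⟨h0, h1.trans hM⟩, Real.norm_eq_abs, abs_le]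
    have h2 := hVm h0
    have h3 := hVm h1
    constructor
    · linarith [neg_abs_le (V 0), abs_nonneg (V M₀)]
    · linarith [le_abs_self (V M₀), abs_nonneg (V 0)]

theorem integral_shift_sub_le {F : ℝ → ℝ} {B h : ℝ} (hF : Monotone F) (hB : ∀ x, |F x| ≤ B)
    (hh : 0 ≤ h) (a b : ℝ) : ∫ x in a..b, (F (x + h) - F x) ≤ 2 * B * h := by
  have hi : ∀ c d, IntervalIntegrable F volume c d := intervalIntegrable_of_bounded hF.measurable hB
  rw [intervalIntegral.integral_sub (intervalIntegrable_of_bounded (u := fun x => F (x + h))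
      (hF.measurable.comp (measurable_add_const h)) (fun x => hB _) _ _) (hi _ _),
    intervalIntegral.integral_comp_add_right]
  have e : (∫ x in a + h..b + h, F x) - ∫ x in a..b, F x =
      (∫ x in b..b + h, F x) - ∫ x in a..a + h, F x := by
    have h1 := intervalIntegral.integral_add_adjacent_intervals (hi a (a + h)) (hi (a + h) (b + h))
    have h2 := intervalIntegral.integral_add_adjacent_intervals (hi a b) (hi b (b + h))
    linarith
  rw [e]
  have hc : ∀ c, |∫ x in c..c + h, F x| ≤ B * h := fun c => by
    have := intervalIntegral.norm_integral_le_of_norm_le_const (a := c) (b := c + h) (f := F)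
      (C := B) fun x _ => hB x
    rwa [add_sub_cancel_left, abs_of_nonneg hh] at this
  have h1 := (abs_le.1 (hc b)).2
  have h2 := (abs_le.1 (hc a)).1
  linarith

/-- If the increments of a primitive of `f` are dominated by those of a bounded monotone function,
then `f` is bounded in `L¹`. -/
theorem integral_abs_le_of_primitive {f F : ℝ → ℝ} {M B : ℝ} (hf : Measurable f)
    (hM : ∀ x, |f x| ≤ M) (hF : Monotone F) (hB : ∀ x, |F x| ≤ B)
    (h : ∀ x y, x ≤ y → |∫ z in x..y, f z| ≤ F y - F x) {a b : ℝ} (hab : a ≤ b) :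
    ∫ x in a..b, |f x| ≤ 2 * B := by
  set d : ℕ → ℝ := fun n => 1 / ((n : ℝ) + 1) with hd
  have hd0 : ∀ n, 0 < d n := fun n => by rw [hd]; positivity
  have hdl : Tendsto d atTop (𝓝[>] 0) := by
    rw [tendsto_nhdsWithin_iff]
    exact ⟨tendsto_one_div_add_atTop_nhds_zero_nat, Eventually.of_forall hd0⟩
  have hfi : ∀ c d, IntervalIntegrable f volume c d := intervalIntegrable_of_bounded hf hM
  have hcont : Continuous fun x => ∫ z in (0:ℝ)..x, f z :=
    intervalIntegral.continuous_primitive hfi 0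
  have havg : ∀ n x, ∫ z in x..x + d n, f z =
      (∫ z in (0:ℝ)..x + d n, f z) - ∫ z in (0:ℝ)..x, f z := fun n x =>
    (intervalIntegral.integral_interval_sub_left (hfi _ _) (hfi _ _)).symm
  have hbound : ∀ n x, |(∫ z in x..x + d n, f z) / d n| ≤ M := fun n x => by
    rw [abs_div, abs_of_pos (hd0 n), div_le_iff₀ (hd0 n)]
    have := intervalIntegral.norm_integral_le_of_norm_le_const (a := x) (b := x + d n) (f := f)
      (C := M) fun x _ => hM x
    rwa [add_sub_cancel_left, abs_of_pos (hd0 n)] at this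
  have hlim : Tendsto (fun n => ∫ x in a..b, |(∫ z in x..x + d n, f z) / d n|) atTop
      (𝓝 (∫ x in a..b, |f x|)) := by
    refine intervalIntegral.tendsto_integral_filter_of_dominated_convergence (fun _ => M)
      (Eventually.of_forall fun n => ?_) (Eventually.of_forall fun n => ae_of_all _ fun x _ => ?_)
      intervalIntegrable_const ?_
    · simp only [havg]
      have : Continuous fun x => |((∫ z in (0:ℝ)..x + d n, f z) - ∫ z in (0:ℝ)..x, f z) / d n| :=
        (((hcont.comp (continuous_add_const (d n))).sub hcont).div_const _).abs
      exact this.aestronglyMeasurable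
    · rw [Real.norm_eq_abs, abs_abs]; exact hbound n x
    · filter_upwards [LocallyIntegrable.ae_hasDerivAt_integral (locallyIntegrable_of_bounded hf hM)]
        with x hx _
      have h1 := (hasDerivAt_iff_tendsto_slope_zero.1 (hx x)).mono_left
        (nhdsWithin_mono 0 (fun t (ht : 0 < t) => ht.ne'))
      refine ((h1.comp hdl).abs).congr fun n => ?_
      simp only [comp_apply, intervalIntegral.integral_same, sub_zero, smul_eq_mul]
      rw [div_eq_inv_mul]
  refine le_of_tendsto' hlim fun n => ?_
  have hFi := intervalIntegrable_of_bounded (u := fun x => (F (x + d n) - F x) / d n)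
    (M := 2 * B / d n) (((hF.measurable.comp (measurable_add_const (d n))).sub
      hF.measurable).div_const _) (fun x => by
      rw [abs_div, abs_of_pos (hd0 n)]
      have := abs_sub (F (x + d n)) (F x)
      have h1 := hB x
      have h2 := hB (x + d n)
      have := hd0 n
      gcongr
      linarith) a b
  have hai : IntervalIntegrable (fun x => |(∫ z in x..x + d n, f z) / d n|) volume a b := by
    refine Continuous.intervalIntegrable ?_ _ _
    simp only [havg]
    exact (((hcont.comp (continuous_add_const (d n))).sub hcont).div_const _).abs
  refine (intervalIntegral.integral_mono_on hab hai hFi fun x _ => ?_).trans ?_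
  · rw [abs_div, abs_of_pos (hd0 n)]
    exact div_le_div_of_nonneg_right (h x _ (by linarith [hd0 n])) (hd0 n).le
  · rw [intervalIntegral.integral_div, div_le_iff₀ (hd0 n)]
    exact integral_shift_sub_le hF hB (hd0 n).le a b

/-- `L¹` bound from a sup bound on increments of the primitive together with a variation bound. -/
theorem integral_abs_le_of_dominated {f F : ℝ → ℝ} {B κ h a b : ℝ} (hf : Continuous f)
    (hF : Monotone F) (hB : ∀ x, |F x| ≤ B) (hd : ∀ x y, x ≤ y → |f y - f x| ≤ F y - F x)
    (hh : 0 < h) (hab : a ≤ b)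
    (hκ : ∀ x y, a ≤ x → x ≤ y → y ≤ b + h → |∫ z in x..y, f z| ≤ κ) :
    ∫ x in a..b, |f x| ≤ (b - a) * (κ / h) + 2 * B * h := by
  have hpt : ∀ x ∈ Icc a b, |f x| ≤ κ / h + (F (x + h) - F x) := by
    intro x hx
    have h1 : ∫ z in x..x + h, f z = h * f x + ∫ z in x..x + h, (f z - f x) := by
      rw [intervalIntegral.integral_sub (hf.intervalIntegrable _ _) intervalIntegrable_const,
        intervalIntegral.integral_const, add_sub_cancel_left, smul_eq_mul]
      ring
    have h2 : |∫ z in x..x + h, (f z - f x)| ≤ (F (x + h) - F x) * h := by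
      have := intervalIntegral.norm_integral_le_of_norm_le_const (a := x) (b := x + h)
        (f := fun z => f z - f x) (C := F (x + h) - F x) fun z hz => by
          rw [uIoc_of_le (by linarith)] at hz
          exact (hd x z hz.1.le).trans (by linarith [hF hz.2])
      rwa [add_sub_cancel_left, abs_of_pos hh] at this
    have h3 := hκ x (x + h) hx.1 (by linarith) (by linarith [hx.2])
    have h4 : h * |f x| ≤ κ + (F (x + h) - F x) * h := by
      have : h * f x = (∫ z in x..x + h, f z) - ∫ z in x..x + h, (f z - f x) := by linarith
      rw [← abs_of_pos hh, ← abs_mul, abs_of_pos hh, this]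
      exact (abs_sub _ _).trans (add_le_add h3 h2)
    rw [← sub_le_iff_le_add, le_div_iff₀ hh]
    linarith
  have hFi := intervalIntegrable_of_bounded (u := fun x => F (x + h) - F x) (M := 2 * B)
    ((hF.measurable.comp (measurable_add_const h)).sub hF.measurable) (fun x => by
      have := abs_sub (F (x + h)) (F x)
      have h1 := hB x
      have h2 := hB (x + h)
      linarith) a b
  refine (intervalIntegral.integral_mono_on hab (hf.abs.intervalIntegrable _ _)
    (intervalIntegrable_const.add hFi) hpt).trans ?_
  rw [intervalIntegral.integral_add intervalIntegrable_const hFi, intervalIntegral.integral_const,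
    smul_eq_mul]
  exact add_le_add_right (integral_shift_sub_le hF hB hh.le a b) _

theorem exists_cell {g : ℕ → ℝ} {n : ℕ} {x : ℝ} (h0 : g 0 ≤ x) (hn : x < g n) :
    ∃ j < n, g j ≤ x ∧ x < g (j + 1) := by
  classical
  have hex : ∃ k, x < g k := ⟨n, hn⟩
  have hpos : Nat.find hex ≠ 0 := fun h => by
    have := Nat.find_spec hex
    rw [h] at this
    exact absurd h0 (not_le.2 this)
  obtain ⟨j, hj⟩ := Nat.exists_eq_succ_of_ne_zero hpos
  refine ⟨j, ?_, ?_, ?_⟩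
  · have := Nat.find_min' hex hn
    lia
  · exact not_lt.1 (Nat.find_min hex (by lia))
  · have := Nat.find_spec hex
    rwa [hj] at this

namespace TransportedDensity

variable {T η M₀ B C η₁ η₂ : ℝ} {q₀ : ℝ → ℝ} {q X q₁ q₂ X₁ X₂ : ℝ → ℝ → ℝ}

theorem abs_flow_sub_le (h : TransportedDensity T η M₀ B C q₀ q X) (hC : 0 ≤ C) {t : ℝ}
    (ht : t ∈ Icc 0 T) (a : ℝ) : |X t a - a| ≤ C * T := by
  have h1 := h.flow_lip 0 ⟨le_rfl, ht.1.trans ht.2⟩ t ht a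
  rw [h.flow_zero, sub_zero, abs_of_nonneg ht.1] at h1
  exact h1.trans (mul_le_mul_of_nonneg_left ht.2 hC)

theorem intervalIntegrable (h : TransportedDensity T η M₀ B C q₀ q X) (t a b : ℝ) :
    IntervalIntegrable (q t) volume a b := by
  obtain ⟨M, hM⟩ := h.bdd
  exact intervalIntegrable_of_bounded (h.meas t) (hM t) a b

theorem continuous_expAvg (h : TransportedDensity T η M₀ B C q₀ q X) (t : ℝ) :
    Continuous (expAvg η fun y => |q t y|) := by
  obtain ⟨M, hM⟩ := h.bdd
  exact _root_.continuous_expAvg h.η_pos (h.meas t).abs (M := M) fun x => by simpa using hM t x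

theorem expAvg_mem (h : TransportedDensity T η M₀ B C q₀ q X) {t : ℝ} (ht : t ∈ Icc 0 T) (x : ℝ) :
    expAvg η (fun y => |q t y|) x ∈ Icc 0 M₀ :=
  ⟨expAvg_nonneg h.η_pos (fun _ => abs_nonneg _) x, h.expAvg_le t ht x⟩

theorem M₀_nonneg (h : TransportedDensity T η M₀ B C q₀ q X) {t : ℝ} (ht : t ∈ Icc 0 T) :
    0 ≤ M₀ := (h.expAvg_mem ht 0).1.trans (h.expAvg_mem ht 0).2

theorem integral_sub_expAvg (h : TransportedDensity T η M₀ B C q₀ q X) (t : ℝ) {x y : ℝ}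
    (hxy : x ≤ y) : ∫ z in x..y, (|q t z| - expAvg η (fun y => |q t y|) z) =
      η * (expAvg η (fun z => |q t z|) y - expAvg η (fun z => |q t z|) x) := by
  obtain ⟨M, hM⟩ := h.bdd
  exact _root_.integral_sub_expAvg h.η_pos (h.meas t).abs (M := M)
    (fun x => by simpa using hM t x) hxy

/-- The nonlocal term is `L¹`-close to the modulus of the density. -/
theorem integral_abs_sub_expAvg_le (h : TransportedDensity T η M₀ B C q₀ q X) {t : ℝ}
    (ht : t ∈ Icc 0 T) {a b : ℝ} (hab : a ≤ b) :
    ∫ x in a..b, |(|q t x| - expAvg η (fun y => |q t y|) x)| ≤ 2 * B * η := by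
  obtain ⟨M, hM⟩ := h.bdd
  obtain ⟨F, hF, hB, hd⟩ := h.dominator t ht
  have hη := h.η_pos
  have key := integral_abs_le_of_primitive
    (f := fun x => |q t x| - expAvg η (fun y => |q t y|) x) (F := fun x => η * F x)
    (M := M + M₀) (B := η * B) ((h.meas t).abs.sub (h.continuous_expAvg t).measurable) (fun x => ?_)
    (fun x y hxy => mul_le_mul_of_nonneg_left (hF hxy) hη.le) (fun x => ?_) (fun x y hxy => ?_) hab
  · linarith
  · refine (abs_sub _ _).trans (add_le_add (by simpa using hM t x) ?_)
    have := h.expAvg_mem ht x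
    rw [abs_of_nonneg this.1]; exact this.2
  · rw [abs_mul, abs_of_pos hη]
    exact mul_le_mul_of_nonneg_left (hB x) hη.le
  · rw [h.integral_sub_expAvg t hxy, abs_mul, abs_of_pos hη, ← mul_sub]
    exact mul_le_mul_of_nonneg_left (hd x y hxy) hη.le

theorem integral_abs_le (h : TransportedDensity T η M₀ B C q₀ q X) {t : ℝ}
    (ht : t ∈ Icc 0 T) {a b : ℝ} (hab : a ≤ b) : ∫ x in a..b, |q t x| ≤ M₀ * (b - a) := by
  refine (intervalIntegral.integral_mono_ae hab (h.intervalIntegrable t a b).abs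
    (intervalIntegrable_const (c := M₀)) ?_).trans (le_of_eq ?_)
  · exact h.ae_abs_le t ht
  · simp [mul_comm]

theorem integral_abs_le_max (h : TransportedDensity T η M₀ B C q₀ q X) {t : ℝ}
    (ht : t ∈ Icc 0 T) {a b δ : ℝ} (hδ : 0 ≤ δ) (hab : b - a ≤ δ) :
    ∫ x in a..b, |q t x| ≤ M₀ * δ := by
  have hM₀ := h.M₀_nonneg ht
  rcases le_total a b with h1 | h1
  · exact (h.integral_abs_le ht h1).trans (mul_le_mul_of_nonneg_left hab hM₀)
  · rw [intervalIntegral.integral_symm]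
    have : 0 ≤ ∫ x in b..a, |q t x| :=
      intervalIntegral.integral_nonneg h1 fun _ _ => abs_nonneg _
    have := mul_nonneg hM₀ hδ
    linarith

theorem primitive_sub_le (h₁ : TransportedDensity T η₁ M₀ B C q₀ q₁ X₁)
    (h₂ : TransportedDensity T η₂ M₀ B C q₀ q₂ X₂) (hq₀ : Measurable q₀) (hM₀ : ∀ x, |q₀ x| ≤ M₀)
    {t : ℝ} (ht : t ∈ Icc 0 T) {s m δ : ℝ} (hm : 0 ≤ m) {n : ℕ}
    (hδ : ∀ j ≤ n, |X₁ t (s + j * m) - X₂ t (s + j * m)| ≤ δ)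
    {x : ℝ} (h0 : X₁ t s ≤ x) (hn : x < X₁ t (s + n * m)) :
    (∫ z in X₁ t s..x, |q₁ t z|) - ∫ z in X₂ t s..x, |q₂ t z| ≤ M₀ * (m + δ) := by
  obtain ⟨j, hj, hj1, hj2⟩ := exists_cell (g := fun j : ℕ => X₁ t (s + j * m)) (x := x)
    (by simpa using h0) hn
  have hi₁ := fun a b => (h₁.intervalIntegrable t a b).abs
  have hi₂ := fun a b => (h₂.intervalIntegrable t a b).abs
  have hi₀ := fun a b => (intervalIntegrable_of_bounded hq₀ hM₀ a b).abs
  have hsj : s ≤ s + j * m := by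
    have : 0 ≤ (j:ℝ) * m := by positivity
    linarith
  have hcell : s + j * m ≤ s + (j + 1 : ℕ) * m := by push_cast; linarith
  have e1 : ∫ z in X₁ t s..x, |q₁ t z| ≤ ∫ z in s..s + (j + 1 : ℕ) * m, |q₀ z| := by
    rw [← h₁.mass_abs t ht _ _ (hsj.trans hcell), ← intervalIntegral.integral_add_adjacent_intervals
      (hi₁ (X₁ t s) x) (hi₁ x (X₁ t (s + (j + 1 : ℕ) * m)))]
    have : 0 ≤ ∫ z in x..X₁ t (s + (j + 1 : ℕ) * m), |q₁ t z| :=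
      intervalIntegral.integral_nonneg hj2.le fun z _ => abs_nonneg (q₁ t z)
    linarith
  have e2 : ∫ z in s..s + (j + 1 : ℕ) * m, |q₀ z| ≤ (∫ z in s..s + j * m, |q₀ z|) + M₀ * m := by
    rw [← intervalIntegral.integral_add_adjacent_intervals (hi₀ s (s + j * m)) (hi₀ _ _)]
    have := intervalIntegral.norm_integral_le_of_norm_le_const (a := s + j * m)
      (b := s + (j + 1 : ℕ) * m) (f := fun z => |q₀ z|) (C := M₀) fun z _ => by
        simpa using hM₀ z
    rw [abs_of_nonneg (sub_nonneg.2 hcell)] at this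
    have h3 := (le_abs_self _).trans this
    have h4 : s + ((j + 1 : ℕ) : ℝ) * m - (s + j * m) = m := by push_cast; ring
    rw [h4] at h3
    linarith
  have hδj := abs_le.1 (hδ j hj.le)
  have e3 : (∫ z in s..s + j * m, |q₀ z|) ≤ (∫ z in X₂ t s..x, |q₂ t z|) + M₀ * δ := by
    rw [← h₂.mass_abs t ht _ _ hsj, ← intervalIntegral.integral_add_adjacent_intervals
      (hi₂ (X₂ t s) x) (hi₂ x (X₂ t (s + j * m)))]
    have := h₂.integral_abs_le_max ht (a := x) (b := X₂ t (s + j * m)) (δ := δ)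
      ((abs_nonneg _).trans (hδ j hj.le)) (by linarith [hδj.1])
    linarith
  linarith

theorem abs_integral_abs_sub_abs_le (h₁ : TransportedDensity T η₁ M₀ B C q₀ q₁ X₁)
    (h₂ : TransportedDensity T η₂ M₀ B C q₀ q₂ X₂) (hq₀ : Measurable q₀) (hM₀ : ∀ x, |q₀ x| ≤ M₀)
    {t : ℝ} (ht : t ∈ Icc 0 T) {s m δ : ℝ} (hm : 0 ≤ m) {n : ℕ}
    (hδ : ∀ j ≤ n, |X₁ t (s + j * m) - X₂ t (s + j * m)| ≤ δ)
    {x y : ℝ} (hxy : x ≤ y) (h01 : X₁ t s ≤ x) (h02 : X₂ t s ≤ x)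
    (hn1 : y < X₁ t (s + n * m)) (hn2 : y < X₂ t (s + n * m)) :
    |∫ z in x..y, (|q₁ t z| - |q₂ t z|)| ≤ 2 * (M₀ * (m + δ)) := by
  have hδ' : ∀ j ≤ n, |X₂ t (s + j * m) - X₁ t (s + j * m)| ≤ δ := fun j hj => by
    rw [abs_sub_comm]; exact hδ j hj
  have hi₁ := fun a b => (h₁.intervalIntegrable t a b).abs
  have hi₂ := fun a b => (h₂.intervalIntegrable t a b).abs
  rw [intervalIntegral.integral_sub (hi₁ _ _) (hi₂ _ _)]
  have a1 := intervalIntegral.integral_add_adjacent_intervals (hi₁ (X₁ t s) x) (hi₁ x y)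
  have a2 := intervalIntegral.integral_add_adjacent_intervals (hi₂ (X₂ t s) x) (hi₂ x y)
  have b1 := primitive_sub_le h₁ h₂ hq₀ hM₀ ht hm hδ h01 (hxy.trans_lt hn1)
  have b2 := primitive_sub_le h₁ h₂ hq₀ hM₀ ht hm hδ (h01.trans hxy) hn1
  have b3 := primitive_sub_le h₂ h₁ hq₀ hM₀ ht hm hδ' h02 (hxy.trans_lt hn2)
  have b4 := primitive_sub_le h₂ h₁ hq₀ hM₀ ht hm hδ' (h02.trans hxy) hn2
  rw [abs_le]
  constructor <;> linarith

/-- `L¹` stability of the modulus of the density in terms of the flow on a grid. -/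
theorem integral_abs_abs_sub_abs_le (h₁ : TransportedDensity T η₁ M₀ B C q₀ q₁ X₁)
    (h₂ : TransportedDensity T η₂ M₀ B C q₀ q₂ X₂) (hq₀ : Measurable q₀) (hM₀ : ∀ x, |q₀ x| ≤ M₀)
    {t : ℝ} (ht : t ∈ Icc 0 T) {s m δ : ℝ} (hm : 0 ≤ m) {n : ℕ}
    (hδ : ∀ j ≤ n, |X₁ t (s + j * m) - X₂ t (s + j * m)| ≤ δ)
    {a b d : ℝ} (hab : a ≤ b) (hd : 0 < d) (h01 : X₁ t s ≤ a) (h02 : X₂ t s ≤ a)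
    (hn1 : b + d < X₁ t (s + n * m)) (hn2 : b + d < X₂ t (s + n * m)) :
    ∫ x in a..b, |(|q₁ t x| - |q₂ t x|)| ≤ 2 * B * (η₁ + η₂) +
      ((b - a) * ((2 * (M₀ * (m + δ)) + M₀ * (η₁ + η₂)) / d) + 4 * B * d) := by
  obtain ⟨F₁, hF₁, hB₁, hd₁⟩ := h₁.dominator t ht
  obtain ⟨F₂, hF₂, hB₂, hd₂⟩ := h₂.dominator t ht
  set W₁ := expAvg η₁ fun y => |q₁ t y| with hW₁
  set W₂ := expAvg η₂ fun y => |q₂ t y| with hW₂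
  have hc₁ : Continuous W₁ := h₁.continuous_expAvg t
  have hc₂ : Continuous W₂ := h₂.continuous_expAvg t
  have hi₁ := fun a b => (h₁.intervalIntegrable t a b).abs
  have hi₂ := fun a b => (h₂.intervalIntegrable t a b).abs
  have hj₁ := fun a b => (hi₁ a b).sub (hc₁.intervalIntegrable a b)
  have hj₂ := fun a b => (hi₂ a b).sub (hc₂.intervalIntegrable a b)
  have hW := integral_abs_le_of_dominated (f := fun x => W₁ x - W₂ x) (F := fun x => F₁ x + F₂ x)
    (B := 2 * B) (κ := 2 * (M₀ * (m + δ)) + M₀ * (η₁ + η₂)) (hc₁.sub hc₂) (hF₁.add hF₂)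
    (fun x => ?_) (fun x y hxy => ?_) hd hab (fun x y hx hxy hy => ?_)
  · have e1 := h₁.integral_abs_sub_expAvg_le ht hab
    have e2 := h₂.integral_abs_sub_expAvg_le ht hab
    have : ∫ x in a..b, |(|q₁ t x| - |q₂ t x|)| ≤ ∫ x in a..b, (|(|q₁ t x| - W₁ x)| +
        |(|q₂ t x| - W₂ x)| + |W₁ x - W₂ x|) := by
      refine intervalIntegral.integral_mono_on hab ((hi₁ _ _).sub (hi₂ _ _)).abs
        (((hj₁ _ _).abs.add (hj₂ _ _).abs).add ((hc₁.sub hc₂).abs.intervalIntegrable _ _))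
        fun x _ => ?_
      have g1 := abs_sub_le |q₁ t x| (W₁ x) |q₂ t x|
      have g2 := abs_sub_le (W₁ x) (W₂ x) |q₂ t x|
      rw [abs_sub_comm (W₂ x)] at g2
      linarith
    rw [intervalIntegral.integral_add (f := fun x => |(|q₁ t x| - W₁ x)| + |(|q₂ t x| - W₂ x)|)
      (g := fun x => |W₁ x - W₂ x|) ((hj₁ _ _).abs.add (hj₂ _ _).abs) ((hc₁.sub hc₂).abs.intervalIntegrable _ _),
      intervalIntegral.integral_add (hj₁ _ _).abs (hj₂ _ _).abs] at this
    linarith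
  · exact (abs_add_le _ _).trans (by linarith [hB₁ x, hB₂ x])
  · have : W₁ y - W₂ y - (W₁ x - W₂ x) = (W₁ y - W₁ x) - (W₂ y - W₂ x) := by ring
    rw [this]
    refine (abs_sub _ _).trans ?_
    linarith [hd₁ x y hxy, hd₂ x y hxy]
  · have g1 := h₁.integral_sub_expAvg t hxy
    have g2 := h₂.integral_sub_expAvg t hxy
    have g3 := abs_integral_abs_sub_abs_le h₁ h₂ hq₀ hM₀ ht hm hδ hxy (h01.trans hx) (h02.trans hx)
      (hy.trans_lt hn1) (hy.trans_lt hn2)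
    rw [intervalIntegral.integral_sub (hi₁ _ _) (hc₁.intervalIntegrable _ _), ← hW₁] at g1
    rw [intervalIntegral.integral_sub (hi₂ _ _) (hc₂.intervalIntegrable _ _), ← hW₂] at g2
    rw [intervalIntegral.integral_sub (hi₁ _ _) (hi₂ _ _)] at g3
    rw [intervalIntegral.integral_sub (hc₁.intervalIntegrable _ _) (hc₂.intervalIntegrable _ _)]
    have k : ∀ {p r : ℝ}, p ∈ Icc 0 M₀ → r ∈ Icc 0 M₀ → |p - r| ≤ M₀ := fun hp hr =>
      abs_le.2 ⟨by linarith [hp.1, hr.2], by linarith [hp.2, hr.1]⟩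
    have k1 := abs_le.1 (k (h₁.expAvg_mem ht y) (h₁.expAvg_mem ht x))
    have k2 := abs_le.1 (k (h₂.expAvg_mem ht y) (h₂.expAvg_mem ht x))
    rw [← hW₁] at k1
    rw [← hW₂] at k2
    have l1 := mul_le_mul_of_nonneg_left k1.1 h₁.η_pos.le
    have l2 := mul_le_mul_of_nonneg_left k1.2 h₁.η_pos.le
    have l3 := mul_le_mul_of_nonneg_left k2.1 h₂.η_pos.le
    have l4 := mul_le_mul_of_nonneg_left k2.2 h₂.η_pos.le
    have g4 := abs_le.1 g3
    rw [abs_le]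
    constructor <;> linarith

/-- On each Lagrangian cell the density has almost constant sign. -/
theorem integral_abs_sub_sign_le (h : TransportedDensity T η M₀ B C q₀ q X) (hq₀ : Measurable q₀)
    (hM₀ : ∀ x, |q₀ x| ≤ M₀) {τ : ℝ → ℝ} (hτ : Monotone τ)
    (hd : ∀ x y, x ≤ y → |q₀ y - q₀ x| ≤ τ y - τ x) {t : ℝ} (ht : t ∈ Icc 0 T) {a b σ : ℝ}
    (hab : a ≤ b) (hσ : σ = 1 ∨ σ = -1) (hσa : q₀ a = σ * |q₀ a|) :
    ∫ x in X t a..X t b, |q t x - σ * (|q t x|)| ≤ 2 * (τ b - τ a) * (b - a) := by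
  have hX := (h.flow_mono t).monotone hab
  have hi := h.intervalIntegrable t
  have hi₀ := intervalIntegrable_of_bounded hq₀ hM₀
  have key : ∀ r : ℝ, |r - σ * (|r|)| = |r| - σ * r := by
    intro r
    rcases hσ with rfl | rfl
    · rw [one_mul, one_mul, abs_sub_comm, abs_of_nonneg (sub_nonneg.2 (le_abs_self r))]
    · have : r - -1 * |r| = |r| - -1 * r := by ring
      rw [this, abs_of_nonneg]; linarith [neg_abs_le r]
  simp only [key]
  rw [intervalIntegral.integral_sub (hi _ _).abs ((hi _ _).const_mul σ),
    intervalIntegral.integral_const_mul, h.mass t ht a b hab, h.mass_abs t ht a b hab,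
    ← intervalIntegral.integral_const_mul,
    ← intervalIntegral.integral_sub (hi₀ _ _).abs ((hi₀ _ _).const_mul σ)]
  have := intervalIntegral.norm_integral_le_of_norm_le_const (a := a) (b := b)
    (f := fun x => |q₀ x| - σ * q₀ x) (C := 2 * (τ b - τ a)) fun x hx => ?_
  · rw [abs_of_nonneg (sub_nonneg.2 hab)] at this
    exact (le_abs_self _).trans this
  · rw [uIoc_of_le hab] at hx
    have h1 := hd a x hx.1.le
    have h2 := hτ hx.2
    have h3 := (abs_abs_sub_abs_le (q₀ x) (q₀ a)).trans h1
    have hσ1 : |σ| = 1 := by rcases hσ with rfl | rfl <;> simp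
    rw [Real.norm_eq_abs, ← key, abs_abs]
    have e : q₀ x - σ * |q₀ x| = (q₀ x - q₀ a) - σ * (|q₀ x| - |q₀ a|) := by
      rw [mul_sub, ← hσa]; ring
    rw [e]
    refine (abs_sub _ _).trans ?_
    rw [abs_mul, hσ1]
    linarith

end TransportedDensity

namespace TransportedDensity

variable {T η M₀ B C η₁ η₂ : ℝ} {q₀ : ℝ → ℝ} {q X q₁ q₂ X₁ X₂ : ℝ → ℝ → ℝ}

theorem integral_abs_sub_cell_le (h₁ : TransportedDensity T η₁ M₀ B C q₀ q₁ X₁)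
    (h₂ : TransportedDensity T η₂ M₀ B C q₀ q₂ X₂) (hq₀ : Measurable q₀) (hM₀ : ∀ x, |q₀ x| ≤ M₀)
    {τ : ℝ → ℝ} (hτ : Monotone τ) (hd : ∀ x y, x ≤ y → |q₀ y - q₀ x| ≤ τ y - τ x)
    {t : ℝ} (ht : t ∈ Icc 0 T) {a b δ : ℝ} (hab : a ≤ b) (ha : |X₁ t a - X₂ t a| ≤ δ)
    (hb : |X₁ t b - X₂ t b| ≤ δ) :
    ∫ x in X₁ t a..X₁ t b, |q₁ t x - q₂ t x| ≤
      (∫ x in X₁ t a..X₁ t b, |(|q₁ t x| - |q₂ t x|)|) +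
        (4 * (τ b - τ a) * (b - a) + 4 * M₀ * δ) := by
  have hX := (h₁.flow_mono t).monotone hab
  have hi₁ := h₁.intervalIntegrable t
  have hi₂ := h₂.intervalIntegrable t
  have hM := h₁.M₀_nonneg ht
  obtain ⟨σ, hσ, hσa⟩ : ∃ σ : ℝ, (σ = 1 ∨ σ = -1) ∧ q₀ a = σ * |q₀ a| := by
    rcases le_total 0 (q₀ a) with h | h
    · exact ⟨1, Or.inl rfl, by rw [abs_of_nonneg h, one_mul]⟩
    · exact ⟨-1, Or.inr rfl, by rw [abs_of_nonpos h]; ring⟩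
  have hσ1 : |σ| = 1 := by rcases hσ with rfl | rfl <;> simp
  have d1 := h₁.integral_abs_sub_sign_le hq₀ hM₀ hτ hd ht hab hσ hσa
  have d2 := h₂.integral_abs_sub_sign_le hq₀ hM₀ hτ hd ht hab hσ hσa
  have hg₁ := fun c d => ((hi₁ c d).sub ((hi₁ c d).abs.const_mul σ)).abs
  have hg₂ := fun c d => ((hi₂ c d).sub ((hi₂ c d).abs.const_mul σ)).abs
  have hsmall : ∀ c d, |c - d| ≤ δ → ∫ x in c..d, |q₂ t x - σ * (|q₂ t x|)| ≤ 2 * M₀ * δ := by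
    intro c d hcd
    have := intervalIntegral.norm_integral_le_of_norm_le_const_ae (a := c) (b := d)
      (f := fun x => |q₂ t x - σ * (|q₂ t x|)|) (C := 2 * M₀) (by
        filter_upwards [h₂.ae_abs_le t ht] with x hx _
        rw [Real.norm_eq_abs, abs_abs]
        refine (abs_sub _ _).trans ?_
        rw [abs_mul, hσ1, abs_abs]; linarith)
    rw [abs_sub_comm] at this
    exact ((le_abs_self _).trans this).trans (mul_le_mul_of_nonneg_left hcd (by positivity))
  have d3 : ∫ x in X₁ t a..X₁ t b, |q₂ t x - σ * (|q₂ t x|)| ≤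
      2 * (τ b - τ a) * (b - a) + 4 * M₀ * δ := by
    rw [← intervalIntegral.integral_add_adjacent_intervals (hg₂ (X₁ t a) (X₂ t a))
      (hg₂ (X₂ t a) (X₁ t b)), ← intervalIntegral.integral_add_adjacent_intervals
      (hg₂ (X₂ t a) (X₂ t b)) (hg₂ (X₂ t b) (X₁ t b))]
    have e1 := hsmall _ _ ha
    have e2 := hsmall (X₂ t b) (X₁ t b) (by rwa [abs_sub_comm])
    linarith
  have hu := ((hi₁ (X₁ t a) (X₁ t b)).abs.sub (hi₂ (X₁ t a) (X₁ t b)).abs).abs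
  have d4 : ∫ x in X₁ t a..X₁ t b, |q₁ t x - q₂ t x| ≤ ∫ x in X₁ t a..X₁ t b,
      (|(|q₁ t x| - |q₂ t x|)| + (|q₁ t x - σ * (|q₁ t x|)| + |q₂ t x - σ * (|q₂ t x|)|)) := by
    refine intervalIntegral.integral_mono_on hX ((hi₁ _ _).sub (hi₂ _ _)).abs
      (hu.add ((hg₁ _ _).add (hg₂ _ _))) fun x _ => ?_
    have e : q₁ t x - q₂ t x = σ * (|q₁ t x| - |q₂ t x|) +
        ((q₁ t x - σ * |q₁ t x|) - (q₂ t x - σ * |q₂ t x|)) := by ring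
    rw [e]
    refine (abs_add_le _ _).trans (add_le_add ?_ (abs_sub _ _))
    rw [abs_mul, hσ1, one_mul]
  rw [intervalIntegral.integral_add hu ((hg₁ _ _).add (hg₂ _ _)),
    intervalIntegral.integral_add (hg₁ _ _) (hg₂ _ _)] at d4
  linarith

/-- `L¹` stability of the density in terms of its modulus and of the flow on a grid. -/
theorem integral_abs_sub_le (h₁ : TransportedDensity T η₁ M₀ B C q₀ q₁ X₁)
    (h₂ : TransportedDensity T η₂ M₀ B C q₀ q₂ X₂) (hq₀ : Measurable q₀) (hM₀ : ∀ x, |q₀ x| ≤ M₀)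
    {τ : ℝ → ℝ} (hτ : Monotone τ) (hB : ∀ x, |τ x| ≤ B)
    (hd : ∀ x y, x ≤ y → |q₀ y - q₀ x| ≤ τ y - τ x)
    {t : ℝ} (ht : t ∈ Icc 0 T) {s m δ : ℝ} (hm : 0 ≤ m) {n : ℕ}
    (hδ : ∀ j ≤ n, |X₁ t (s + j * m) - X₂ t (s + j * m)| ≤ δ) :
    ∫ x in X₁ t s..X₁ t (s + n * m), |q₁ t x - q₂ t x| ≤
      (∫ x in X₁ t s..X₁ t (s + n * m), |(|q₁ t x| - |q₂ t x|)|) +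
        (8 * B * m + 4 * n * M₀ * δ) := by
  have hi₁ := h₁.intervalIntegrable t
  have hi₂ := h₂.intervalIntegrable t
  have key : ∀ k ≤ n, ∫ x in X₁ t s..X₁ t (s + k * m), |q₁ t x - q₂ t x| ≤
      (∫ x in X₁ t s..X₁ t (s + k * m), |(|q₁ t x| - |q₂ t x|)|) +
        (4 * (τ (s + k * m) - τ s) * m + 4 * k * M₀ * δ) := by
    intro k
    induction k with
    | zero => simp
    | succ k ih =>
      intro hk
      have hcell : s + k * m ≤ s + (k + 1 : ℕ) * m := by push_cast; linarith
      have h1 := ih (by lia)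
      have h2 := integral_abs_sub_cell_le h₁ h₂ hq₀ hM₀ hτ hd ht hcell (hδ k (by lia)) (hδ _ hk)
      have h4 : s + ((k + 1 : ℕ) : ℝ) * m - (s + k * m) = m := by push_cast; ring
      rw [h4] at h2
      rw [← intervalIntegral.integral_add_adjacent_intervals
        (((hi₁ (X₁ t s) (X₁ t (s + k * m))).sub (hi₂ _ _)).abs)
        (((hi₁ (X₁ t (s + k * m)) (X₁ t (s + (k + 1 : ℕ) * m))).sub (hi₂ _ _)).abs),
        ← intervalIntegral.integral_add_adjacent_intervals
        (((hi₁ (X₁ t s) (X₁ t (s + k * m))).abs.sub (hi₂ _ _).abs).abs)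
        (((hi₁ (X₁ t (s + k * m)) (X₁ t (s + (k + 1 : ℕ) * m))).abs.sub (hi₂ _ _).abs).abs)]
      have e : 4 * ((k + 1 : ℕ) : ℝ) * M₀ * δ = 4 * k * M₀ * δ + 4 * M₀ * δ := by
        push_cast; ring
      rw [e]
      linarith
  have h1 := key n le_rfl
  have h2 : 4 * (τ (s + n * m) - τ s) * m ≤ 8 * B * m := by
    refine mul_le_mul_of_nonneg_right ?_ hm
    linarith [(abs_le.1 (hB (s + n * m))).2, (abs_le.1 (hB s)).1]
  linarith

end TransportedDensity

namespace TransportedDensity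

variable {T M₀ B C : ℝ} {q₀ : ℝ → ℝ} {η : ℕ → ℝ} {q X : ℕ → ℝ → ℝ → ℝ}

/-- Compactness of the flows on a countable set of starting points, uniformly in time. -/
theorem exists_subseq_flow (hT : 0 < T) (hC : 0 ≤ C)
    (h : ∀ k, TransportedDensity T (η k) M₀ B C q₀ (q k) (X k)) {ι : Type*} [Countable ι]
    (c : ι → ℝ) : ∃ ψ : ℕ → ℕ, StrictMono ψ ∧ ∀ i, ∀ ε > 0, ∀ᶠ n : ℕ × ℕ in atTop,
      ∀ t ∈ Icc 0 T, |X (ψ n.1) t (c i) - X (ψ n.2) t (c i)| ≤ ε := by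
  set r : ℕ × ℕ → ℝ := fun p => max 0 (min (p.1 * (T / (p.2 + 1))) T) with hr
  have hrT : ∀ p, r p ∈ Icc 0 T := fun p => max_min_mem hT.le _
  set K : Set ((ℕ × ℕ) × ι → ℝ) := univ.pi fun p => Icc (c p.2 - C * T) (c p.2 + C * T) with hK
  have hKc : IsCompact K := isCompact_univ_pi fun p => isCompact_Icc
  obtain ⟨x, -, ψ, hψ, hx⟩ := hKc.tendsto_subseq (x := fun k p => X k (r p.1) (c p.2)) fun k p _ => by
    have := abs_le.1 ((h k).abs_flow_sub_le hC (hrT p.1) (c p.2))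
    exact ⟨by linarith [this.1], by linarith [this.2]⟩
  refine ⟨ψ, hψ, fun i ε hε => ?_⟩
  obtain ⟨N, hN⟩ := exists_nat_gt (C * T / (ε / 4))
  have hfin : ∀ᶠ n : ℕ × ℕ in atTop, ∀ j ∈ Finset.range (N + 2),
      |X (ψ n.1) (r (j, N)) (c i) - X (ψ n.2) (r (j, N)) (c i)| < ε / 2 := by
    refine (Finset.eventually_all _).2 fun j _ => ?_
    have h1 : Tendsto (fun k => X (ψ k) (r (j, N)) (c i)) atTop (𝓝 (x ((j, N), i))) :=
      (tendsto_pi_nhds.1 hx) ((j, N), i)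
    have h2 := cauchySeq_iff_tendsto_dist_atTop_0.1 h1.cauchySeq
    filter_upwards [h2.eventually (Iio_mem_nhds (half_pos hε))] with n hn
    rwa [Real.dist_eq] at hn
  filter_upwards [hfin] with n hn t ht
  have hN1 : (0:ℝ) < N + 1 := by positivity
  set j := ⌊t / (T / (N + 1))⌋₊ with hj
  have hd : 0 < T / (N + 1) := by positivity
  have hj1 : j * (T / (N + 1)) ≤ t := by
    rw [← le_div_iff₀ hd]; exact Nat.floor_le (div_nonneg ht.1 hd.le)
  have hj2 : t < (j + 1) * (T / (N + 1)) := by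
    rw [← div_lt_iff₀ hd]; exact Nat.lt_floor_add_one _
  have hjN : j < N + 2 := by
    have h1 : j * (T / (N + 1)) ≤ T := hj1.trans ht.2
    have h2 : (j:ℝ) ≤ N + 1 := by
      rw [mul_div_assoc', div_le_iff₀ hN1] at h1
      nlinarith
    have h3 : j ≤ N + 1 := by exact_mod_cast h2
    lia
  have hrj : r (j, N) = j * (T / (N + 1)) :=
    max_min_of_mem ⟨by positivity, hj1.trans ht.2⟩
  have hdist : C * |t - r (j, N)| ≤ ε / 4 := by
    rw [hrj, abs_of_nonneg (by linarith)]
    have h1 : t - j * (T / (N + 1)) ≤ T / (N + 1) := by linarith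
    refine (mul_le_mul_of_nonneg_left h1 hC).trans ?_
    rw [mul_div_assoc', div_le_iff₀ hN1]
    rw [div_lt_iff₀ (by positivity)] at hN
    nlinarith
  have e1 := ((h (ψ n.1)).flow_lip _ (hrT (j, N)) t ht (c i)).trans hdist
  have e2 := ((h (ψ n.2)).flow_lip _ (hrT (j, N)) t ht (c i)).trans hdist
  have e3 := hn j (Finset.mem_range.2 hjN)
  rw [abs_le] at e1 e2 ⊢
  rw [abs_lt] at e3
  constructor <;> linarith [e1.1, e1.2, e2.1, e2.2, e3.1, e3.2]

/-- Uniform-in-time convergence of the flows at the points of all uniform grids. -/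
def FlowCauchy (T : ℝ) (X : ℕ → ℝ → ℝ → ℝ) : Prop :=
  ∀ S p j : ℕ, ∀ ε > 0, ∀ᶠ n : ℕ × ℕ in atTop, ∀ t ∈ Icc 0 T,
    |X n.1 t (-S + j * (1 / ((p:ℝ) + 1))) - X n.2 t (-S + j * (1 / ((p:ℝ) + 1)))| ≤ ε

theorem FlowCauchy.eventually_grid (hX : FlowCauchy T X) (S p n : ℕ) {δ : ℝ} (hδ : 0 < δ) :
    ∀ᶠ k : ℕ × ℕ in atTop, ∀ t ∈ Icc 0 T, ∀ j ≤ n,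
      |X k.1 t (-S + j * (1 / ((p:ℝ) + 1))) - X k.2 t (-S + j * (1 / ((p:ℝ) + 1)))| ≤ δ := by
  have : ∀ᶠ k : ℕ × ℕ in atTop, ∀ j ∈ Finset.range (n + 1), ∀ t ∈ Icc 0 T,
      |X k.1 t (-S + j * (1 / ((p:ℝ) + 1))) - X k.2 t (-S + j * (1 / ((p:ℝ) + 1)))| ≤ δ :=
    (Finset.eventually_all _).2 fun j _ => hX S p j δ hδ
  filter_upwards [this] with k hk t ht j hj
  exact hk j (Finset.mem_range.2 (by lia)) t ht

theorem grid_end (S p : ℕ) :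
    -(S:ℝ) + ((2 * S * (p + 1) : ℕ) : ℝ) * (1 / ((p:ℝ) + 1)) = S := by
  push_cast; field_simp; ring

theorem eventually_integral_abs_abs_sub_abs_le (hC : 0 ≤ C) (hB0 : 0 ≤ B)
    (h : ∀ k, TransportedDensity T (η k) M₀ B C q₀ (q k) (X k)) (hη : Tendsto η atTop (𝓝 0))
    (hq₀ : Measurable q₀) (hM₀ : ∀ x, |q₀ x| ≤ M₀) (hX : FlowCauchy T X) (N : ℕ) {ε : ℝ}
    (hε : 0 < ε) : ∀ᶠ n : ℕ × ℕ in atTop, ∀ t ∈ Icc 0 T,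
      ∫ x in (-N:ℝ)..N, |(|q n.1 t x| - |q n.2 t x|)| ≤ ε := by
  have hM : 0 ≤ M₀ := (abs_nonneg _).trans (hM₀ 0)
  set d := ε / (8 * (B + 1)) with hd
  have hd0 : 0 < d := by positivity
  have hdε : 4 * B * d ≤ ε / 2 := by
    rw [hd, mul_div_assoc', div_le_iff₀ (by positivity)]; nlinarith
  set K := 2 * B + 10 * N * M₀ / d with hK
  have hK0 : 0 ≤ K := by positivity
  set θ := ε / (2 * (K + 1)) with hθ
  have hθ0 : 0 < θ := by positivity
  have hθε : K * θ ≤ ε / 2 := by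
    rw [hθ, mul_div_assoc', div_le_iff₀ (by positivity)]; nlinarith
  obtain ⟨p, hp⟩ := exists_nat_one_div_lt hθ0
  obtain ⟨S, hS⟩ := exists_nat_gt (N + d + C * T)
  have hη2 : ∀ᶠ n : ℕ × ℕ in atTop, η n.1 + η n.2 < θ := by
    have h1 : ∀ᶠ k in atTop, η k < θ / 2 := hη.eventually (Iio_mem_nhds (half_pos hθ0))
    rw [← prod_atTop_atTop_eq]
    filter_upwards [h1.prod_mk h1] with n hn
    linarith [hn.1, hn.2]
  filter_upwards [hη2, hX.eventually_grid S p (2 * S * (p + 1)) hθ0] with n hn hgrid t ht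
  have hfl := fun k a => abs_le.1 ((h k).abs_flow_sub_le hC ht a)
  have hNN : (-N:ℝ) ≤ N := by linarith [Nat.cast_nonneg (α := ℝ) N]
  have key := integral_abs_abs_sub_abs_le (h n.1) (h n.2) hq₀ hM₀ ht (s := -S)
    (m := 1 / ((p:ℝ) + 1)) (by positivity) (hgrid t ht) (a := -N) (b := N) hNN hd0
    (by linarith [(hfl n.1 (-S)).2]) (by linarith [(hfl n.2 (-S)).2])
    (by rw [grid_end]; linarith [(hfl n.1 S).1]) (by rw [grid_end]; linarith [(hfl n.2 S).1])
  refine key.trans ?_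
  have e1 : 2 * B * (η n.1 + η n.2) ≤ 2 * B * θ := by gcongr
  have e2 : ((N:ℝ) - -N) * ((2 * (M₀ * (1 / ((p:ℝ) + 1) + θ)) + M₀ * (η n.1 + η n.2)) / d) ≤
      ((N:ℝ) - -N) * ((2 * (M₀ * (θ + θ)) + M₀ * θ) / d) := by
    have : (0:ℝ) ≤ N - -N := by linarith
    gcongr
  have e3 : ((N:ℝ) - -N) * ((2 * (M₀ * (θ + θ)) + M₀ * θ) / d) = 10 * N * M₀ / d * θ := by ring
  have e4 : K * θ = 2 * B * θ + 10 * N * M₀ / d * θ := by rw [hK]; ring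
  linarith

theorem eventually_integral_abs_sub_le (hC : 0 ≤ C) (hB0 : 0 ≤ B)
    (h : ∀ k, TransportedDensity T (η k) M₀ B C q₀ (q k) (X k)) (hη : Tendsto η atTop (𝓝 0))
    (hq₀ : Measurable q₀) (hM₀ : ∀ x, |q₀ x| ≤ M₀) {τ : ℝ → ℝ} (hτ : Monotone τ)
    (hB : ∀ x, |τ x| ≤ B) (hd : ∀ x y, x ≤ y → |q₀ y - q₀ x| ≤ τ y - τ x)
    (hX : FlowCauchy T X) (N : ℕ) {ε : ℝ} (hε : 0 < ε) :
    ∀ᶠ n : ℕ × ℕ in atTop, ∀ t ∈ Icc 0 T,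
      ∫ x in (-N:ℝ)..N, |q n.1 t x - q n.2 t x| ≤ ε := by
  have hM : 0 ≤ M₀ := (abs_nonneg _).trans (hM₀ 0)
  obtain ⟨S, hS⟩ := exists_nat_gt (N + C * T)
  obtain ⟨N', hN'⟩ := exists_nat_gt (S + C * T)
  set θ := ε / 3 / (8 * B + 1) with hθ
  have hθ0 : 0 < θ := by positivity
  have hθε : 8 * B * θ ≤ ε / 3 := by
    rw [hθ, mul_div_assoc', div_le_iff₀ (by positivity)]; nlinarith
  obtain ⟨p, hp⟩ := exists_nat_one_div_lt hθ0
  set n₀ := 2 * S * (p + 1) with hn₀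
  set δ := ε / 3 / (4 * n₀ * M₀ + 1) with hδ
  have hδ0 : 0 < δ := by positivity
  have hδε : 4 * n₀ * M₀ * δ ≤ ε / 3 := by
    rw [hδ, mul_div_assoc', div_le_iff₀ (by positivity)]; nlinarith
  have hε3 : 0 < ε / 3 := by positivity
  filter_upwards [hX.eventually_grid S p n₀ hδ0,
    eventually_integral_abs_abs_sub_abs_le hC hB0 h hη hq₀ hM₀ hX N' hε3] with n hgrid hu t ht
  have hfl := fun k a => abs_le.1 ((h k).abs_flow_sub_le hC ht a)
  have hi := fun k => (h k).intervalIntegrable t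
  have hNN : (-N:ℝ) ≤ N := by linarith [Nat.cast_nonneg (α := ℝ) N]
  have key := integral_abs_sub_le (h n.1) (h n.2) hq₀ hM₀ hτ hB hd ht (s := -S)
    (m := 1 / ((p:ℝ) + 1)) (by positivity) (hgrid t ht)
  rw [hn₀, grid_end, ← hn₀] at key
  have e1 : ∫ x in (-N:ℝ)..N, |q n.1 t x - q n.2 t x| ≤
      ∫ x in X n.1 t (-S)..X n.1 t S, |q n.1 t x - q n.2 t x| :=
    intervalIntegral.integral_mono_interval (by linarith [(hfl n.1 (-S)).2]) hNN
      (by linarith [(hfl n.1 S).1]) (ae_of_all _ fun _ => abs_nonneg _)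
      ((hi _ _ _).sub (hi _ _ _)).abs
  have e2 : ∫ x in X n.1 t (-S)..X n.1 t S, |(|q n.1 t x| - |q n.2 t x|)| ≤
      ∫ x in (-N':ℝ)..N', |(|q n.1 t x| - |q n.2 t x|)| :=
    intervalIntegral.integral_mono_interval (by linarith [(hfl n.1 (-S)).1])
      ((h n.1).flow_mono t |>.monotone (by linarith [Nat.cast_nonneg (α := ℝ) S]))
      (by linarith [(hfl n.1 S).2]) (ae_of_all _ fun _ => abs_nonneg _)
      ((hi _ _ _).abs.sub (hi _ _ _).abs).abs
  have e3 := hu t ht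
  have e4 : 8 * B * (1 / ((p:ℝ) + 1)) ≤ 8 * B * θ := by gcongr
  linarith

end TransportedDensity

/-- A monotone bounded function dominating the increments of a function of bounded variation. -/
theorem exists_monotone_dominator {f : ℝ → ℝ} (hf : BoundedVariationOn f univ) :
    ∃ (τ : ℝ → ℝ) (B : ℝ), Monotone τ ∧ (∀ x, |τ x| ≤ B) ∧
      ∀ x y, x ≤ y → |f y - f x| ≤ τ y - τ x := by
  have hloc := hf.locallyBoundedVariationOn
  refine ⟨variationOnFromTo f univ 0, (eVariationOn f univ).toReal, ?_, fun x => ?_,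
    fun x y hxy => ?_⟩
  · rw [← monotoneOn_univ]
    exact variationOnFromTo.monotoneOn hloc (mem_univ 0)
  · have key : ∀ s : Set ℝ, |(eVariationOn f s).toReal| ≤ (eVariationOn f univ).toReal :=
      fun s => by
        rw [abs_of_nonneg ENNReal.toReal_nonneg]
        exact ENNReal.toReal_mono hf (eVariationOn.mono f (subset_univ s))
    unfold variationOnFromTo
    split_ifs
    · exact key _
    · rw [abs_neg]; exact key _
  · rw [← variationOnFromTo.add hloc (mem_univ 0) (mem_univ x) (mem_univ y), add_sub_cancel_left,
      variationOnFromTo.eq_of_le f univ hxy]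
    have h := eVariationOn.edist_le f (s := univ ∩ Icc x y) (x := y) (y := x)
      ⟨mem_univ _, right_mem_Icc.2 hxy⟩ ⟨mem_univ _, left_mem_Icc.2 hxy⟩
    have hle := ENNReal.toReal_mono (hloc x y (mem_univ _) (mem_univ _)) h
    rwa [edist_dist, ENNReal.toReal_ofReal dist_nonneg, Real.dist_eq] at hle

/-- Joint measurability of the exponential average. -/
theorem measurable_expAvg {η : ℝ} {q : ℝ → ℝ → ℝ} (hq : Measurable (uncurry q)) :
    Measurable fun p : ℝ × ℝ => expAvg η (fun y => |q p.1 y|) p.2 := by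
  have hm : Measurable fun z : (ℝ × ℝ) × ℝ => (Real.exp ((z.2 - z.1.2) / η) / η) * |q z.1.1 z.2| := by
    have h1 : Measurable fun z : (ℝ × ℝ) × ℝ => q z.1.1 z.2 :=
      hq.comp (g := uncurry q) ((measurable_fst.comp measurable_fst).prodMk measurable_snd)
    have h2 : Measurable fun z : (ℝ × ℝ) × ℝ => Real.exp ((z.2 - z.1.2) / η) / η := by fun_prop
    exact h2.mul (continuous_abs.measurable.comp h1)
  have hs : MeasurableSet {z : (ℝ × ℝ) × ℝ | z.2 ≤ z.1.2} :=
    measurableSet_le measurable_snd (measurable_snd.comp measurable_fst)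
  have h := ((hm.indicator hs).stronglyMeasurable.integral_prod_right' (ν := volume)).measurable
  have he : (fun p : ℝ × ℝ => expAvg η (fun y => |q p.1 y|) p.2) = fun p => ∫ y,
      indicator {z : (ℝ × ℝ) × ℝ | z.2 ≤ z.1.2}
        (fun z => (Real.exp ((z.2 - z.1.2) / η) / η) * |q z.1.1 z.2|) (p, y) := by
    funext p
    rw [expAvg, ← integral_indicator measurableSet_Iic]
    rfl
  rw [he]
  exact h

/-- A sequence which is Cauchy in `L¹_loc` uniformly in time has a subsequence converging
almost everywhere at each time and in `L¹_loc` uniformly in time. -/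
theorem exists_fast_limit {T M₀ : ℝ} {Q : ℕ → ℝ → ℝ → ℝ}
    (hmeas : ∀ k, Measurable (uncurry (Q k))) (hM₀ : 0 ≤ M₀)
    (hbdd : ∀ k, ∀ t ∈ Icc 0 T, ∀ᵐ x, |Q k t x| ≤ M₀)
    (hC : ∀ N : ℕ, ∀ ε > 0, ∀ᶠ n : ℕ × ℕ in atTop, ∀ t ∈ Icc 0 T,
      ∫ x in (-N:ℝ)..N, |Q n.1 t x - Q n.2 t x| ≤ ε) :
    ∃ ψ : ℕ → ℕ, StrictMono ψ ∧ ∃ q : ℝ → ℝ → ℝ, Measurable (uncurry q) ∧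
      (∀ t x, |q t x| ≤ M₀) ∧
      (∀ t ∈ Icc 0 T, ∀ᵐ x, Tendsto (fun k => Q (ψ k) t x) atTop (𝓝 (q t x))) ∧
      ∀ N : ℕ, ∀ ε > 0, ∀ᶠ k in atTop, ∀ t ∈ Icc 0 T,
        ∫ x in (-N:ℝ)..N, |Q (ψ k) t x - q t x| ≤ ε := by
  have hmt : ∀ k t, Measurable (Q k t) := fun k t => (hmeas k).comp measurable_prodMk_left
  have hintg : ∀ k m, ∀ t ∈ Icc 0 T, ∀ R : ℕ,
      IntegrableOn (fun x => Q k t x - Q m t x) (Ioc (-R:ℝ) R) := fun k m t ht R => by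
    refine Measure.integrableOn_of_bounded (M := M₀ + M₀) (by simp) ?_ ?_
    · exact ((hmt k t).sub (hmt m t)).aestronglyMeasurable
    · refine ae_restrict_of_ae ?_
      filter_upwards [hbdd k t ht, hbdd m t ht] with x h1 h2
      exact (norm_sub_le _ _).trans (add_le_add h1 h2)
  obtain ⟨ψ, hψ, hfast⟩ := extraction_forall_of_eventually'
    (P := fun N k => ∀ n m, k ≤ n → k ≤ m → ∀ t ∈ Icc 0 T,
      ∫ x in (-N:ℝ)..N, |Q n t x - Q m t x| ≤ (1 / 2) ^ (N + 1)) fun N => by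
      obtain ⟨⟨a, b⟩, hab⟩ := eventually_atTop.1 (hC N ((1 / 2) ^ (N + 1)) (by positivity))
      exact ⟨max a b, fun k hk n m hn hm =>
        hab (n, m) ⟨(le_max_left a b).trans (hk.trans hn), (le_max_right a b).trans (hk.trans hm)⟩⟩
  have hconv : ∀ t ∈ Icc 0 T, ∀ᵐ x, ∃ l, Tendsto (fun k => Q (ψ k) t x) atTop (𝓝 l) := by
    intro t ht
    have hR : ∀ R : ℕ, ∀ᵐ x ∂(volume.restrict (Ioc (-R:ℝ) R)),
        ∃ l, Tendsto (fun k => Q (ψ (k + R)) t x) atTop (𝓝 l) := fun R => by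
      refine Lp.ae_tendsto_of_cauchy_eLpNorm (p := 1) (B := fun N => (2⁻¹ : ENNReal) ^ N)
        (fun n => (hmt _ t).aestronglyMeasurable) le_rfl ?_ fun N n m hn hm => ?_
      · rw [ENNReal.tsum_geometric]; simp
      · have h1 := hfast (N + R) (ψ (n + R)) (ψ (m + R)) (hψ.monotone (by lia))
          (hψ.monotone (by lia)) t ht
        have h2 : ∫ x in Ioc (-R:ℝ) R, |Q (ψ (n + R)) t x - Q (ψ (m + R)) t x|
            ≤ (1 / 2) ^ (N + R + 1) := by
          refine le_trans ?_ h1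
          rw [intervalIntegral.integral_of_le (by linarith [Nat.cast_nonneg (α := ℝ) (N + R)])]
          refine setIntegral_mono_set (hintg _ _ t ht _).abs (ae_of_all _ fun x => abs_nonneg _)
            (Ioc_subset_Ioc ?_ ?_).eventuallyLE <;> push_cast <;>
            linarith [Nat.cast_nonneg (α := ℝ) N]
        rw [eLpNorm_one_eq_lintegral_enorm]
        have h3 := ofReal_integral_norm_eq_lintegral_enorm
          (hintg (ψ (n + R)) (ψ (m + R)) t ht R)
        refine (h3.symm.le.trans (ENNReal.ofReal_le_ofReal h2)).trans_lt ?_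
        rw [show (2⁻¹ : ENNReal) ^ N = ENNReal.ofReal ((1 / 2) ^ N) by
          rw [ENNReal.ofReal_pow (by norm_num), one_div, ENNReal.ofReal_inv_of_pos two_pos]; simp]
        refine (ENNReal.ofReal_lt_ofReal_iff (by positivity)).2 ?_
        exact pow_lt_pow_right_of_lt_one₀ (by norm_num) (by norm_num) (by lia)
    have hR' : ∀ R : ℕ, ∀ᵐ x, x ∈ Ioc (-R:ℝ) R →
        ∃ l, Tendsto (fun k => Q (ψ k) t x) atTop (𝓝 l) := fun R => by
      refine ((ae_restrict_iff' measurableSet_Ioc).1 (hR R)).mono fun x hx hxR => ?_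
      obtain ⟨l, hl⟩ := hx hxR
      exact ⟨l, (tendsto_add_atTop_iff_nat (f := fun k => Q (ψ k) t x) R).1 hl⟩
    refine (ae_all_iff.2 hR').mono fun x hx => ?_
    obtain ⟨R, hR⟩ := exists_nat_gt |x|
    rw [abs_lt] at hR
    exact hx R ⟨hR.1, hR.2.le⟩
  set q : ℝ → ℝ → ℝ := fun t x => max (-M₀) (min (limsup (fun k => Q (ψ k) t x) atTop) M₀) with hqd
  have hqm : Measurable (uncurry q) := by
    have h1 : Measurable fun p : ℝ × ℝ => limsup (fun k => Q (ψ k) p.1 p.2) atTop :=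
      Measurable.limsup fun k => hmeas (ψ k)
    exact measurable_const.max (h1.min measurable_const)
  have hqb : ∀ t x, |q t x| ≤ M₀ := fun t x => abs_le.2 (max_min_mem (by linarith) _)
  have hlim : ∀ t ∈ Icc 0 T, ∀ᵐ x, Tendsto (fun k => Q (ψ k) t x) atTop (𝓝 (q t x)) := by
    intro t ht
    filter_upwards [hconv t ht, ae_all_iff.2 fun k => hbdd (ψ k) t ht] with x ⟨l, hl⟩ hb
    have hl' : l ∈ Icc (-M₀) M₀ :=
      isClosed_Icc.mem_of_tendsto hl (Eventually.of_forall fun k => abs_le.1 (hb k))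
    have : q t x = l := by
      rw [hqd]; dsimp only; rw [hl.limsup_eq, max_min_of_mem hl']
    rwa [this]
  refine ⟨ψ, hψ, q, hqm, hqb, hlim, fun N ε hε => ?_⟩
  obtain ⟨⟨a, b⟩, hab⟩ := eventually_atTop.1 (hC N ε hε)
  filter_upwards [eventually_ge_atTop a] with k hk t ht
  have ht' : Tendsto (fun m => ∫ x in (-N:ℝ)..N, |Q (ψ k) t x - Q (ψ m) t x|) atTop
      (𝓝 (∫ x in (-N:ℝ)..N, |Q (ψ k) t x - q t x|)) := by
    refine intervalIntegral.tendsto_integral_filter_of_dominated_convergence (fun _ => M₀ + M₀)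
      (Eventually.of_forall fun m =>
        (continuous_abs.measurable.comp ((hmt (ψ k) t).sub (hmt (ψ m) t))).aestronglyMeasurable)
      (Eventually.of_forall fun m => ?_) intervalIntegrable_const ?_
    · filter_upwards [hbdd (ψ k) t ht, hbdd (ψ m) t ht] with x h1 h2 _
      rw [Real.norm_eq_abs, abs_abs]
      exact (abs_sub _ _).trans (add_le_add h1 h2)
    · filter_upwards [hlim t ht] with x hx _
      exact (tendsto_const_nhds.sub hx).abs
  exact le_of_tendsto ht' ((eventually_ge_atTop b).mono fun m hm =>
    hab (ψ k, ψ m) ⟨hk.trans (hψ.id_le k), hm.trans (hψ.id_le m)⟩ t ht)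

theorem IsCompact.exists_subset_Ioc_nat {K : Set ℝ} (hK : IsCompact K) :
    ∃ N : ℕ, K ⊆ Ioc (-N:ℝ) N := by
  obtain ⟨R, hR⟩ := hK.isBounded.exists_norm_le
  obtain ⟨N, hN⟩ := exists_nat_gt R
  refine ⟨N, fun x hx => ?_⟩
  have := abs_lt.1 ((hR x hx).trans_lt hN)
  exact ⟨this.1, this.2.le⟩

theorem setIntegral_le_intervalIntegral {K : Set ℝ} {f : ℝ → ℝ} {N : ℕ} (hK : K ⊆ Ioc (-N:ℝ) N)
    (hf : ∀ x, 0 ≤ f x) (hi : IntervalIntegrable f volume (-N) N) :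
    ∫ x in K, f x ≤ ∫ x in (-N:ℝ)..N, f x := by
  have hN : (-N:ℝ) ≤ N := by linarith [Nat.cast_nonneg (α := ℝ) N]
  rw [intervalIntegral.integral_of_le hN]
  exact setIntegral_mono_set ((intervalIntegrable_iff_integrableOn_Ioc_of_le hN).1 hi)
    (ae_of_all _ hf) hK.eventuallyLE

theorem intervalIntegrable_abs_sub {f g : ℝ → ℝ} {Mf Mg : ℝ} (hf : Measurable f)
    (hg : Measurable g) (hMf : ∀ x, |f x| ≤ Mf) (hMg : ∀ x, |g x| ≤ Mg) (a b : ℝ) :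
    IntervalIntegrable (fun x => |f x - g x|) volume a b :=
  intervalIntegrable_of_bounded (continuous_abs.measurable.comp (hf.sub hg)) (M := Mf + Mg)
    (fun x => by
      refine (abs_abs (f x - g x)).le.trans ?_
      exact (abs_sub _ _).trans (add_le_add (hMf x) (hMg x))) a b

/-- Continuity in time with values in `L¹_loc` is preserved by locally uniform limits. -/
theorem inSolutionClass_of_tendsto {T M₀ : ℝ} {Q : ℕ → ℝ → ℝ → ℝ} {q : ℝ → ℝ → ℝ}
    (hQ : ∀ k, InSolutionClass T (Q k)) (hq : Measurable (uncurry q)) (hM : ∀ t x, |q t x| ≤ M₀)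
    (hlim : ∀ N : ℕ, ∀ ε > 0, ∀ᶠ k in atTop, ∀ t ∈ Icc 0 T,
      ∫ x in (-N:ℝ)..N, |Q k t x - q t x| ≤ ε) : InSolutionClass T q := by
  refine ⟨hq, ⟨M₀, hM⟩, fun s hs K hK => ?_⟩
  obtain ⟨N, hN⟩ := hK.exists_subset_Ioc_nat
  have hN0 : (-N:ℝ) ≤ N := by linarith [Nat.cast_nonneg (α := ℝ) N]
  have hqt : ∀ t, Measurable (q t) := fun t => hq.comp measurable_prodMk_left
  rw [Metric.tendsto_nhds]
  intro ε hε
  obtain ⟨k, hk⟩ := (hlim N (ε / 4) (by positivity)).exists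
  obtain ⟨M, hMk⟩ := (hQ k).bdd
  have hQt : ∀ t, Measurable (Q k t) := fun t => (hQ k).meas.comp measurable_prodMk_left
  have hcont := (hQ k).timeCont s hs (Icc (-N:ℝ) N) isCompact_Icc
  filter_upwards [hcont.eventually (Iio_mem_nhds (show 0 < ε / 4 by positivity)),
    self_mem_nhdsWithin] with t ht htT
  rw [Real.dist_eq, sub_zero, abs_of_nonneg (integral_nonneg fun x => abs_nonneg _)]
  rw [integral_Icc_eq_integral_Ioc, ← intervalIntegral.integral_of_le hN0] at ht
  have i1 := intervalIntegrable_abs_sub (hQt t) (hqt t) (hMk t) (hM t) (-N) N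
  have i2 := intervalIntegrable_abs_sub (hQt s) (hqt s) (hMk s) (hM s) (-N) N
  have i3 := intervalIntegrable_abs_sub (hQt t) (hQt s) (hMk t) (hMk s) (-N) N
  have i4 := intervalIntegrable_abs_sub (hqt t) (hqt s) (hM t) (hM s) (-N) N
  calc ∫ x in K, |q t x - q s x| ≤ ∫ x in (-N:ℝ)..N, |q t x - q s x| :=
        setIntegral_le_intervalIntegral hN (fun x => abs_nonneg _) i4
    _ ≤ ∫ x in (-N:ℝ)..N, (|Q k t x - q t x| + |Q k t x - Q k s x| + |Q k s x - q s x|) := by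
        refine intervalIntegral.integral_mono hN0 i4 ((i1.add i3).add i2) fun x => ?_
        have h1 := abs_sub_le (q t x) (Q k t x) (q s x)
        have h2 := abs_sub_le (Q k t x) (Q k s x) (q s x)
        have h3 := abs_sub_comm (q t x) (Q k t x)
        dsimp only
        linarith
    _ = (∫ x in (-N:ℝ)..N, |Q k t x - q t x|) + (∫ x in (-N:ℝ)..N, |Q k t x - Q k s x|)
          + ∫ x in (-N:ℝ)..N, |Q k s x - q s x| := by
        rw [intervalIntegral.integral_add (i1.add i3) i2, intervalIntegral.integral_add i1 i3]
    _ < ε := by linarith [hk t htT, hk s hs]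

/-- Weak-star convergence from almost everywhere convergence at each time. -/
theorem tendsto_setIntegral_mul_of_ae {T M₀ : ℝ} {Q : ℕ → ℝ → ℝ → ℝ} {q : ℝ → ℝ → ℝ}
    (hQ : ∀ k, Measurable (uncurry (Q k))) (hq : Measurable (uncurry q))
    (hM : ∀ k, ∀ t ∈ Icc 0 T, ∀ᵐ x, |Q k t x| ≤ M₀)
    (hlim : ∀ t ∈ Icc 0 T, ∀ᵐ x, Tendsto (fun k => Q k t x) atTop (𝓝 (q t x)))
    {g : ℝ → ℝ → ℝ}
    (hg : Integrable (uncurry g) (volume.restrict (Ioo (0:ℝ) T ×ˢ (univ : Set ℝ)))) :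
    Tendsto (fun k => ∫ p : ℝ × ℝ in Ioo (0:ℝ) T ×ˢ (univ : Set ℝ), Q k p.1 p.2 * g p.1 p.2) atTop
      (𝓝 (∫ p : ℝ × ℝ in Ioo (0:ℝ) T ×ˢ (univ : Set ℝ), q p.1 p.2 * g p.1 p.2)) := by
  have hprod : (volume : Measure (ℝ × ℝ)).restrict (Ioo (0:ℝ) T ×ˢ (univ : Set ℝ))
      = (volume.restrict (Ioo (0:ℝ) T)).prod volume := by
    rw [Measure.volume_eq_prod, ← Measure.prod_restrict, Measure.restrict_univ]
  have hae : ∀ s : Set (ℝ × ℝ), MeasurableSet s → (∀ t ∈ Icc 0 T, ∀ᵐ x, (t, x) ∈ s) →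
      ∀ᵐ p ∂((volume : Measure (ℝ × ℝ)).restrict (Ioo (0:ℝ) T ×ˢ (univ : Set ℝ))), p ∈ s := by
    intro s hs h
    rw [hprod, Measure.ae_prod_mem_iff_ae_ae_mem hs]
    exact (ae_restrict_mem measurableSet_Ioo).mono fun t ht => h t (Ioo_subset_Icc_self ht)
  refine tendsto_integral_of_dominated_convergence (fun p => M₀ * |g p.1 p.2|)
    (fun k => (hQ k).aestronglyMeasurable.mul hg.aestronglyMeasurable) (hg.abs.const_mul M₀)
    (fun k => ?_) ?_
  · refine (hae {p | |uncurry (Q k) p| ≤ M₀}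
      (measurableSet_le (continuous_abs.measurable.comp (hQ k)) measurable_const) (hM k)).mono
      fun p hp => ?_
    rw [norm_mul]
    exact mul_le_mul_of_nonneg_right hp (norm_nonneg _)
  · refine (hae {p | Tendsto (fun k => uncurry (Q k) p) atTop (𝓝 (uncurry q p))}
      (measurableSet_tendsto_fun hQ hq) hlim).mono fun p hp => ?_
    exact Tendsto.mul_const _ hp

/-- The first derivatives of a test function are measurable, bounded and supported in a strip. -/
theorem IsTestFun.deriv_bounds {T : ℝ} {φ : ℝ → ℝ → ℝ} (hφ : IsTestFun T φ) :
    Measurable (fun p : ℝ × ℝ => deriv (fun s => φ s p.2) p.1) ∧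
    Measurable (fun p : ℝ × ℝ => deriv (fun y => φ p.1 y) p.2) ∧
    ∃ (A : ℝ) (N : ℕ), ∀ t x, |deriv (fun s => φ s x) t| ≤ A ∧ |deriv (fun y => φ t y) x| ≤ A ∧
      (x ∉ Ioc (-N:ℝ) N → deriv (fun s => φ s x) t = 0 ∧ deriv (fun y => φ t y) x = 0) := by
  set D := fderiv ℝ (uncurry φ) with hD
  have hDc : Continuous D := hφ.smooth.continuous_fderiv one_ne_zero
  have hDs : HasCompactSupport D := hφ.compSupp.fderiv ℝ
  have hdiff : ∀ p, HasFDerivAt (uncurry φ) (D p) p := fun p =>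
    (hφ.smooth.differentiable one_ne_zero p).hasFDerivAt
  have ha : ∀ t x, deriv (fun s => φ s x) t = D (t, x) (1, 0) := fun t x => by
    have h1 : HasDerivAt (fun s : ℝ => (s, x)) ((1:ℝ), (0:ℝ)) t :=
      (hasDerivAt_id t).prodMk (hasDerivAt_const t x)
    exact ((hdiff (t, x)).comp_hasDerivAt t h1).deriv
  have hb : ∀ t x, deriv (fun y => φ t y) x = D (t, x) (0, 1) := fun t x => by
    have h1 : HasDerivAt (fun y : ℝ => (t, y)) ((0:ℝ), (1:ℝ)) x :=
      (hasDerivAt_const x t).prodMk (hasDerivAt_id x)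
    exact ((hdiff (t, x)).comp_hasDerivAt x h1).deriv
  obtain ⟨A, hA⟩ := hDs.exists_bound_of_continuous hDc
  obtain ⟨N, hN⟩ := (IsCompact.image hDs continuous_snd).exists_subset_Ioc_nat
  simp only [ha, hb]
  refine ⟨(hDc.clm_apply continuous_const).measurable, (hDc.clm_apply continuous_const).measurable,
    A, N, fun t x => ⟨?_, ?_, fun hx => ?_⟩⟩
  · refine ((D (t, x)).le_opNorm_of_le (c := 1) ?_).trans ?_
    · simp [Prod.norm_def]
    · rw [mul_one]; exact hA _
  · refine ((D (t, x)).le_opNorm_of_le (c := 1) ?_).trans ?_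
    · simp [Prod.norm_def]
    · rw [mul_one]; exact hA _
  · have : D (t, x) = 0 := by
      by_contra h
      exact hx (hN ⟨(t, x), subset_tsupport _ h, rfl⟩)
    simp [this]

namespace TransportedDensity

variable {T M₀ B C : ℝ} {q₀ : ℝ → ℝ} {η : ℕ → ℝ} {q X : ℕ → ℝ → ℝ → ℝ} {qs : ℝ → ℝ → ℝ}

/-- Convergence of the exponential averages, uniformly in time. -/
theorem eventually_integral_abs_expAvg_sub_le
    (h : ∀ k, TransportedDensity T (η k) M₀ B C q₀ (q k) (X k)) (hη : Tendsto η atTop (𝓝 0))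
    (hqs : Measurable (uncurry qs)) (hM : ∀ t x, |qs t x| ≤ M₀)
    (hlim : ∀ N : ℕ, ∀ ε > 0, ∀ᶠ k in atTop, ∀ t ∈ Icc 0 T,
      ∫ x in (-N:ℝ)..N, |q k t x - qs t x| ≤ ε) (N : ℕ) {ε : ℝ} (hε : 0 < ε) :
    ∀ᶠ k in atTop, ∀ t ∈ Icc 0 T,
      ∫ x in (-N:ℝ)..N, abs (expAvg (η k) (fun y => |q k t y|) x - |qs t x|) ≤ ε := by
  have hN0 : (-N:ℝ) ≤ N := by linarith [Nat.cast_nonneg (α := ℝ) N]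
  have hqt : ∀ t, Measurable (qs t) := fun t => hqs.comp measurable_prodMk_left
  have h0 : Tendsto (fun k => 2 * B * η k) atTop (𝓝 0) := by
    simpa using hη.const_mul (2 * B)
  filter_upwards [hlim N (ε / 2) (by positivity), h0.eventually (Iio_mem_nhds (half_pos hε))]
    with k hk hηk t ht
  obtain ⟨M, hMk⟩ := (h k).bdd
  have hW : Measurable (expAvg (η k) fun y => |q k t y|) := ((h k).continuous_expAvg t).measurable
  have hWb : ∀ x, |expAvg (η k) (fun y => |q k t y|) x| ≤ M₀ := fun x => by
    have := (h k).expAvg_mem ht x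
    rw [abs_of_nonneg this.1]; exact this.2
  have habs : Measurable fun x => |q k t x| := continuous_abs.measurable.comp ((h k).meas t)
  have habs' : Measurable fun x => |qs t x| := continuous_abs.measurable.comp (hqt t)
  have i1 := intervalIntegrable_abs_sub habs hW (Mf := M) (by simpa using hMk t) hWb (-N) N
  have i2 := intervalIntegrable_abs_sub ((h k).meas t) (hqt t) (hMk t) (hM t) (-N) N
  have i3 := intervalIntegrable_abs_sub hW habs' (Mg := M₀) hWb (by simpa using hM t) (-N) N
  refine (intervalIntegral.integral_mono hN0 i3 (i1.add i2) fun x => ?_).trans ?_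
  · have h1 := abs_sub_le (expAvg (η k) (fun y => |q k t y|) x) |q k t x| |qs t x|
    have h2 := abs_abs_sub_abs_le_abs_sub (q k t x) (qs t x)
    have h3 := abs_sub_comm (expAvg (η k) (fun y => |q k t y|) x) |q k t x|
    dsimp only [Pi.add_apply]
    linarith
  · refine (intervalIntegral.integral_add i1 i2).le.trans ?_
    have := (h k).integral_abs_sub_expAvg_le ht hN0
    linarith [hk t ht]

/-- Passage to the limit in the weak formulation. -/
theorem isWeakSolutionLocal {V : ℝ → ℝ} (hV : LocallyLipschitz V) (hVm : Monotone V)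
    (h : ∀ k, TransportedDensity T (η k) M₀ B C q₀ (q k) (X k))
    (hη : Tendsto η atTop (𝓝 0)) (hq : ∀ k, Measurable (uncurry (q k)))
    (hw : ∀ k, IsWeakSolutionNonlocal T V (expKernel (η k)) q₀ (q k))
    (hqs : Measurable (uncurry qs)) (hM : ∀ t x, |qs t x| ≤ M₀)
    (hlim : ∀ N : ℕ, ∀ ε > 0, ∀ᶠ k in atTop, ∀ t ∈ Icc 0 T,
      ∫ x in (-N:ℝ)..N, |q k t x - qs t x| ≤ ε) : IsWeakSolutionLocal T V q₀ qs := by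
  intro φ hφ
  obtain ⟨ham, hbm, A, N, hAN⟩ := hφ.deriv_bounds
  set a : ℝ → ℝ → ℝ := fun t x => deriv (fun s => φ s x) t with ha
  set b : ℝ → ℝ → ℝ := fun t x => deriv (fun y => φ t y) x with hb
  set W : ℕ → ℝ → ℝ → ℝ := fun k t x => expAvg (η k) (fun y => |q k t y|) x with hW
  have hA0 : 0 ≤ A := (abs_nonneg _).trans (hAN 0 0).1
  have hM₀ : 0 ≤ M₀ := (abs_nonneg _).trans (hM 0 0)
  have hN0 : (-N:ℝ) ≤ N := by linarith [Nat.cast_nonneg (α := ℝ) N]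
  obtain ⟨L, hL⟩ := (hV.locallyLipschitzOn (s := Icc 0 M₀)).exists_lipschitzOnWith_of_compact
    isCompact_Icc
  set c := |V 0| + |V M₀| with hc
  have hVc : ∀ w ∈ Icc 0 M₀, |V w| ≤ c := fun w hw' => by
    have h1 := hVm hw'.1
    have h2 := hVm hw'.2
    rw [abs_le]
    constructor
    · linarith [neg_abs_le (V 0), abs_nonneg (V M₀)]
    · linarith [le_abs_self (V M₀), abs_nonneg (V 0)]
  have hWmem : ∀ k, ∀ t ∈ Icc 0 T, ∀ x, W k t x ∈ Icc 0 M₀ := fun k t ht x => (h k).expAvg_mem ht x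
  have hqmem : ∀ t x, |qs t x| ∈ Icc 0 M₀ := fun t x => ⟨abs_nonneg _, hM t x⟩
  have hcoef : ∀ t x w, w ∈ Icc 0 M₀ → |a t x + b t x * V w| ≤ A + A * c := fun t x w hw' => by
    refine (abs_add_le _ _).trans (add_le_add (hAN t x).1 ?_)
    rw [abs_mul]
    exact mul_le_mul (hAN t x).2.1 (hVc w hw') (abs_nonneg _) hA0
  have hloc : ∀ (u : ℝ → ℝ → ℝ) (w : ℝ → ℝ → ℝ) (t : ℝ),
      ∫ x, u t x * (a t x + b t x * V (w t x))
        = ∫ x in (-N:ℝ)..N, u t x * (a t x + b t x * V (w t x)) := fun u w t => by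
    rw [intervalIntegral.integral_of_le hN0]
    refine (setIntegral_eq_integral_of_forall_compl_eq_zero fun x hx => ?_).symm
    have := (hAN t x).2.2 hx
    rw [show a t x = 0 from this.1, show b t x = 0 from this.2]; ring
  have hWm : ∀ k, Measurable (uncurry (W k)) := fun k => measurable_expAvg (hq k)
  have hfm : ∀ k, Measurable fun p : ℝ × ℝ =>
      q k p.1 p.2 * (a p.1 p.2 + b p.1 p.2 * V (W k p.1 p.2)) := fun k =>
    (hq k).mul (ham.add (hbm.mul (hVm.measurable.comp (hWm k))))
  have hfsm : Measurable fun p : ℝ × ℝ =>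
      qs p.1 p.2 * (a p.1 p.2 + b p.1 p.2 * V |qs p.1 p.2|) :=
    hqs.mul (ham.add (hbm.mul (hVm.measurable.comp (continuous_abs.measurable.comp hqs))))
  have hslice : ∀ t, ∀ x, |qs t x * (a t x + b t x * V |qs t x|)| ≤ M₀ * (A + A * c) :=
    fun t x => by
      rw [abs_mul]
      exact mul_le_mul (hM t x) (hcoef t x _ (hqmem t x)) (abs_nonneg _) hM₀
  have hpt : ∀ t ∈ Icc 0 T, Tendsto (fun k => ∫ x, q k t x * (a t x + b t x * V (W k t x))) atTop
      (𝓝 (∫ x, qs t x * (a t x + b t x * V |qs t x|))) := by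
    intro t ht
    have e1 : Tendsto (fun k => ∫ x in (-N:ℝ)..N, |q k t x - qs t x|) atTop (𝓝 0) := by
      rw [Metric.tendsto_nhds]
      intro ε hε
      filter_upwards [hlim N (ε / 2) (half_pos hε)] with k hk
      rw [Real.dist_eq, sub_zero,
        abs_of_nonneg (intervalIntegral.integral_nonneg hN0 fun x _ => abs_nonneg _)]
      linarith [hk t ht]
    have e2 : Tendsto (fun k => ∫ x in (-N:ℝ)..N, abs (W k t x - |qs t x|)) atTop (𝓝 0) := by
      rw [Metric.tendsto_nhds]
      intro ε hε
      filter_upwards [eventually_integral_abs_expAvg_sub_le h hη hqs hM hlim N (half_pos hε)]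
        with k hk
      rw [Real.dist_eq, sub_zero,
        abs_of_nonneg (intervalIntegral.integral_nonneg hN0 fun x _ => abs_nonneg _)]
      linarith [hk t ht]
    have e3 := (e1.const_mul (A + A * c)).add (e2.const_mul (M₀ * (A * L)))
    rw [mul_zero, mul_zero, add_zero] at e3
    rw [tendsto_iff_dist_tendsto_zero]
    refine squeeze_zero (fun _ => dist_nonneg) (fun k => ?_) e3
    obtain ⟨M, hMk⟩ := (h k).bdd
    have hqt : Measurable (qs t) := hqs.comp measurable_prodMk_left
    have i1 := intervalIntegrable_abs_sub ((h k).meas t) hqt (hMk t) (hM t) (-N) N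
    have i2 := intervalIntegrable_abs_sub (f := W k t) (g := fun x => |qs t x|) (Mf := M₀)
      (Mg := M₀) ((hWm k).comp measurable_prodMk_left) (continuous_abs.measurable.comp hqt)
      (fun x => by rw [abs_of_nonneg (hWmem k t ht x).1]; exact (hWmem k t ht x).2)
      (by simpa using hM t) (-N) N
    have j1 : IntervalIntegrable (fun x => q k t x * (a t x + b t x * V (W k t x))) volume (-N) N :=
      intervalIntegrable_of_bounded ((hfm k).comp measurable_prodMk_left) (M := M * (A + A * c))
        (fun x => by
          refine (abs_mul _ _).le.trans ?_
          exact mul_le_mul (hMk t x) (hcoef t x _ (hWmem k t ht x)) (abs_nonneg _)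
            ((abs_nonneg _).trans (hMk t x))) _ _
    have j2 : IntervalIntegrable (fun x => qs t x * (a t x + b t x * V |qs t x|)) volume (-N) N :=
      intervalIntegrable_of_bounded (hfsm.comp measurable_prodMk_left) (hslice t) _ _
    rw [Real.dist_eq, hloc (q k) (W k) t, hloc qs (fun t x => |qs t x|) t,
      ← intervalIntegral.integral_sub j1 j2, ← intervalIntegral.integral_const_mul,
      ← intervalIntegral.integral_const_mul,
      ← intervalIntegral.integral_add (i1.const_mul _) (i2.const_mul _)]
    refine (intervalIntegral.abs_integral_le_integral_abs hN0).trans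
      (intervalIntegral.integral_mono hN0 (j1.sub j2).abs
        ((i1.const_mul _).add (i2.const_mul _)) fun x => ?_)
    have hVL : abs (V (W k t x) - V |qs t x|) ≤ L * abs (W k t x - |qs t x|) := by
      have := hL.dist_le_mul _ (hWmem k t ht x) _ (hqmem t x)
      rwa [Real.dist_eq, Real.dist_eq] at this
    have hsplit : q k t x * (a t x + b t x * V (W k t x)) - qs t x * (a t x + b t x * V |qs t x|)
        = (a t x + b t x * V (W k t x)) * (q k t x - qs t x)
          + qs t x * (b t x * (V (W k t x) - V |qs t x|)) := by ring
    dsimp only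
    rw [hsplit]
    refine (abs_add_le _ _).trans (add_le_add ?_ ?_)
    · rw [abs_mul]
      exact mul_le_mul_of_nonneg_right (hcoef t x _ (hWmem k t ht x)) (abs_nonneg _)
    · rw [abs_mul, abs_mul, mul_assoc, mul_assoc]
      exact mul_le_mul (hM t x) (mul_le_mul (hAN t x).2.1 hVL (abs_nonneg _) hA0)
        (by positivity) hM₀
  have hmain : Tendsto (fun k => ∫ t in Ioo (0:ℝ) T, ∫ x, q k t x * (a t x + b t x * V (W k t x)))
      atTop (𝓝 (∫ t in Ioo (0:ℝ) T, ∫ x, qs t x * (a t x + b t x * V |qs t x|))) := by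
    refine tendsto_integral_of_dominated_convergence
      (fun _ => M₀ * (A + A * c) * |(N:ℝ) - (-N)|)
      (fun k => ((hfm k).stronglyMeasurable.integral_prod_right' (ν := volume)).aestronglyMeasurable)
      (integrableOn_const (by simp)) (fun k => ?_) ?_
    · filter_upwards [ae_restrict_mem measurableSet_Ioo] with t ht
      have ht' := Ioo_subset_Icc_self ht
      rw [hloc (q k) (W k) t]
      refine intervalIntegral.norm_integral_le_of_norm_le_const_ae ?_
      filter_upwards [(h k).ae_abs_le t ht'] with x hx _
      rw [norm_mul]
      exact mul_le_mul hx (hcoef t x _ (hWmem k t ht' x)) (norm_nonneg _) hM₀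
    · filter_upwards [ae_restrict_mem measurableSet_Ioo] with t ht
      exact hpt t (Ioo_subset_Icc_self ht)
  exact tendsto_nhds_unique (hmain.add_const _)
    (tendsto_const_nhds.congr fun k => (hw k φ hφ).symm)

end TransportedDensity

/-- Lemma 4.2, convergence to a weak solution of the local
equation. -/
theorem convergence_to_weak_local_solution
    (T : ℝ) (hT : 0 < T)
    (V : ℝ → ℝ) (hV : LocallyLipschitz V) (hVmono : Monotone V)
    (q₀ : ℝ → ℝ) (hq₀meas : Measurable q₀) (hq₀bdd : ∃ M : ℝ, ∀ x, |q₀ x| ≤ M)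
    (hq₀BV : BoundedVariationOn q₀ univ)
    (q : ℝ → ℝ → ℝ → ℝ)
    (hq : ∀ η : ℝ, 0 < η →
      InSolutionClass T (q η) ∧ IsWeakSolutionNonlocal T V (expKernel η) q₀ (q η)) :
    ∀ ηk : ℕ → ℝ, (∀ k, 0 < ηk k) → Tendsto ηk atTop (nhds 0) →
      ∃ ψ : ℕ → ℕ, StrictMono ψ ∧
        ∃ qstar : ℝ → ℝ → ℝ, InSolutionClass T qstar ∧
          -- (i) uniform-in-time local L¹ convergence of the nonlocal terms to |q*|
          (∀ K : Set ℝ, IsCompact K → ∀ δ : ℝ, 0 < δ →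
            ∃ N : ℕ, ∀ j ≥ N, ∀ t ∈ Icc (0:ℝ) T,
              (∫ x in K,
                abs (nonlocalTerm (expKernel (ηk (ψ j))) (q (ηk (ψ j))) t x - |qstar t x|))
                ≤ δ) ∧
          -- (ii) weak-star convergence in L^∞(Ω_T)
          (∀ g : ℝ → ℝ → ℝ,
            Integrable (uncurry g) (volume.restrict (Ioo (0:ℝ) T ×ˢ (univ : Set ℝ))) →
            Tendsto
              (fun j => ∫ p : ℝ × ℝ in Ioo (0:ℝ) T ×ˢ (univ : Set ℝ),
                q (ηk (ψ j)) p.1 p.2 * g p.1 p.2)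
              atTop
              (nhds (∫ p : ℝ × ℝ in Ioo (0:ℝ) T ×ˢ (univ : Set ℝ),
                qstar p.1 p.2 * g p.1 p.2))) ∧
          -- (iii) q* is a weak solution of the local conservation law
          IsWeakSolutionLocal T V q₀ qstar := by
  intro ηk hηk hη0
  obtain ⟨M₀, hM₀⟩ := hq₀bdd
  obtain ⟨τ, B, hτ, hB, hd⟩ := exists_monotone_dominator hq₀BV
  have hB0 : 0 ≤ B := (abs_nonneg _).trans (hB 0)
  have hM₀0 : 0 ≤ M₀ := (abs_nonneg _).trans (hM₀ 0)
  set C := |V 0| + |V M₀| with hCdef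
  have hC : 0 ≤ C := by positivity
  choose X hX using fun k => exists_transportedDensity hT (hηk k) hV hVmono hq₀meas hM₀ hτ hB hd
    (hq _ (hηk k)).1 (hq _ (hηk k)).2
  obtain ⟨ψ₁, hψ₁, hflow⟩ := TransportedDensity.exists_subseq_flow hT hC hX
    (ι := ℕ × ℕ × ℕ) fun i => -(i.1:ℝ) + i.2.2 * (1 / ((i.2.1:ℝ) + 1))
  have hcauchy := TransportedDensity.eventually_integral_abs_sub_le hC hB0 (fun k => hX (ψ₁ k))
    (hη0.comp hψ₁.tendsto_atTop) hq₀meas hM₀ hτ hB hd fun S p j ε hε => hflow (S, p, j) ε hε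
  obtain ⟨ψ₂, hψ₂, qstar, hqm, hqb, hae, hlim⟩ := exists_fast_limit
    (Q := fun k => q (ηk (ψ₁ k))) (fun k => (hq _ (hηk _)).1.meas) hM₀0
    (fun k => (hX (ψ₁ k)).ae_abs_le) fun N ε hε => hcauchy N hε
  have hψ : StrictMono (ψ₁ ∘ ψ₂) := hψ₁.comp hψ₂
  have hη := hη0.comp hψ.tendsto_atTop
  have htd := fun k => hX ((ψ₁ ∘ ψ₂) k)
  refine ⟨ψ₁ ∘ ψ₂, hψ, qstar,
    inSolutionClass_of_tendsto (fun k => (hq _ (hηk ((ψ₁ ∘ ψ₂) k))).1) hqm hqb hlim,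
    fun K hK δ hδ => ?_, fun g hg => ?_, ?_⟩
  · obtain ⟨N, hN⟩ := hK.exists_subset_Ioc_nat
    obtain ⟨k₀, hk₀⟩ := eventually_atTop.1
      (TransportedDensity.eventually_integral_abs_expAvg_sub_le htd hη hqm hqb hlim N hδ)
    refine ⟨k₀, fun j hj t ht => le_trans ?_ (hk₀ j hj t ht)⟩
    refine setIntegral_le_intervalIntegral hN (fun x => abs_nonneg _) ?_
    refine intervalIntegrable_abs_sub (f := nonlocalTerm (expKernel (ηk ((ψ₁ ∘ ψ₂) j))) (q (ηk ((ψ₁ ∘ ψ₂) j))) t) (g := fun x => |qstar t x|)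
      (Mf := M₀) (Mg := M₀) ((htd j).continuous_expAvg t).measurable
      (continuous_abs.measurable.comp (hqm.comp measurable_prodMk_left)) (fun x => ?_)
      (by simpa using hqb t) _ _
    have hmem := (htd j).expAvg_mem ht x
    exact (abs_of_nonneg hmem.1).le.trans hmem.2
  · exact tendsto_setIntegral_mul_of_ae (fun k => (hq _ (hηk _)).1.meas) hqm
      (fun k => (htd k).ae_abs_le) hae hg
  · exact TransportedDensity.isWeakSolutionLocal hV hVmono htd hη
      (fun k => (hq _ (hηk _)).1.meas) (fun k => (hq _ (hηk _)).2) hqm hqb hlim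

end
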